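/- Fix ε > 0. Let A, B, C ∈ ℝ^3 with all coordinates exceeding 1, and write A = A_1A_2A_3, B = B_1B_2B_3, C = C_1C_2C_3. Let M(A,B,C) be the number of triples (a,b,c) of primitive vectors in ℤ^3, each with all coordinates nonzero, such that: a_1b_1c_1^2 + a_2b_2c_2^2 + a_3b_3c_3^2 = 0; |a_i| ≤ A_i, |b_i| ≤ B_i, |c_i| ≤ C_i for i = 1,2,3; gcd(a_i, c_j) = 1 and gcd(c_i, c_j) = 1 whenever i ≠ j; a_1a_2a_3 is squarefree; and gcd(a_i, b_j, b_k) = 1 for every permutation {i,j,k} of {1,2,3}. Then M(A,B,C) ≪_ε A^{2/3}B^{2/3}C^{1/3} + σ·τ·A·B^{1/2}·C^{1/2}, where σ = 1 + min{A,B}^ε / min_{i≠j}(B_iB_j)^{1/16} and τ = 1 + (log B) / min_{i≠j}(B_iB_j)^{1/16}, the implied constant depending only on ε. -/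

import Mathlib

section

open Finset

open scoped NumberTheorySymbols

theorem card_le_of_det_gap_aux {α : Type*} (S : Finset α) (u v : α → ℝ) (X Y δ : ℝ)
    (hX : 0 < X) (hY : 0 < Y) (hδ : 0 < δ)
    (hu : ∀ s ∈ S, |u s| * Y ≤ |v s| * X) (hv : ∀ s ∈ S, |v s| ≤ Y) (hv0 : ∀ s ∈ S, v s ≠ 0)
    (hgap : ∀ s ∈ S, ∀ t ∈ S, u s * v t - u t * v s ≠ 0 → δ ≤ |u s * v t - u t * v s|)
    (hpar : ∀ s ∈ S, ∀ T ⊆ S, (∀ t ∈ T, u s * v t - u t * v s = 0) → #T ≤ 2) :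
    (#S : ℝ) ≤ 6 + 4 * (X * Y / δ) := by
  classical
  set n : ℕ := ⌊X * Y / δ⌋₊ + 1 with hn
  have hn0 : (0 : ℝ) < n := by rw [hn]; positivity
  have hnlt : X * Y / δ < n := by rw [hn]; push_cast; exact Nat.lt_floor_add_one _
  have hnle : (n : ℝ) ≤ X * Y / δ + 1 := by
    rw [hn]; push_cast; gcongr; exact Nat.floor_le (by positivity)
  set f : α → ℤ := fun s => ⌊u s * Y / (v s * X) * n⌋ with hf
  have habs : ∀ s ∈ S, |u s * Y / (v s * X)| ≤ 1 := by
    intro s hs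
    have := hu s hs
    have h0 : 0 < |v s| := abs_pos.mpr (hv0 s hs)
    rw [abs_div, abs_mul, abs_mul, abs_of_pos hX, abs_of_pos hY, div_le_one (by positivity)]
    exact this
  have hmaps : ∀ s ∈ S, f s ∈ Finset.Icc (-(n : ℤ)) n := by
    intro s hs
    have h1 := abs_le.mp (habs s hs)
    rw [Finset.mem_Icc, hf]
    constructor
    · rw [Int.le_floor]; push_cast; nlinarith [h1.1]
    · have : ((⌊u s * Y / (v s * X) * n⌋ : ℤ) : ℝ) ≤ ((n : ℤ) : ℝ) := by
        refine (Int.floor_le _).trans ?_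
        push_cast; nlinarith [h1.2]
      exact_mod_cast this
  have hfib : ∀ k ∈ Finset.Icc (-(n : ℤ)) n, #{s ∈ S | f s = k} ≤ 2 := by
    intro k _
    rcases Finset.eq_empty_or_nonempty {s ∈ S | f s = k} with h | ⟨s, hs⟩
    · simp [h]
    · have hsS := (Finset.mem_filter.mp hs).1
      have hsk := (Finset.mem_filter.mp hs).2
      refine hpar s hsS _ (Finset.filter_subset _ _) ?_
      intro t ht
      have htS := (Finset.mem_filter.mp ht).1
      have htk := (Finset.mem_filter.mp ht).2
      by_contra hne
      have hg := hgap s hsS t htS hne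
      have hd : |u s * Y / (v s * X) * n - u t * Y / (v t * X) * n| < 1 :=
        Int.abs_sub_lt_one_of_floor_eq_floor (hsk.trans htk.symm)
      have hvs := hv0 s hsS
      have hvt := hv0 t htS
      have e : u s * v t - u t * v s =
          (u s * Y / (v s * X) * n - u t * Y / (v t * X) * n) * (v s * v t * X / (Y * n)) := by
        field_simp
      have hvv : |v s * v t * X / (Y * n)| ≤ X * Y / n := by
        rw [abs_div, abs_mul, abs_mul, abs_of_pos hX, abs_of_pos (show 0 < Y * n by positivity)]
        rw [div_le_div_iff₀ (by positivity) (by positivity)]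
        have : |v s| * |v t| ≤ Y * Y :=
          mul_le_mul (hv s hsS) (hv t htS) (abs_nonneg _) hY.le
        have h3 : 0 ≤ X * n := by positivity
        nlinarith
      rw [e, abs_mul] at hg
      have h4 : |u s * Y / (v s * X) * n - u t * Y / (v t * X) * n| * |v s * v t * X / (Y * n)|
          ≤ 1 * (X * Y / n) := by gcongr
      have h5 : X * Y / n < δ := by
        rw [div_lt_iff₀ hn0]; rw [div_lt_iff₀ hδ] at hnlt; linarith
      linarith
  have hc := Finset.card_le_mul_card_image_of_maps_to hmaps 2 hfib
  rw [Int.card_Icc] at hc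
  have : #S ≤ 2 * (2 * n + 1) := by
    refine hc.trans (le_of_eq ?_); congr 1; omega
  have h6 : (#S : ℝ) ≤ 2 * (2 * n + 1) := by exact_mod_cast this
  linarith

/-- Points of a bounded planar region whose pairwise determinants either vanish or exceed `δ`. -/
theorem card_le_of_det_gap {α : Type*} (S : Finset α) (u v : α → ℝ) (X Y δ : ℝ)
    (hX : 0 < X) (hY : 0 < Y) (hδ : 0 < δ)
    (hu : ∀ s ∈ S, |u s| ≤ X) (hv : ∀ s ∈ S, |v s| ≤ Y) (h0 : ∀ s ∈ S, u s ≠ 0 ∨ v s ≠ 0)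
    (hgap : ∀ s ∈ S, ∀ t ∈ S, u s * v t - u t * v s ≠ 0 → δ ≤ |u s * v t - u t * v s|)
    (hpar : ∀ s ∈ S, ∀ T ⊆ S, (∀ t ∈ T, u s * v t - u t * v s = 0) → #T ≤ 2) :
    (#S : ℝ) ≤ 12 + 8 * (X * Y / δ) := by
  classical
  have h1 := card_le_of_det_gap_aux {s ∈ S | |u s| * Y ≤ |v s| * X} u v X Y δ hX hY hδ
    (by simp +contextual) (fun s hs => hv s (Finset.mem_filter.mp hs).1)
    (by
      intro s hs hv0
      obtain ⟨hs, h⟩ := Finset.mem_filter.mp hs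
      rw [hv0] at h
      have : u s ≠ 0 := by have := h0 s hs; tauto
      have : 0 < |u s| * Y := by positivity
      simp at h; linarith)
    (fun s hs t ht => hgap s (Finset.mem_filter.mp hs).1 t (Finset.mem_filter.mp ht).1)
    (fun s hs T hT => hpar s (Finset.mem_filter.mp hs).1 T (hT.trans (Finset.filter_subset _ _)))
  have h2 := card_le_of_det_gap_aux {s ∈ S | ¬ |u s| * Y ≤ |v s| * X} v u Y X δ hY hX hδ
    (fun s hs => by have := (Finset.mem_filter.mp hs).2; linarith)
    (fun s hs => hu s (Finset.mem_filter.mp hs).1)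
    (by
      intro s hs hv0
      obtain ⟨hs, h⟩ := Finset.mem_filter.mp hs
      rw [hv0] at h
      apply h; simp; positivity)
    (fun s hs t ht h => by
      have := hgap t (Finset.mem_filter.mp ht).1 s (Finset.mem_filter.mp hs).1
        (by contrapose! h; linarith)
      rwa [show v s * u t - v t * u s = u t * v s - u s * v t by ring])
    (fun s hs T hT h => hpar s (Finset.mem_filter.mp hs).1 T
      (hT.trans (Finset.filter_subset _ _)) (fun t ht => by linarith [h t ht]))
  have h3 := Finset.card_filter_add_card_filter_not (s := S) (fun s => |u s| * Y ≤ |v s| * X)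
  have h4 : (#S : ℝ) = #{s ∈ S | |u s| * Y ≤ |v s| * X} + #{s ∈ S | ¬ |u s| * Y ≤ |v s| * X} := by
    exact_mod_cast h3.symm
  rw [h4]
  rw [mul_comm Y X] at h2
  linarith

/-- The factor `2` (or `4` at the prime `2`) for every prime divisor of `q`. -/
def sqrtBound (q : ℕ) : ℕ := ∏ p ∈ q.primeFactors, if p = 2 then 4 else 2

theorem sqrtBound_le (q : ℕ) : sqrtBound q ≤ 4 * 2 ^ #(q.primeFactors.erase 2) := by
  unfold sqrtBound
  by_cases h : 2 ∈ q.primeFactors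
  · rw [← Finset.mul_prod_erase _ _ h, if_pos rfl]
    gcongr
    refine (Finset.prod_le_pow_card _ _ 2 ?_)
    intro p hp
    rw [if_neg (Finset.ne_of_mem_erase hp)]
  · rw [Finset.erase_eq_of_notMem h]
    refine (Finset.prod_le_pow_card _ _ 2 ?_).trans (by omega)
    intro p hp
    rw [if_neg (by rintro rfl; exact h hp)]

theorem card_sqrt_odd_prime_pow (p k : ℕ) (hp : p.Prime) (hp2 : p ≠ 2) (u : ZMod (p ^ k))
    (hu : IsUnit u) : Nat.card {x : ZMod (p ^ k) // x ^ 2 = u} ≤ 2 := by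
  have : NeZero (p ^ k) := ⟨pow_ne_zero _ hp.ne_zero⟩
  rcases isEmpty_or_nonempty {x : ZMod (p ^ k) // x ^ 2 = u} with h | ⟨⟨y, hy⟩⟩
  · simp
  · have key : ∀ x : ZMod (p ^ k), x ^ 2 = u → x = y ∨ x = -y := by
      intro x hx
      obtain ⟨X, rfl⟩ := ZMod.intCast_surjective x
      obtain ⟨Y, rfl⟩ := ZMod.intCast_surjective y
      have hYu : IsUnit ((Y : ZMod (p ^ k))) := by
        have : IsUnit ((Y : ZMod (p ^ k)) ^ 2) := hy ▸ hu
        exact (isUnit_pow_iff two_ne_zero).mp this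
      rcases Nat.eq_zero_or_pos k with rfl | hk
      · left
        have : Subsingleton (ZMod (p ^ 0)) := by rw [pow_zero]; infer_instance
        exact Subsingleton.elim _ _
      have hYp : ¬ (p : ℤ) ∣ Y := by
        intro hd
        rw [ZMod.coe_int_isUnit_iff_isCoprime] at hYu
        have h1 : (p : ℤ) ∣ ((p ^ k : ℕ) : ℤ) := by
          push_cast; exact dvd_pow_self _ hk.ne'
        have := hYu.isUnit_of_dvd' h1 hd
        exact (Nat.prime_iff_prime_int.mp hp).not_isUnit this
      have hdvd : ((p : ℤ) ^ k) ∣ (X - Y) * (X + Y) := by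
        have : ((X ^ 2 - Y ^ 2 : ℤ) : ZMod (p ^ k)) = 0 := by
          push_cast; rw [hx, hy, sub_self]
        rw [ZMod.intCast_zmod_eq_zero_iff_dvd] at this
        push_cast at this
        convert this using 1; ring
      have hpi := Nat.prime_iff_prime_int.mp hp
      have h2 : ¬ (p : ℤ) ∣ 2 := by
        intro h
        have : p ∣ 2 := by exact_mod_cast h
        exact hp2 ((Nat.prime_dvd_prime_iff_eq hp Nat.prime_two).mp this)
      by_cases ha : (p : ℤ) ∣ X - Y
      · have hb : ¬ (p : ℤ) ∣ X + Y := by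
          intro hb
          have : (p : ℤ) ∣ 2 * Y := by
            have := dvd_sub hb ha; rwa [show X + Y - (X - Y) = 2 * Y by ring] at this
          rcases hpi.dvd_or_dvd this with h | h
          exacts [h2 h, hYp h]
        left
        have hc : IsCoprime ((p : ℤ) ^ k) (X + Y) :=
          (IsCoprime.pow_left ((hpi.coprime_iff_not_dvd).mpr hb))
        have := hc.dvd_of_dvd_mul_right hdvd
        have h3 : ((X - Y : ℤ) : ZMod (p ^ k)) = 0 := by
          rw [ZMod.intCast_zmod_eq_zero_iff_dvd]; push_cast; exact this
        push_cast at h3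
        exact sub_eq_zero.mp h3
      · right
        have hc : IsCoprime ((p : ℤ) ^ k) (X - Y) :=
          (IsCoprime.pow_left ((hpi.coprime_iff_not_dvd).mpr ha))
        have := hc.dvd_of_dvd_mul_left hdvd
        have h3 : ((X + Y : ℤ) : ZMod (p ^ k)) = 0 := by
          rw [ZMod.intCast_zmod_eq_zero_iff_dvd]; push_cast; exact this
        push_cast at h3
        exact eq_neg_of_add_eq_zero_left h3
    have : {x : ZMod (p ^ k) | x ^ 2 = u} ⊆ (({y, -y} : Finset (ZMod (p ^ k))) : Set _) := by
      intro x hx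
      have := key x hx
      simpa using this
    have h2 := Set.ncard_le_ncard this (Finset.finite_toSet _)
    rw [Set.ncard_coe_finset] at h2
    exact h2.trans Finset.card_le_two

theorem card_sqrt_two_pow (k : ℕ) (u : ZMod (2 ^ k))
    (hu : IsUnit u) : Nat.card {x : ZMod (2 ^ k) // x ^ 2 = u} ≤ 4 := by
  rcases isEmpty_or_nonempty {x : ZMod (2 ^ k) // x ^ 2 = u} with h | ⟨⟨y, hy⟩⟩
  · simp
  rcases Nat.lt_or_ge k 2 with hk | hk
  · calc Nat.card {x : ZMod (2 ^ k) // x ^ 2 = u} ≤ Nat.card (ZMod (2 ^ k)) :=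
          Nat.card_le_card_of_injective _ Subtype.val_injective
      _ = 2 ^ k := Nat.card_zmod _
      _ ≤ 4 := by interval_cases k <;> norm_num
  obtain ⟨m, rfl⟩ : ∃ m, k = m + 1 := ⟨k - 1, by omega⟩
  have hm : 1 ≤ m := by omega
  set h : ZMod (2 ^ (m + 1)) := ((2 ^ m : ℤ) : ZMod (2 ^ (m + 1))) with hh
  have key : ∀ x : ZMod (2 ^ (m + 1)), x ^ 2 = u →
      x = y ∨ x = -y ∨ x = y + h ∨ x = -y + h := by
    intro x hx
    obtain ⟨X, rfl⟩ := ZMod.intCast_surjective x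
    obtain ⟨Y, rfl⟩ := ZMod.intCast_surjective y
    have hodd : ∀ Z : ℤ, (Z : ZMod (2 ^ (m + 1))) ^ 2 = u → ¬ (2 : ℤ) ∣ Z := by
      intro Z hZ hd
      have hZu : IsUnit ((Z : ZMod (2 ^ (m + 1)))) := by
        have : IsUnit ((Z : ZMod (2 ^ (m + 1))) ^ 2) := hZ ▸ hu
        exact (isUnit_pow_iff two_ne_zero).mp this
      rw [ZMod.coe_int_isUnit_iff_isCoprime] at hZu
      have h1 : (2 : ℤ) ∣ ((2 ^ (m + 1) : ℕ) : ℤ) := by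
        push_cast; exact dvd_pow_self _ (by omega)
      have := hZu.isUnit_of_dvd' h1 hd
      exact Int.prime_two.not_isUnit this
    have hX := hodd X hx
    have hY := hodd Y hy
    have hdvd : ((2 : ℤ) ^ (m + 1)) ∣ (X - Y) * (X + Y) := by
      have : ((X ^ 2 - Y ^ 2 : ℤ) : ZMod (2 ^ (m + 1))) = 0 := by
        push_cast; rw [hx, hy, sub_self]
      rw [ZMod.intCast_zmod_eq_zero_iff_dvd] at this
      push_cast at this
      convert this using 1; ring
    obtain ⟨s, hs⟩ : (2 : ℤ) ∣ X - Y := by omega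
    obtain ⟨t, ht⟩ : (2 : ℤ) ∣ X + Y := by omega
    have half : ∀ w : ℤ, (2 : ℤ) ^ (m - 1) ∣ w →
        ((2 * w : ℤ) : ZMod (2 ^ (m + 1))) = 0 ∨ ((2 * w : ℤ) : ZMod (2 ^ (m + 1))) = h := by
      rintro w ⟨r, rfl⟩
      have e : (2 : ℤ) * (2 ^ (m - 1) * r) = 2 ^ m * r := by
        obtain ⟨l, rfl⟩ : ∃ l, m = l + 1 := ⟨m - 1, by omega⟩
        simp [pow_succ]; ring
      rw [e]
      rcases Int.even_or_odd' r with ⟨r', h' | h'⟩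
      · left
        rw [ZMod.intCast_zmod_eq_zero_iff_dvd, h']
        push_cast; exact ⟨r', by ring⟩
      · right
        rw [hh, ← sub_eq_zero, ← Int.cast_sub, ZMod.intCast_zmod_eq_zero_iff_dvd, h']
        push_cast; exact ⟨r', by ring⟩
    have hst : (2 : ℤ) ^ (m - 1) ∣ s * t := by
      rw [hs, ht] at hdvd
      have e : (2 : ℤ) ^ (m + 1) = 4 * 2 ^ (m - 1) := by
        obtain ⟨l, rfl⟩ : ∃ l, m = l + 1 := ⟨m - 1, by omega⟩
        simp [pow_succ]; ring
      rw [e, show 2 * s * (2 * t) = 4 * (s * t) by ring] at hdvd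
      exact (mul_dvd_mul_iff_left (by norm_num)).mp hdvd
    by_cases hs2 : (2 : ℤ) ∣ s
    · have ht2 : ¬ (2 : ℤ) ∣ t := by omega
      have hc : IsCoprime ((2 : ℤ) ^ (m - 1)) t :=
        IsCoprime.pow_left ((Int.prime_two.coprime_iff_not_dvd).mpr ht2)
      have := half s (hc.dvd_of_dvd_mul_right hst)
      rw [← hs] at this; push_cast at this
      rcases this with h | h
      · left; exact sub_eq_zero.mp h
      · right; right; left; rw [← h]; ring
    · have hc : IsCoprime ((2 : ℤ) ^ (m - 1)) s :=
        IsCoprime.pow_left ((Int.prime_two.coprime_iff_not_dvd).mpr hs2)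
      have := half t (hc.dvd_of_dvd_mul_left hst)
      rw [← ht] at this; push_cast at this
      rcases this with h | h
      · right; left; exact eq_neg_of_add_eq_zero_left h
      · right; right; right; rw [← h]; ring
  have : {x : ZMod (2 ^ (m + 1)) | x ^ 2 = u} ⊆
      (({y, -y, y + h, -y + h} : Finset (ZMod (2 ^ (m + 1)))) : Set _) := by
    intro x hx
    have := key x hx
    simpa using this
  have h2 := Set.ncard_le_ncard this (Finset.finite_toSet _)
  rw [Set.ncard_coe_finset] at h2
  exact h2.trans Finset.card_le_four

theorem card_sqrt_le (q : ℕ) (hq : q ≠ 0) (u : ZMod q) (hu : IsUnit u) :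
    Nat.card {x : ZMod q // x ^ 2 = u} ≤ sqrtBound q := by
  induction q using Nat.recOnPosPrimePosCoprime with
  | zero => exact absurd rfl hq
  | one =>
    calc Nat.card {x : ZMod 1 // x ^ 2 = u} ≤ Nat.card (ZMod 1) :=
          Nat.card_le_card_of_injective _ Subtype.val_injective
      _ ≤ sqrtBound 1 := by simp [sqrtBound]
  | prime_pow p k hp hk =>
    rw [sqrtBound, Nat.primeFactors_prime_pow hk.ne' hp, Finset.prod_singleton]
    split_ifs with h2
    · subst h2; exact card_sqrt_two_pow k u hu
    · exact card_sqrt_odd_prime_pow p k hp h2 u hu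
  | coprime a b ha hb hab iha ihb =>
    have e : sqrtBound (a * b) = sqrtBound a * sqrtBound b := by
      unfold sqrtBound
      rw [hab.primeFactors_mul, Finset.prod_union hab.disjoint_primeFactors]
    have : NeZero a := ⟨by omega⟩
    have : NeZero b := ⟨by omega⟩
    let φ := ZMod.chineseRemainder hab
    have h1 := iha (by omega) (φ u).1 ((hu.map φ).map (RingHom.fst _ _))
    have h2 := ihb (by omega) (φ u).2 ((hu.map φ).map (RingHom.snd _ _))
    rw [e]
    refine le_trans ?_ (Nat.mul_le_mul h1 h2)
    rw [← Nat.card_prod]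
    refine Nat.card_le_card_of_injective
      (fun x => (⟨(φ x.1).1, by rw [← Prod.pow_fst, ← map_pow, x.2]⟩,
        ⟨(φ x.1).2, by rw [← Prod.pow_snd, ← map_pow, x.2]⟩)) ?_
    intro x y hxy
    simp only [Prod.mk.injEq, Subtype.mk.injEq] at hxy
    exact Subtype.ext (φ.injective (Prod.ext hxy.1 hxy.2))

theorem abs_sum_Ico_le_of_periodic (f : ℕ → ℝ) (n : ℕ) (hn : 0 < n) (hper : ∀ x, f (x + n) = f x)
    (hsum : ∑ x ∈ range n, f x = 0) (hb : ∀ x, |f x| ≤ 1) (a b : ℕ) :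
    |∑ x ∈ Ico a b, f x| ≤ n := by
  have hz : ∀ a, ∑ x ∈ Ico a (a + n), f x = 0 := by
    intro a
    induction a with
    | zero => simpa using hsum
    | succ k ih =>
      have h1 := Finset.sum_Ico_consecutive f (Nat.le_succ k) (show k + 1 ≤ k + 1 + n by omega)
      have h2 := Finset.sum_Ico_consecutive f (show k ≤ k + n by omega)
        (show k + n ≤ k + 1 + n by omega)
      have h3 : ∑ x ∈ Ico (k + n) (k + 1 + n), f x = f k := by
        rw [show k + 1 + n = (k + n) + 1 by ring, Nat.Ico_succ_singleton,
          Finset.sum_singleton, hper]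
      rw [Nat.succ_eq_add_one, Nat.Ico_succ_singleton, Finset.sum_singleton] at h1
      linarith
  induction hk : b - a using Nat.strong_induction_on generalizing a with
  | _ k ih =>
    rcases Nat.lt_or_ge (b - a) n with h | h
    · calc |∑ x ∈ Ico a b, f x| ≤ ∑ x ∈ Ico a b, |f x| := Finset.abs_sum_le_sum_abs _ _
        _ ≤ ∑ x ∈ Ico a b, 1 := Finset.sum_le_sum fun x _ => hb x
        _ = ((b - a : ℕ) : ℝ) := by simp
        _ ≤ n := by exact_mod_cast h.le
    · rw [← Finset.sum_Ico_consecutive f (show a ≤ a + n by omega) (show a + n ≤ b by omega), hz,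
        zero_add]
      exact ih (b - (a + n)) (by omega) (a + n) rfl

theorem sum_range_eq_zero_of_mul (f : ℕ → ℝ) (n : ℕ) (hn : 0 < n) (hper : ∀ x, f (x + n) = f x)
    (hmul : ∀ x y, f (x * y) = f x * f y) (u : ℕ) (hu : u.Coprime n) (hfu : f u = -1) :
    ∑ x ∈ range n, f x = 0 := by
  have hmod : ∀ x, f (x % n) = f x := fun x => Function.Periodic.map_mod_nat hper x
  have h : ∑ x ∈ range n, f x = ∑ x ∈ range n, f (u * x) := by
    symm
    have hinj : Set.InjOn (fun x => u * x % n) (range n : Set ℕ) := by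
      intro x hx y hy hxy
      have : u * x ≡ u * y [MOD n] := hxy
      have := Nat.ModEq.cancel_left_of_coprime (by rwa [Nat.gcd_comm]) this
      exact Nat.ModEq.eq_of_lt_of_lt this (by simpa using hx) (by simpa using hy)
    have hmaps : ∀ x ∈ range n, u * x % n ∈ range n := fun x _ => by
      simpa using Nat.mod_lt _ hn
    refine Finset.sum_nbij (fun x => u * x % n) hmaps hinj
      (Finset.surjOn_of_injOn_of_card_le _ hmaps hinj le_rfl) ?_
    intro x _
    exact (hmod _).symm
  simp only [hmul, hfu] at h
  rw [← Finset.mul_sum] at h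
  linarith

theorem exists_odd_factorization {n : ℕ} (hn : n ≠ 0) (h : ¬ IsSquare n) :
    ∃ p v r : ℕ, p.Prime ∧ Odd v ∧ ¬ p ∣ r ∧ n = p ^ v * r := by
  have : ∃ p ∈ n.primeFactors, ¬ IsSquare (p ^ n.factorization p) := by
    by_contra! hc
    apply h
    rw [← Nat.prod_factorization_pow_eq_self hn]
    exact Finset.isSquare_prod _ hc
  obtain ⟨p, hp, hs⟩ := this
  have hpp := Nat.prime_of_mem_primeFactors hp
  refine ⟨p, n.factorization p, n / p ^ n.factorization p, hpp, ?_, ?_, ?_⟩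
  · by_contra hc
    exact hs ((Nat.not_odd_iff_even.mp hc).isSquare_pow p)
  · exact Nat.not_dvd_ordCompl hpp hn
  · exact (Nat.ordProj_mul_ordCompl_eq_self n p).symm

theorem exists_jacobiSym_eq_neg_one {n : ℕ} (hodd : Odd n) (h : ¬ IsSquare n) :
    ∃ u : ℕ, u % 8 = 1 ∧ u.Coprime n ∧ J(u | n) = -1 := by
  obtain ⟨p, v, r, hp, hv, hpr, rfl⟩ := exists_odd_factorization
    (by rintro rfl; simp at hodd) h
  have hodd' := Nat.odd_mul.mp hodd
  have hpo : Odd p := by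
    rcases hp.eq_two_or_odd' with rfl | h
    · have := hodd'.1
      rw [Nat.odd_pow_iff hv.pos.ne'] at this
      exact absurd this (by decide)
    · exact h
  have : Fact p.Prime := ⟨hp⟩
  obtain ⟨w, hw⟩ := FiniteField.exists_nonsquare (F := ZMod p)
    (by rw [ZMod.ringChar_zmod_n]; rintro rfl; exact absurd hpo (by decide))
  have hco : p.Coprime (8 * r) := by
    rw [Nat.coprime_mul_iff_right]
    refine ⟨?_, (Nat.Prime.coprime_iff_not_dvd hp).mpr hpr⟩
    exact Nat.Coprime.pow_right 3 hpo.coprime_two_right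
  obtain ⟨u, hu1, hu2⟩ := Nat.chineseRemainder hco w.val 1
  have hJp : J(u | p) = -1 := by
    have hc : ((u : ℤ) : ZMod p) = w := by
      have := (ZMod.natCast_eq_natCast_iff u w.val p).mpr hu1
      rw [ZMod.natCast_zmod_val] at this
      exact_mod_cast this
    rw [ZMod.nonsquare_iff_jacobiSym_eq_neg_one, hc]
    exact hw
  have hr0 : r ≠ 0 := by rintro rfl; simp at hpr
  have hJr : J(u | r) = 1 := by
    have h1 : u ≡ 1 [MOD r] := hu2.of_dvd (Dvd.intro_left _ rfl)
    rw [jacobiSym.mod_left' (a₂ := 1) (by exact_mod_cast (Int.natCast_modEq_iff.mpr h1))]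
    exact jacobiSym.one_left _
  have hJ : J(u | p ^ v * r) = -1 := by
    rw [jacobiSym.mul_right' _ (pow_ne_zero _ hp.ne_zero) hr0, jacobiSym.pow_right, hJp, hJr,
      hv.neg_one_pow, mul_one]
  refine ⟨u, ?_, ?_, hJ⟩
  · have h1 : u ≡ 1 [MOD 8] := hu2.of_dvd (Dvd.intro _ rfl)
    exact h1
  · by_contra hc
    have : J(u | p ^ v * r) = 0 := by
      rw [jacobiSym.eq_zero_iff]
      exact ⟨mul_ne_zero (pow_ne_zero _ hp.ne_zero) hr0, by rw [Int.gcd_natCast_natCast]; exact hc⟩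
    omega

theorem abs_jacobiSym_le_one (a : ℤ) (b : ℕ) : |(J(a | b) : ℝ)| ≤ 1 := by
  rcases jacobiSym.trichotomy a b with h | h | h <;> rw [h] <;> simp

theorem abs_sum_jacobiSym_left_le {n : ℕ} (hodd : Odd n) (h : ¬ IsSquare n) (a b : ℕ) :
    |∑ x ∈ Ico a b, (J(x | n) : ℝ)| ≤ n := by
  obtain ⟨u, -, hu, hJ⟩ := exists_jacobiSym_eq_neg_one hodd h
  have hper : ∀ x : ℕ, (J((x + n : ℕ) | n) : ℝ) = J(x | n) := by
    intro x
    rw [jacobiSym.mod_left' (a₂ := (x : ℤ)) (by push_cast; simp)]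
  refine abs_sum_Ico_le_of_periodic (fun x => (J(x | n) : ℝ)) n hodd.pos hper ?_
    (fun x => abs_jacobiSym_le_one _ _) a b
  refine sum_range_eq_zero_of_mul (fun x => (J(x | n) : ℝ)) n hodd.pos hper ?_ u hu (by simp [hJ])
  intro x y
  push_cast
  rw [jacobiSym.mul_left]; push_cast; rfl

theorem exists_jacobiSym_right_eq_neg_one {m : ℕ} (hm : m ≠ 0) (h : ¬ IsSquare m) :
    ∃ u : ℕ, Odd u ∧ J(m | u) = -1 := by
  obtain ⟨e, r, hr2, rfl⟩ := Nat.exists_eq_two_pow_mul_odd hm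
  have h2 : ∀ u : ℕ, Odd u → J((2 ^ e * r : ℕ) | u) = J(2 | u) ^ e * J(r | u) := by
    intro u hu
    push_cast
    rw [jacobiSym.mul_left, jacobiSym.pow_left]
  by_cases hr : IsSquare r
  · have he : Odd e := by
      by_contra hc
      exact h (((Nat.not_odd_iff_even.mp hc).isSquare_pow 2).mul hr)
    obtain ⟨s, rfl⟩ := hr
    have hso : Odd s := (Nat.odd_mul.mp hr2).1
    have hco : Nat.Coprime 8 s := Nat.Coprime.pow_left 3 hso.coprime_two_left
    obtain ⟨u, hu1, hu2⟩ := Nat.chineseRemainder hco 5 1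
    have hu5 : u % 8 = 5 := hu1
    have huo : Odd u := Nat.odd_iff.mpr (by omega)
    have hus : Nat.gcd s u = 1 := by
      have := hu2.gcd_eq
      rw [Nat.gcd_comm, this]; simp
    refine ⟨u, huo, ?_⟩
    rw [h2 u huo, Nat.cast_mul, jacobiSym.mul_left, ← sq, jacobiSym.sq_one (by simpa using hus),
      jacobiSym.at_two huo, ZMod.χ₈_nat_mod_eight, hu5, mul_one]
    rw [show ZMod.χ₈ ((5 : ℕ) : ZMod 8) = -1 by decide]
    exact he.neg_one_pow
  · obtain ⟨u, hu8, hur, hJ⟩ := exists_jacobiSym_eq_neg_one hr2 hr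
    have huo : Odd u := Nat.odd_iff.mpr (by omega)
    refine ⟨u, huo, ?_⟩
    rw [h2 u huo, jacobiSym.quadratic_reciprocity_one_mod_four' hr2 (by omega), hJ,
      jacobiSym.at_two huo, ZMod.χ₈_nat_mod_eight, hu8]
    simp

theorem abs_sum_jacobiSym_right_le {m : ℕ} (hm : m ≠ 0) (h : ¬ IsSquare m) (a b : ℕ) :
    |∑ x ∈ Ico a b, if Odd x then (J(m | x) : ℝ) else 0| ≤ 4 * m := by
  obtain ⟨u, huo, hJ⟩ := exists_jacobiSym_right_eq_neg_one hm h
  set f : ℕ → ℝ := fun x => if Odd x then (J(m | x) : ℝ) else 0 with hf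
  have hper : ∀ x : ℕ, f (x + 4 * m) = f x := by
    intro x
    have hpar : Odd (x + 4 * m) ↔ Odd x := by
      rw [Nat.odd_add]; simp [show Even (4 * m) from ⟨2 * m, by ring⟩]
    simp only [hf, hpar]
    split_ifs with hx
    · rw [jacobiSym.mod_right' m (hpar.mpr hx), jacobiSym.mod_right' m hx, Nat.add_mod_right]
    · rfl
  have hb : ∀ x, |f x| ≤ 1 := by
    intro x
    simp only [hf]
    split_ifs
    · exact abs_jacobiSym_le_one _ _
    · simp
  have hmul : ∀ x y, f (x * y) = f x * f y := by
    intro x y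
    simp only [hf, Nat.odd_mul]
    by_cases hx : Odd x
    · by_cases hy : Odd y
      · simp only [hx, hy, and_self, if_true]
        rw [jacobiSym.mul_right' _ hx.pos.ne' hy.pos.ne']; push_cast; rfl
      · simp [hy]
    · simp [hx]
  have hco : u.Coprime (4 * m) := by
    rw [Nat.coprime_mul_iff_right]
    refine ⟨Nat.Coprime.pow_right 2 huo.coprime_two_right, ?_⟩
    by_contra hc
    have : J(m | u) = 0 := by
      rw [jacobiSym.eq_zero_iff]
      exact ⟨huo.pos.ne', by rw [Int.gcd_natCast_natCast, Nat.gcd_comm]; exact hc⟩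
    omega
  have := abs_sum_Ico_le_of_periodic f (4 * m) (by omega) hper
    (sum_range_eq_zero_of_mul f (4 * m) (by omega) hper hmul u hco (by simp [hf, huo, hJ])) hb a b
  simpa [hf] using this

theorem dvd_of_squarefree_of_isSquare_mul {a b : ℕ} (ha : Squarefree a) (h : IsSquare (a * b)) :
    a ∣ b := by
  obtain ⟨k, hk⟩ := h
  have h1 : a ∣ k := (ha.dvd_pow_iff_dvd two_ne_zero).mp (by rw [sq, ← hk]; exact dvd_mul_right a b)
  obtain ⟨r, rfl⟩ := h1
  refine ⟨r * r, ?_⟩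
  have : a * b = a * (a * (r * r)) := by rw [hk]; ring
  exact Nat.eq_of_mul_eq_mul_left (Nat.pos_of_ne_zero ha.ne_zero) this

theorem eq_of_squarefree_of_isSquare_mul {a b : ℕ} (ha : Squarefree a) (hb : Squarefree b)
    (h : IsSquare (a * b)) : a = b :=
  Nat.dvd_antisymm (dvd_of_squarefree_of_isSquare_mul ha h)
    (dvd_of_squarefree_of_isSquare_mul hb (by rwa [mul_comm]))

theorem card_filter_isSquare_mul_le (m : ℕ) (hm : m ≠ 0) (P : ℕ) :
    #{b ∈ Icc 1 P | IsSquare (b * m)} ≤ Nat.sqrt P := by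
  obtain ⟨a, t, rfl, ha⟩ := Nat.sq_mul_squarefree m
  have hsub : {b ∈ Icc 1 P | IsSquare (b * (t ^ 2 * a))} ⊆
      (Icc 1 (Nat.sqrt P)).image (fun r => a * r ^ 2) := by
    intro b hb
    simp only [mem_filter, mem_Icc] at hb
    obtain ⟨⟨h1, h2⟩, k, hk⟩ := hb
    have ht : t ≠ 0 := by rintro rfl; simp at hm
    have hsq : IsSquare (a * b) := by
      have h3 : t ^ 2 ∣ k ^ 2 := ⟨a * b, by rw [sq k, ← hk]; ring⟩
      obtain ⟨r, rfl⟩ := (Nat.pow_dvd_pow_iff two_ne_zero).mp h3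
      refine ⟨r, Nat.eq_of_mul_eq_mul_left (pow_pos (Nat.pos_of_ne_zero ht) 2) ?_⟩
      calc t ^ 2 * (a * b) = b * (t ^ 2 * a) := by ring
        _ = t ^ 2 * (r * r) := by rw [hk]; ring
    obtain ⟨c, hc⟩ := dvd_of_squarefree_of_isSquare_mul ha hsq
    have hc2 : IsSquare c := by
      obtain ⟨k, hk⟩ := hsq
      rw [hc] at hk
      have h3 : a ^ 2 ∣ k ^ 2 := ⟨c, by rw [sq k, ← hk]; ring⟩
      obtain ⟨r, rfl⟩ := (Nat.pow_dvd_pow_iff two_ne_zero).mp h3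
      refine ⟨r, Nat.eq_of_mul_eq_mul_left (pow_pos (Nat.pos_of_ne_zero ha.ne_zero) 2) ?_⟩
      calc a ^ 2 * c = a * (a * c) := by ring
        _ = a ^ 2 * (r * r) := by rw [hk]; ring
    obtain ⟨r, rfl⟩ := hc2
    rw [mem_image]
    refine ⟨r, ?_, by rw [hc]; ring⟩
    rw [mem_Icc]
    constructor
    · rcases Nat.eq_zero_or_pos r with rfl | h
      · simp at hc; omega
      · exact h
    · rw [Nat.le_sqrt]
      calc r * r ≤ a * (r * r) := Nat.le_mul_of_pos_left _ (Nat.pos_of_ne_zero ha.ne_zero)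
        _ ≤ P := by rw [← hc]; exact h2
  calc _ ≤ _ := card_le_card hsub
    _ ≤ _ := card_image_le
    _ = _ := by simp

theorem sum_sq_sum_jacobiSym_le {α : Type*} (S : Finset α) (g : α → ℕ) (T c : ℝ) (hT0 : 0 ≤ T)
    (hT : ∀ n : ℕ, Odd n → ¬ IsSquare n → |∑ s ∈ S, (J(g s | n) : ℝ)| ≤ T * n)
    (Z : ℕ) (w : ℕ → ℝ) (hw : ∀ d, |w d| ≤ c) (hw0 : ∀ d, w d ≠ 0 → Odd d ∧ Squarefree d) :
    ∑ s ∈ S, (∑ d ∈ Ico Z (2 * Z), w d * (J(g s | d) : ℝ)) ^ 2 ≤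
      c ^ 2 * (Z * #S + 4 * Z ^ 4 * T) := by
  have hc : 0 ≤ c := (abs_nonneg _).trans (hw 0)
  have key : ∀ d ∈ Ico Z (2 * Z), ∀ e ∈ Ico Z (2 * Z),
      w d * w e * ∑ s ∈ S, (J(g s | d) : ℝ) * (J(g s | e) : ℝ) ≤
        c ^ 2 * ((if d = e then (#S : ℝ) else 0) + 4 * Z ^ 2 * T) := by
    intro d hd e he
    rw [mem_Ico] at hd he
    have hwde : |w d * w e| ≤ c ^ 2 := by
      rw [abs_mul, sq]; exact mul_le_mul (hw d) (hw e) (abs_nonneg _) hc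
    by_cases hwd : w d = 0
    · rw [hwd, zero_mul, zero_mul]; split_ifs <;> positivity
    by_cases hwe : w e = 0
    · rw [hwe, mul_zero, zero_mul]; split_ifs <;> positivity
    have hdo := hw0 d hwd
    have heo := hw0 e hwe
    refine (le_abs_self _).trans ?_
    rw [abs_mul]
    refine mul_le_mul hwde ?_ (abs_nonneg _) (by positivity)
    split_ifs with hde
    · have : |∑ s ∈ S, (J(g s | d) : ℝ) * (J(g s | e) : ℝ)| ≤ #S := by
        refine (abs_sum_le_sum_abs _ _).trans ?_
        rw [card_eq_sum_ones]; push_cast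
        refine sum_le_sum fun s _ => ?_
        rw [abs_mul]
        exact mul_le_one₀ (abs_jacobiSym_le_one _ _) (abs_nonneg _) (abs_jacobiSym_le_one _ _)
      have : 0 ≤ 4 * (Z : ℝ) ^ 2 * T := by positivity
      linarith
    · have h1 := hT (d * e) (hdo.1.mul heo.1)
        (fun h => hde (eq_of_squarefree_of_isSquare_mul hdo.2 heo.2 h))
      have h2 : ∀ s, (J(g s | d * e) : ℝ) = (J(g s | d) : ℝ) * (J(g s | e) : ℝ) := by
        intro s
        rw [jacobiSym.mul_right' _ hdo.2.ne_zero heo.2.ne_zero]; push_cast; rfl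
      simp only [h2] at h1
      have h3 : ((d * e : ℕ) : ℝ) ≤ 4 * Z ^ 2 := by
        have : d * e ≤ (2 * Z) * (2 * Z) := Nat.mul_le_mul (by omega) (by omega)
        calc ((d * e : ℕ) : ℝ) ≤ ((2 * Z * (2 * Z) : ℕ) : ℝ) := by exact_mod_cast this
          _ = 4 * Z ^ 2 := by push_cast; ring
      calc _ ≤ _ := h1
        _ ≤ T * (4 * Z ^ 2) := by gcongr
        _ = _ := by ring
  calc ∑ s ∈ S, (∑ d ∈ Ico Z (2 * Z), w d * (J(g s | d) : ℝ)) ^ 2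
      = ∑ d ∈ Ico Z (2 * Z), ∑ e ∈ Ico Z (2 * Z),
          w d * w e * ∑ s ∈ S, (J(g s | d) : ℝ) * (J(g s | e) : ℝ) := by
        simp_rw [sq, sum_mul_sum, mul_sum]
        rw [sum_comm]
        refine sum_congr rfl fun d _ => ?_
        rw [sum_comm]
        refine sum_congr rfl fun e _ => sum_congr rfl fun s _ => by ring
    _ ≤ ∑ d ∈ Ico Z (2 * Z), ∑ e ∈ Ico Z (2 * Z),
          c ^ 2 * ((if d = e then (#S : ℝ) else 0) + 4 * Z ^ 2 * T) :=
        sum_le_sum fun d hd => sum_le_sum fun e he => key d hd e he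
    _ = ∑ d ∈ Ico Z (2 * Z), c ^ 2 * (#S + Z * (4 * Z ^ 2 * T)) := by
        refine sum_congr rfl fun d hd => ?_
        rw [← mul_sum, sum_add_distrib, sum_ite_eq, if_pos hd]
        simp [two_mul]
    _ = _ := by
        simp [two_mul]; ring

theorem card_divisors_le_rpow (η : ℝ) (hη : 0 < η) :
    ∃ C : ℝ, 1 ≤ C ∧ ∀ n : ℕ, n ≠ 0 → (#n.divisors : ℝ) ≤ C * (n : ℝ) ^ η := by
  set c : ℝ := max 1 (1 / (η * Real.log 2)) with hc
  have hl2 : 0 < Real.log 2 := Real.log_pos (by norm_num)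
  have hc1 : 1 ≤ c := le_max_left _ _
  set M : ℕ := ⌈(2 : ℝ) ^ (1 / η)⌉₊ with hM
  have hbern : ∀ e : ℕ, (e + 1 : ℝ) ≤ 2 ^ e := by
    intro e
    have := Nat.lt_two_pow_self (n := e)
    exact_mod_cast this
  have hsmall : ∀ p e : ℕ, p.Prime → (e + 1 : ℝ) ≤ c * ((p : ℝ) ^ η) ^ e := by
    intro p e hp
    have h1 : (2 : ℝ) ^ η ≤ (p : ℝ) ^ η :=
      Real.rpow_le_rpow (by norm_num) (by exact_mod_cast hp.two_le) hη.le
    have h2 : 1 + e * (η * Real.log 2) ≤ ((2 : ℝ) ^ η) ^ e := by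
      rw [Real.rpow_def_of_pos (by norm_num), ← Real.exp_nat_mul]
      have := Real.add_one_le_exp (e * (Real.log 2 * η))
      linarith
    have h3 : 1 ≤ c * (η * Real.log 2) := by
      have : 1 / (η * Real.log 2) ≤ c := le_max_right _ _
      rwa [div_le_iff₀ (by positivity)] at this
    calc (e + 1 : ℝ) ≤ c * (1 + e * (η * Real.log 2)) := by
          nlinarith [Nat.cast_nonneg (α := ℝ) e]
      _ ≤ c * ((2 : ℝ) ^ η) ^ e := by gcongr
      _ ≤ _ := by gcongr
  have hbig : ∀ p e : ℕ, M ≤ p → (e + 1 : ℝ) ≤ ((p : ℝ) ^ η) ^ e := by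
    intro p e hp
    have h1 : (2 : ℝ) ≤ (p : ℝ) ^ η := by
      have : (2 : ℝ) ^ (1 / η) ≤ p := (Nat.le_ceil _).trans (by exact_mod_cast hp)
      calc (2 : ℝ) = ((2 : ℝ) ^ (1 / η)) ^ η := by
            rw [← Real.rpow_mul (by norm_num), one_div, inv_mul_cancel₀ hη.ne', Real.rpow_one]
        _ ≤ _ := Real.rpow_le_rpow (by positivity) this hη.le
    exact (hbern e).trans (by gcongr)
  refine ⟨c ^ M, one_le_pow₀ hc1, fun n hn => ?_⟩
  rw [Nat.card_divisors hn]
  have hn' : (n : ℝ) ^ η = ∏ p ∈ n.primeFactors, ((p : ℝ) ^ η) ^ n.factorization p := by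
    conv_lhs => rw [← Nat.prod_factorization_pow_eq_self hn]
    rw [Finsupp.prod, Nat.support_factorization, Nat.cast_prod,
      ← Real.finsetProd_rpow _ _ (fun _ _ => by positivity)]
    refine prod_congr rfl fun p _ => ?_
    push_cast
    rw [← Real.rpow_natCast_mul (by positivity), mul_comm, Real.rpow_mul_natCast (by positivity)]
  rw [hn']
  push_cast
  calc ∏ p ∈ n.primeFactors, ((n.factorization p : ℝ) + 1)
      ≤ ∏ p ∈ n.primeFactors, ((if p < M then c else 1) * ((p : ℝ) ^ η) ^ n.factorization p) := by
        refine prod_le_prod (fun _ _ => by positivity) fun p hp => ?_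
        split_ifs with h
        · exact hsmall p _ (Nat.prime_of_mem_primeFactors hp)
        · rw [one_mul]; exact hbig p _ (not_lt.mp h)
    _ = (∏ p ∈ n.primeFactors, if p < M then c else 1) *
          ∏ p ∈ n.primeFactors, ((p : ℝ) ^ η) ^ n.factorization p := prod_mul_distrib
    _ ≤ _ := by
        gcongr
        rw [prod_ite, prod_const, prod_const_one, mul_one]
        refine pow_le_pow_right₀ hc1 ?_
        calc _ ≤ #(range M) := card_le_card fun p hp => by
              simp only [mem_filter] at hp; simpa using hp.2
          _ = M := card_range M

/-- The character sum `∑ w(d) (l/d)` over the dyadic range `Z ≤ d < 2Z`. -/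
noncomputable def dyadicSum (w : ℕ → ℝ) (Z l : ℕ) : ℝ :=
  ∑ d ∈ Ico Z (2 * Z), w d * (J(l | d) : ℝ)

/-- The mean square of `dyadicSum` over products `b₁ b₂` in a box. -/
noncomputable def dyadicEnergy (w : ℕ → ℝ) (P₁ P₂ Z : ℕ) : ℝ :=
  ∑ b ∈ Icc 1 P₁ ×ˢ Icc 1 P₂, dyadicSum w Z (b.1 * b.2) ^ 2

theorem jacobiSym_prod_left {ι : Type*} (s : Finset ι) (f : ι → ℤ) (d : ℕ) :
    J(∏ i ∈ s, f i | d) = ∏ i ∈ s, J(f i | d) := by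
  classical
  induction s using Finset.induction_on with
  | empty => simp
  | insert a s ha ih => rw [prod_insert ha, prod_insert ha, jacobiSym.mul_left, ih]

theorem abs_sum_jacobiSym_box_le (P₁ P₂ n : ℕ) (hodd : Odd n) (h : ¬ IsSquare n) :
    |∑ b ∈ Icc 1 P₁ ×ˢ Icc 1 P₂, (J((b.1 * b.2 : ℕ) | n) : ℝ)| ≤
      Real.sqrt ((P₁ * P₂ : ℕ) : ℝ) * n := by
  have hfac : ∑ b ∈ Icc 1 P₁ ×ˢ Icc 1 P₂, (J((b.1 * b.2 : ℕ) | n) : ℝ) =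
      (∑ x ∈ Icc 1 P₁, (J(x | n) : ℝ)) * ∑ y ∈ Icc 1 P₂, (J(y | n) : ℝ) := by
    rw [sum_mul_sum, sum_product]
    refine sum_congr rfl fun x _ => sum_congr rfl fun y _ => ?_
    push_cast
    rw [jacobiSym.mul_left]; push_cast; rfl
  have htriv : ∀ P : ℕ, |∑ x ∈ Icc 1 P, (J(x | n) : ℝ)| ≤ P := by
    intro P
    calc _ ≤ ∑ x ∈ Icc 1 P, |(J(x | n) : ℝ)| := abs_sum_le_sum_abs _ _
      _ ≤ ∑ x ∈ Icc 1 P, 1 := sum_le_sum fun x _ => abs_jacobiSym_le_one _ _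
      _ = P := by simp
  have hchar : ∀ P : ℕ, |∑ x ∈ Icc 1 P, (J(x | n) : ℝ)| ≤ n := by
    intro P
    have := abs_sum_jacobiSym_left_le hodd h 1 (P + 1)
    exact this
  rw [hfac, abs_mul]
  have h1 := htriv P₁
  have h2 := htriv P₂
  have h3 := hchar P₁
  have h4 := hchar P₂
  set x := |∑ x ∈ Icc 1 P₁, (J(x | n) : ℝ)|
  set y := |∑ x ∈ Icc 1 P₂, (J(x | n) : ℝ)|
  have hx : 0 ≤ x := abs_nonneg _
  have hy : 0 ≤ y := abs_nonneg _
  refine abs_le_of_sq_le_sq' ?_ (by positivity) |>.2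
  rw [mul_pow, mul_pow, Real.sq_sqrt (by positivity)]
  push_cast
  calc x ^ 2 * y ^ 2 = (x * y) * (x * y) := by ring
    _ ≤ (P₁ * P₂) * (n * n) := by gcongr
    _ = _ := by ring

theorem dyadicEnergy_le_small
    {w : ℕ → ℝ} {Z : ℕ} (hZ : 0 < Z) (hw : ∀ d, |w d| ≤ 1 / Z)
    (hw0 : ∀ d, w d ≠ 0 → Odd d ∧ Squarefree d)
    (P₁ P₂ : ℕ) :
    dyadicEnergy w P₁ P₂ Z ≤ (P₁ * P₂ : ℕ) / Z + 4 * Z ^ 2 * Real.sqrt ((P₁ * P₂ : ℕ) : ℝ) := by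
  have h := sum_sq_sum_jacobiSym_le (Icc 1 P₁ ×ˢ Icc 1 P₂) (fun b => b.1 * b.2)
    (Real.sqrt ((P₁ * P₂ : ℕ) : ℝ)) (1 / Z) (Real.sqrt_nonneg _)
    (fun n h1 h2 => abs_sum_jacobiSym_box_le P₁ P₂ n h1 h2) Z w hw hw0
  have hZ' : (0 : ℝ) < Z := by exact_mod_cast hZ
  refine h.trans (le_of_eq ?_)
  rw [card_product, Nat.card_Icc, Nat.card_Icc]
  simp only [Nat.add_sub_cancel]
  field_simp

theorem abs_dyadicSum_le_one
    {w : ℕ → ℝ} {Z : ℕ} (hZ : 0 < Z) (hw : ∀ d, |w d| ≤ 1 / Z)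
    (l : ℕ) : |dyadicSum w Z l| ≤ 1 := by
  have hZ' : (0 : ℝ) < Z := by exact_mod_cast hZ
  calc |dyadicSum w Z l| ≤ ∑ d ∈ Ico Z (2 * Z), |w d * (J(l | d) : ℝ)| := abs_sum_le_sum_abs _ _
    _ ≤ ∑ d ∈ Ico Z (2 * Z), 1 / (Z : ℝ) := by
        refine sum_le_sum fun d _ => ?_
        rw [abs_mul]
        calc |w d| * |(J(l | d) : ℝ)| ≤ 1 / Z * 1 := by
              gcongr
              · exact hw d
              · exact abs_jacobiSym_le_one _ _
          _ = _ := mul_one _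
    _ = 1 := by simp [two_mul]; field_simp

/-- The dual sum to `dyadicSum`. -/
noncomputable def dualSum (w : ℕ → ℝ) (P₁ P₂ Z d : ℕ) : ℝ :=
  ∑ b ∈ Icc 1 P₁ ×ˢ Icc 1 P₂, dyadicSum w Z (b.1 * b.2) * (J((b.1 * b.2 : ℕ) | d) : ℝ)

theorem dyadicEnergy_eq (w : ℕ → ℝ) (P₁ P₂ Z : ℕ) :
    dyadicEnergy w P₁ P₂ Z = ∑ d ∈ Ico Z (2 * Z), w d * dualSum w P₁ P₂ Z d := by
  unfold dyadicEnergy dualSum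
  simp_rw [mul_sum]
  rw [sum_comm]
  refine sum_congr rfl fun b _ => ?_
  rw [sq]
  conv_lhs => rw [dyadicSum, sum_mul]
  exact sum_congr rfl fun d _ => by rw [dyadicSum]; ring

theorem card_filter_isSquare_box_le (P₁ P₂ m : ℕ) (hm : m ≠ 0) :
    (#{b ∈ Icc 1 P₁ ×ˢ Icc 1 P₂ | IsSquare (b.1 * b.2 * m)} : ℝ) ≤
      ((P₁ * P₂ : ℕ) : ℝ) ^ ((3 : ℝ) / 4) := by
  set n := #{b ∈ Icc 1 P₁ ×ˢ Icc 1 P₂ | IsSquare (b.1 * b.2 * m)} with hn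
  have hA : n ≤ P₂ * Nat.sqrt P₁ := by
    calc n ≤ ∑ y ∈ Icc 1 P₂, #{x ∈ Icc 1 P₁ | IsSquare (x * (y * m))} := by
          rw [hn, card_filter, sum_product_right]
          refine sum_le_sum fun y _ => ?_
          rw [card_filter]
          exact sum_le_sum fun x _ => by rw [mul_assoc]
      _ ≤ ∑ y ∈ Icc 1 P₂, Nat.sqrt P₁ := sum_le_sum fun y hy =>
          card_filter_isSquare_mul_le _ (mul_ne_zero (by simp at hy; omega) hm) _
      _ = _ := by simp
  have hB : n ≤ P₁ * Nat.sqrt P₂ := by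
    calc n ≤ ∑ x ∈ Icc 1 P₁, #{y ∈ Icc 1 P₂ | IsSquare (y * (x * m))} := by
          rw [hn, card_filter, sum_product]
          refine sum_le_sum fun x _ => ?_
          rw [card_filter]
          exact sum_le_sum fun y _ => by rw [show x * y * m = y * (x * m) by ring]
      _ ≤ ∑ x ∈ Icc 1 P₁, Nat.sqrt P₂ := sum_le_sum fun x hx =>
          card_filter_isSquare_mul_le _ (mul_ne_zero (by simp at hx; omega) hm) _
      _ = _ := by simp
  have hsq : ((n : ℝ)) ^ 2 ≤ (P₁ * P₂ : ℝ) * Real.sqrt (P₁ * P₂) := by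
    have h1 : (n : ℝ) ≤ P₂ * Real.sqrt P₁ := by
      calc (n : ℝ) ≤ ((P₂ * Nat.sqrt P₁ : ℕ) : ℝ) := by exact_mod_cast hA
        _ ≤ _ := by push_cast; gcongr; exact Real.nat_sqrt_le_real_sqrt
    have h2 : (n : ℝ) ≤ P₁ * Real.sqrt P₂ := by
      calc (n : ℝ) ≤ ((P₁ * Nat.sqrt P₂ : ℕ) : ℝ) := by exact_mod_cast hB
        _ ≤ _ := by push_cast; gcongr; exact Real.nat_sqrt_le_real_sqrt
    calc (n : ℝ) ^ 2 = n * n := sq _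
      _ ≤ (P₂ * Real.sqrt P₁) * (P₁ * Real.sqrt P₂) := by gcongr
      _ = _ := by rw [Real.sqrt_mul (by positivity)]; ring
  refine abs_le_of_sq_le_sq' (hsq.trans (le_of_eq ?_)) (by positivity) |>.2
  push_cast
  set Q : ℝ := P₁ * P₂ with hQ
  have hQ0 : 0 ≤ Q := by positivity
  rw [Real.sqrt_eq_rpow, ← Real.rpow_mul_natCast hQ0]
  nth_rewrite 1 [← Real.rpow_one Q]
  rw [← Real.rpow_add_of_nonneg hQ0 (by norm_num) (by norm_num)]
  norm_num

theorem sq_dyadicEnergy_le_large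
    {w : ℕ → ℝ} {Z : ℕ} (hZ : 0 < Z) (hw : ∀ d, |w d| ≤ 1 / Z)
    (hw0 : ∀ d, w d ≠ 0 → Odd d ∧ Squarefree d)
    (P₁ P₂ : ℕ) :
    dyadicEnergy w P₁ P₂ Z ^ 2 ≤ 4 * ((P₁ * P₂ : ℕ) : ℝ) ^ 4 / Z +
      (P₁ * P₂ : ℕ) * ((P₁ * P₂ : ℕ) : ℝ) ^ ((3 : ℝ) / 4) := by
  have hZ' : (0 : ℝ) < Z := by exact_mod_cast hZ
  set B := Icc 1 P₁ ×ˢ Icc 1 P₂ with hB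
  have hBcard : (#B : ℝ) = (P₁ * P₂ : ℕ) := by
    rw [hB, card_product]; simp
  have hBpos : ∀ b ∈ B, b.1 * b.2 ≠ 0 := by
    intro b hb
    rw [hB, mem_product, mem_Icc, mem_Icc] at hb
    exact mul_ne_zero (by omega) (by omega)
  have hBle : ∀ b ∈ B, b.1 * b.2 ≤ P₁ * P₂ := by
    intro b hb
    rw [hB, mem_product, mem_Icc, mem_Icc] at hb
    exact Nat.mul_le_mul hb.1.2 hb.2.2
  set G : ℕ → ℝ := fun d => if Odd d then dualSum w P₁ P₂ Z d else 0 with hG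
  have h1 : dyadicEnergy w P₁ P₂ Z = ∑ d ∈ Ico Z (2 * Z), w d * G d := by
    rw [dyadicEnergy_eq]
    refine sum_congr rfl fun d _ => ?_
    by_cases hd : w d = 0
    · simp [hd]
    · simp only [hG, if_pos (hw0 d hd).1]
  have h2 : ∑ d ∈ Ico Z (2 * Z), w d ^ 2 ≤ 1 / Z := by
    calc _ ≤ ∑ d ∈ Ico Z (2 * Z), (1 / (Z : ℝ)) ^ 2 := sum_le_sum fun d _ => by
          rw [← sq_abs]; gcongr; exact hw d
      _ = _ := by simp [two_mul]; field_simp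
  have h3 : ∑ d ∈ Ico Z (2 * Z), G d ^ 2 ≤ ∑ b ∈ B, ∑ b' ∈ B,
      (4 * ((P₁ * P₂ : ℕ) : ℝ) ^ 2 +
        if IsSquare (b.1 * b.2 * (b'.1 * b'.2)) then (Z : ℝ) else 0) := by
    have : ∑ d ∈ Ico Z (2 * Z), G d ^ 2 = ∑ b ∈ B, ∑ b' ∈ B,
        dyadicSum w Z (b.1 * b.2) * dyadicSum w Z (b'.1 * b'.2) *
        ∑ d ∈ Ico Z (2 * Z),
          if Odd d then (J((b.1 * b.2 * (b'.1 * b'.2) : ℕ) | d) : ℝ) else 0 := by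
      simp_rw [mul_sum]
      rw [sum_congr rfl fun b _ => sum_comm (s := B), sum_comm]
      refine sum_congr rfl fun d _ => ?_
      simp only [hG]
      split_ifs with hd
      · rw [dualSum, sq, sum_mul_sum]
        refine sum_congr rfl fun b _ => sum_congr rfl fun b' _ => ?_
        rw [Nat.cast_mul (b.1 * b.2), jacobiSym.mul_left]; push_cast; ring
      · simp
    rw [this]
    refine sum_le_sum fun b hb => sum_le_sum fun b' hb' => (le_abs_self _).trans ?_
    rw [abs_mul, abs_mul]
    have ha : |dyadicSum w Z (b.1 * b.2)| * |dyadicSum w Z (b'.1 * b'.2)| ≤ 1 :=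
      mul_le_one₀ (abs_dyadicSum_le_one hZ hw _) (abs_nonneg _) (abs_dyadicSum_le_one hZ hw _)
    refine (mul_le_of_le_one_left (abs_nonneg _) ha).trans ?_
    split_ifs with hs
    · calc |∑ d ∈ Ico Z (2 * Z), if Odd d then
              (J((b.1 * b.2 * (b'.1 * b'.2) : ℕ) | d) : ℝ) else 0|
          ≤ ∑ d ∈ Ico Z (2 * Z), |if Odd d then
              (J((b.1 * b.2 * (b'.1 * b'.2) : ℕ) | d) : ℝ) else 0| := abs_sum_le_sum_abs _ _
        _ ≤ ∑ d ∈ Ico Z (2 * Z), 1 := sum_le_sum fun d _ => by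
            split_ifs
            · exact abs_jacobiSym_le_one _ _
            · simp
        _ = Z := by simp [two_mul]
        _ ≤ _ := by simp; positivity
    · rw [add_zero]
      refine (abs_sum_jacobiSym_right_le (mul_ne_zero (hBpos b hb) (hBpos b' hb')) hs _ _).trans ?_
      have := Nat.mul_le_mul (hBle b hb) (hBle b' hb')
      rw [sq]
      have : ((b.1 * b.2 * (b'.1 * b'.2) : ℕ) : ℝ) ≤ ((P₁ * P₂ * (P₁ * P₂) : ℕ) : ℝ) := by
        exact_mod_cast this
      rw [Nat.cast_mul (P₁ * P₂)] at this
      linarith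
  have h4 : ∑ b ∈ B, ∑ b' ∈ B, (4 * ((P₁ * P₂ : ℕ) : ℝ) ^ 2 +
      if IsSquare (b.1 * b.2 * (b'.1 * b'.2)) then (Z : ℝ) else 0) ≤
      4 * ((P₁ * P₂ : ℕ) : ℝ) ^ 4 +
        Z * ((P₁ * P₂ : ℕ) * ((P₁ * P₂ : ℕ) : ℝ) ^ ((3 : ℝ) / 4)) := by
    rw [sum_comm]
    calc _ ≤ ∑ b' ∈ B, (4 * ((P₁ * P₂ : ℕ) : ℝ) ^ 3 +
            Z * ((P₁ * P₂ : ℕ) : ℝ) ^ ((3 : ℝ) / 4)) := by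
          refine sum_le_sum fun b' hb' => ?_
          rw [sum_add_distrib, sum_const, nsmul_eq_mul, hBcard, ← sum_filter, sum_const,
            nsmul_eq_mul]
          have := card_filter_isSquare_box_le P₁ P₂ (b'.1 * b'.2) (hBpos b' hb')
          have := mul_le_mul_of_nonneg_right this hZ'.le
          linarith
      _ = _ := by
          rw [sum_const, nsmul_eq_mul, hBcard]; ring
  rw [h1]
  calc _ ≤ _ := sum_mul_sq_le_sq_mul_sq _ _ _
    _ ≤ 1 / Z * (4 * ((P₁ * P₂ : ℕ) : ℝ) ^ 4 +
        Z * ((P₁ * P₂ : ℕ) * ((P₁ * P₂ : ℕ) : ℝ) ^ ((3 : ℝ) / 4))) := by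
        gcongr
        exact h3.trans h4
    _ = _ := by field_simp

theorem card_filter_prod_eq_le (P₁ P₂ k l : ℕ) (hl : l ≠ 0) :
    #{t ∈ Fintype.piFinset (fun _ : Fin k => Icc 1 P₁ ×ˢ Icc 1 P₂) |
      ∏ i, (t i).1 * (t i).2 = l} ≤ #l.divisors ^ (2 * k) := by
  calc _ ≤ #(Fintype.piFinset (fun _ : Fin k => l.divisors ×ˢ l.divisors)) := by
        refine card_le_card fun t ht => ?_
        rw [mem_filter] at ht
        rw [Fintype.mem_piFinset]
        intro i
        have : (t i).1 * (t i).2 ∣ l := by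
          rw [← ht.2]; exact dvd_prod_of_mem (fun i => (t i).1 * (t i).2) (mem_univ i)
        rw [mem_product, Nat.mem_divisors, Nat.mem_divisors]
        exact ⟨⟨(dvd_mul_right _ _).trans this, hl⟩, ⟨(dvd_mul_left _ _).trans this, hl⟩⟩
    _ = _ := by
        rw [Fintype.card_piFinset]
        simp only [card_product, prod_const, card_univ, Fintype.card_fin]
        rw [pow_mul, sq]

theorem sum_abs_sum_jacobiSym_le (X Z : ℕ) (hZX : Z ^ 3 ≤ X) :
    ∑ l ∈ Icc 1 X, |∑ d ∈ Ico Z (2 * Z), (if Odd d ∧ Squarefree d then (1 : ℝ) else 0) *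
      (J(l | d) : ℝ)| ≤ 3 * Real.sqrt Z * X := by
  set w : ℕ → ℝ := fun d => if Odd d ∧ Squarefree d then 1 else 0 with hw
  have h1 := sum_sq_sum_jacobiSym_le (Icc 1 X) (fun l => l) 1 1 zero_le_one
    (fun n h1 h2 => by
      have := abs_sum_jacobiSym_left_le h1 h2 1 (X + 1)
      rw [one_mul]; exact this) Z w
    (fun d => by simp only [hw]; split_ifs <;> simp)
    (fun d hd => by by_contra hc; exact hd (by simp [hw, hc]))
  rw [Nat.card_Icc, Nat.add_sub_cancel, one_pow, one_mul, mul_one] at h1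
  have h2 : (4 : ℝ) * Z ^ 4 ≤ 4 * (Z * X) := by
    have : ((Z ^ 3 : ℕ) : ℝ) ≤ X := by exact_mod_cast hZX
    push_cast at this
    calc (4 : ℝ) * Z ^ 4 = 4 * (Z * Z ^ 3) := by ring
      _ ≤ _ := by gcongr
  have h3 := sum_mul_sq_le_sq_mul_sq (Icc 1 X) (fun _ => (1 : ℝ))
    (fun l => |∑ d ∈ Ico Z (2 * Z), w d * (J(l | d) : ℝ)|)
  simp only [one_mul, one_pow, sum_const, Nat.card_Icc, Nat.add_sub_cancel, nsmul_eq_mul, mul_one,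
    sq_abs] at h3
  refine abs_le_of_sq_le_sq' ?_ (by positivity) |>.2
  calc _ ≤ _ := h3
    _ ≤ X * (Z * X + 4 * (Z * X)) := by gcongr; linarith
    _ ≤ X * (Z * X + 8 * (Z * X)) := by gcongr; norm_num
    _ = _ := by rw [mul_pow, mul_pow, Real.sq_sqrt (by positivity)]; ring

theorem pow_dyadicEnergy_le
    {w : ℕ → ℝ} {Z : ℕ} (hZ : 0 < Z) (hw : ∀ d, |w d| ≤ 1 / Z)
    (hw0 : ∀ d, w d ≠ 0 → Odd d ∧ Squarefree d)
    (P₁ P₂ n : ℕ) :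
    dyadicEnergy w P₁ P₂ Z ^ (n + 1) ≤
      1 / Z * ∑ d ∈ Ico Z (2 * Z) with Odd d ∧ Squarefree d, |dualSum w P₁ P₂ Z d| ^ (n + 1) := by
  have hZ' : (0 : ℝ) < Z := by exact_mod_cast hZ
  set D := (Ico Z (2 * Z)).filter (fun d => Odd d ∧ Squarefree d) with hD
  have hE0 : 0 ≤ dyadicEnergy w P₁ P₂ Z := sum_nonneg fun _ _ => sq_nonneg _
  have h1 : dyadicEnergy w P₁ P₂ Z ≤ 1 / Z * ∑ d ∈ D, |dualSum w P₁ P₂ Z d| := by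
    rw [dyadicEnergy_eq, mul_sum, hD, sum_filter]
    refine sum_le_sum fun d _ => ?_
    split_ifs with h
    · refine (le_abs_self _).trans ?_
      rw [abs_mul]
      exact mul_le_mul_of_nonneg_right (hw d) (abs_nonneg _)
    · have : w d = 0 := by by_contra hc; exact h (hw0 d hc)
      simp [this]
  have hDc : (#D : ℝ) ≤ Z := by
    have : #D ≤ #(Ico Z (2 * Z)) := card_le_card (filter_subset _ _)
    rw [Nat.card_Ico] at this
    exact_mod_cast (show #D ≤ Z by omega)
  have h2 : (∑ d ∈ D, |dualSum w P₁ P₂ Z d|) ^ (n + 1) ≤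
      Z ^ n * ∑ d ∈ D, |dualSum w P₁ P₂ Z d| ^ (n + 1) := by
    rcases D.eq_empty_or_nonempty with he | hne
    · simp [he]
    have := pow_sum_div_card_le_sum_pow (s := D) (f := fun d => |dualSum w P₁ P₂ Z d|)
      (fun _ _ => abs_nonneg _) n
    have hpos : (0 : ℝ) < #D := by exact_mod_cast hne.card_pos
    rw [div_le_iff₀ (by positivity)] at this
    calc _ ≤ _ := this
      _ ≤ (∑ d ∈ D, |dualSum w P₁ P₂ Z d| ^ (n + 1)) * Z ^ n := by gcongr
      _ = _ := mul_comm _ _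
  calc _ ≤ (1 / Z * ∑ d ∈ D, |dualSum w P₁ P₂ Z d|) ^ (n + 1) := by gcongr
    _ = (1 / Z) ^ (n + 1) * (∑ d ∈ D, |dualSum w P₁ P₂ Z d|) ^ (n + 1) := mul_pow _ _ _
    _ ≤ (1 / Z) ^ (n + 1) * (Z ^ n * ∑ d ∈ D, |dualSum w P₁ P₂ Z d| ^ (n + 1)) := by gcongr
    _ = _ := by rw [div_pow, one_pow]; field_simp; ring

theorem sum_pow_dualSum_le
    {w : ℕ → ℝ} {Z : ℕ} (hZ : 0 < Z) (hw : ∀ d, |w d| ≤ 1 / Z)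
    (P₁ P₂ k : ℕ) (D : Finset ℕ) (R : ℝ)
    (hR : ∀ l ∈ Icc 1 ((P₁ * P₂) ^ k), (#l.divisors : ℝ) ^ (2 * k) ≤ R) :
    ∑ d ∈ D, dualSum w P₁ P₂ Z d ^ k ≤
      R * ∑ l ∈ Icc 1 ((P₁ * P₂) ^ k), |∑ d ∈ D, (J(l | d) : ℝ)| := by
  set T := Fintype.piFinset (fun _ : Fin k => Icc 1 P₁ ×ˢ Icc 1 P₂) with hT
  have hpow : ∀ d, dualSum w P₁ P₂ Z d ^ k = ∑ t ∈ T,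
      (∏ i, dyadicSum w Z ((t i).1 * (t i).2)) *
        (J((∏ i, (t i).1 * (t i).2 : ℕ) | d) : ℝ) := by
    intro d
    rw [dualSum, sum_pow']
    refine sum_congr rfl fun t _ => ?_
    rw [prod_mul_distrib, Nat.cast_prod, jacobiSym_prod_left, Int.cast_prod]
  have hmaps : ∀ t ∈ T, ∏ i, (t i).1 * (t i).2 ∈ Icc 1 ((P₁ * P₂) ^ k) := by
    intro t ht
    rw [hT, Fintype.mem_piFinset] at ht
    simp only [mem_product, mem_Icc] at ht
    rw [mem_Icc]
    constructor
    · exact Nat.one_le_iff_ne_zero.mpr (prod_ne_zero_iff.mpr fun i _ =>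
        mul_ne_zero (by have := (ht i).1.1; omega) (by have := (ht i).2.1; omega))
    · calc _ ≤ ∏ i : Fin k, P₁ * P₂ := prod_le_prod' fun i _ =>
            Nat.mul_le_mul (ht i).1.2 (ht i).2.2
        _ = _ := by simp
  calc ∑ d ∈ D, dualSum w P₁ P₂ Z d ^ k
      = ∑ t ∈ T, (∏ i, dyadicSum w Z ((t i).1 * (t i).2)) *
          ∑ d ∈ D, (J((∏ i, (t i).1 * (t i).2 : ℕ) | d) : ℝ) := by
        simp_rw [hpow, mul_sum]
        rw [sum_comm]
    _ ≤ ∑ t ∈ T, |∑ d ∈ D, (J((∏ i, (t i).1 * (t i).2 : ℕ) | d) : ℝ)| := by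
        refine sum_le_sum fun t _ => (le_abs_self _).trans ?_
        rw [abs_mul]
        refine mul_le_of_le_one_left (abs_nonneg _) ?_
        rw [abs_prod]
        exact prod_le_one (fun _ _ => abs_nonneg _) fun i _ => abs_dyadicSum_le_one hZ hw _
    _ = ∑ l ∈ Icc 1 ((P₁ * P₂) ^ k), ∑ t ∈ T with ∏ i, (t i).1 * (t i).2 = l,
          |∑ d ∈ D, (J((∏ i, (t i).1 * (t i).2 : ℕ) | d) : ℝ)| :=
        (sum_fiberwise_of_maps_to hmaps _).symm
    _ = ∑ l ∈ Icc 1 ((P₁ * P₂) ^ k), (#{t ∈ T | ∏ i, (t i).1 * (t i).2 = l} : ℝ) *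
          |∑ d ∈ D, (J(l | d) : ℝ)| := by
        refine sum_congr rfl fun l _ => ?_
        rw [← nsmul_eq_mul, ← sum_const]
        refine sum_congr rfl fun t ht => ?_
        rw [(mem_filter.mp ht).2]
    _ ≤ ∑ l ∈ Icc 1 ((P₁ * P₂) ^ k), R * |∑ d ∈ D, (J(l | d) : ℝ)| := by
        refine sum_le_sum fun l hl => ?_
        gcongr
        refine le_trans ?_ (hR l hl)
        have := card_filter_prod_eq_le P₁ P₂ k l (by rw [mem_Icc] at hl; omega)
        exact_mod_cast this
    _ = _ := by rw [mul_sum]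

theorem exists_dyadicEnergy_le_middle : ∃ K : ℝ, 1 ≤ K ∧ ∀ (w : ℕ → ℝ) (Z P₁ P₂ : ℕ), 0 < Z →
    0 < P₁ → 0 < P₂ →
    (∀ d, |w d| ≤ 1 / Z) → (∀ d, w d ≠ 0 → Odd d ∧ Squarefree d) →
    P₁ * P₂ ≤ Z ^ 8 → Z ≤ (P₁ * P₂) ^ 4 →
    dyadicEnergy w P₁ P₂ Z ≤
      K * ((P₁ * P₂ : ℕ) * ((P₁ * P₂ : ℕ) : ℝ) ^ (-(1 / 384) : ℝ)) := by
  obtain ⟨C, hC1, hC⟩ := card_divisors_le_rpow (1 / 9216) (by norm_num)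
  have hC24 : 1 ≤ C ^ 24 := one_le_pow₀ hC1
  refine ⟨3 * C ^ 24, by linarith, fun w Z P₁ P₂ hZ hP₁ hP₂ hw hw0 h8 h4 => ?_⟩
  have hZ' : (0 : ℝ) < Z := by exact_mod_cast hZ
  set P := P₁ * P₂ with hP
  have hPpos : 0 < P := Nat.mul_pos hP₁ hP₂
  have hP' : (0 : ℝ) < P := by exact_mod_cast hPpos
  have hE0 : 0 ≤ dyadicEnergy w P₁ P₂ Z := sum_nonneg fun _ _ => sq_nonneg _
  set D := (Ico Z (2 * Z)).filter (fun d => Odd d ∧ Squarefree d) with hD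
  set R : ℝ := C ^ 24 * (P : ℝ) ^ (1 / 32 : ℝ) with hR
  have hRb : ∀ l ∈ Icc 1 ((P₁ * P₂) ^ 12), (#l.divisors : ℝ) ^ (2 * 12) ≤ R := by
    intro l hl
    rw [mem_Icc] at hl
    have hl' : (l : ℝ) ≤ (P : ℝ) ^ 12 := by exact_mod_cast hl.2
    calc (#l.divisors : ℝ) ^ (2 * 12) ≤ (C * (l : ℝ) ^ (1 / 9216 : ℝ)) ^ 24 := by
          gcongr
          exact hC l (by omega)
      _ ≤ (C * ((P : ℝ) ^ 12) ^ (1 / 9216 : ℝ)) ^ 24 := by gcongr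
      _ = _ := by
          rw [mul_pow, hR, ← Real.rpow_natCast (P : ℝ) 12, ← Real.rpow_mul hP'.le,
            ← Real.rpow_mul_natCast hP'.le]
          norm_num
  have hZ3 : Z ^ 3 ≤ P ^ 12 := by
    calc Z ^ 3 ≤ (P ^ 4) ^ 3 := Nat.pow_le_pow_left h4 3
      _ = _ := by rw [← pow_mul]
  have h1 := pow_dyadicEnergy_le hZ hw hw0 P₁ P₂ 11
  have h2 := sum_pow_dualSum_le hZ hw P₁ P₂ 12 D R hRb
  have h3 := sum_abs_sum_jacobiSym_le (P ^ 12) Z hZ3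
  have h3' : ∑ l ∈ Icc 1 (P ^ 12), |∑ d ∈ D, (J(l | d) : ℝ)| ≤ 3 * Real.sqrt Z * (P : ℝ) ^ 12 := by
    push_cast at h3
    refine le_trans (le_of_eq ?_) h3
    refine sum_congr rfl fun l _ => ?_
    rw [hD, sum_filter]
    congr 1
    exact sum_congr rfl fun d _ => by split_ifs <;> simp
  have hsq : (P : ℝ) ^ (1 / 16 : ℝ) ≤ Real.sqrt Z := by
    rw [Real.sqrt_eq_rpow]
    have : (P : ℝ) ≤ (Z : ℝ) ^ 8 := by exact_mod_cast h8
    calc (P : ℝ) ^ (1 / 16 : ℝ) ≤ ((Z : ℝ) ^ 8) ^ (1 / 16 : ℝ) := by gcongr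
      _ = _ := by
        rw [← Real.rpow_natCast, ← Real.rpow_mul hZ'.le]; norm_num
  have hR0 : 0 ≤ R := by positivity
  have hfin : dyadicEnergy w P₁ P₂ Z ^ 12 ≤
      (3 * C ^ 24 * (P * (P : ℝ) ^ (-(1 / 384) : ℝ))) ^ 12 := by
    calc dyadicEnergy w P₁ P₂ Z ^ 12
        ≤ 1 / Z * ∑ d ∈ D, |dualSum w P₁ P₂ Z d| ^ 12 := h1
      _ = 1 / Z * ∑ d ∈ D, dualSum w P₁ P₂ Z d ^ 12 := by
          congr 1
          exact sum_congr rfl fun d _ => (by decide : Even 12).pow_abs _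
      _ ≤ 1 / Z * (R * (3 * Real.sqrt Z * (P : ℝ) ^ 12)) := by
          gcongr
          exact h2.trans (mul_le_mul_of_nonneg_left h3' hR0)
      _ = 3 * R * (P : ℝ) ^ 12 * (1 / Real.sqrt Z) := by
          have : (Z : ℝ) = Real.sqrt Z * Real.sqrt Z := (Real.mul_self_sqrt hZ'.le).symm
          have hs : 0 < Real.sqrt Z := Real.sqrt_pos.mpr hZ'
          rw [show (1 : ℝ) / Z = 1 / (Real.sqrt Z * Real.sqrt Z) by rw [← this]]
          field_simp
      _ ≤ 3 * R * (P : ℝ) ^ 12 * (1 / (P : ℝ) ^ (1 / 16 : ℝ)) := by gcongr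
      _ = 3 * C ^ 24 * ((P : ℝ) ^ 12 * (P : ℝ) ^ (-(1 / 32) : ℝ)) := by
          rw [hR, show (-(1 / 32) : ℝ) = 1 / 32 - 1 / 16 by norm_num, Real.rpow_sub hP']
          ring
      _ ≤ (3 * C ^ 24) ^ 12 * ((P : ℝ) ^ 12 * (P : ℝ) ^ (-(1 / 32) : ℝ)) := by
          gcongr
          exact le_self_pow₀ (by linarith) (by norm_num)
      _ = _ := by
          rw [mul_pow (3 * C ^ 24) ((P : ℝ) * _), mul_pow (P : ℝ), ← Real.rpow_mul_natCast hP'.le]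
          norm_num
  exact le_of_pow_le_pow_left₀ (by norm_num) (by positivity) hfin

theorem exists_dyadicEnergy_le : ∃ K : ℝ, 1 ≤ K ∧ ∀ (w : ℕ → ℝ) (Z P₁ P₂ : ℕ), 0 < Z →
    0 < P₁ → 0 < P₂ →
    (∀ d, |w d| ≤ 1 / Z) → (∀ d, w d ≠ 0 → Odd d ∧ Squarefree d) →
    dyadicEnergy w P₁ P₂ Z ≤ K * ((P₁ * P₂ : ℕ) * ((Z : ℝ) ^ (-(1 / 4) : ℝ) +
      ((P₁ * P₂ : ℕ) : ℝ) ^ (-(1 / 8) : ℝ) +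
      if Z ≤ (P₁ * P₂) ^ 4 then ((P₁ * P₂ : ℕ) : ℝ) ^ (-(1 / 384) : ℝ) else 0)) := by
  obtain ⟨K, hK1, hK⟩ := exists_dyadicEnergy_le_middle
  refine ⟨4 * K, by linarith, fun w Z P₁ P₂ hZ hP₁ hP₂ hw hw0 => ?_⟩
  have hZ' : (0 : ℝ) < Z := by exact_mod_cast hZ
  have hZ1 : (1 : ℝ) ≤ Z := by exact_mod_cast hZ
  have hmid := hK w Z P₁ P₂ hZ hP₁ hP₂ hw hw0
  have hsmall := dyadicEnergy_le_small hZ hw hw0 P₁ P₂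
  have hlarge := sq_dyadicEnergy_le_large hZ hw hw0 P₁ P₂
  have hPpos : 0 < P₁ * P₂ := Nat.mul_pos hP₁ hP₂
  generalize P₁ * P₂ = P at *
  have hP' : (0 : ℝ) < P := by exact_mod_cast hPpos
  have hP1 : (1 : ℝ) ≤ P := by exact_mod_cast hPpos
  set E := dyadicEnergy w P₁ P₂ Z
  have ha : 0 < (P : ℝ) * (Z : ℝ) ^ (-(1 / 4) : ℝ) := by positivity
  have hb : 0 < (P : ℝ) * (P : ℝ) ^ (-(1 / 8) : ℝ) := by positivity
  have hc : 0 < (P : ℝ) * (P : ℝ) ^ (-(1 / 384) : ℝ) := by positivity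
  have hkey : E ≤ 4 * (P * (Z : ℝ) ^ (-(1 / 4) : ℝ) + P * (P : ℝ) ^ (-(1 / 8) : ℝ)) ∨
      (Z ≤ P ^ 4 ∧ E ≤ K * (P * (P : ℝ) ^ (-(1 / 384) : ℝ))) := by
    by_cases h8 : P ≤ Z ^ 8
    · by_cases h4 : Z ≤ P ^ 4
      · exact Or.inr ⟨h4, hmid h8 h4⟩
      · left
        have h4' : (P : ℝ) ^ 4 ≤ Z := by exact_mod_cast (not_le.mp h4).le
        have hP4 : (P : ℝ) ≤ (Z : ℝ) ^ (1 / 4 : ℝ) := by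
          calc (P : ℝ) = ((P : ℝ) ^ 4) ^ (1 / 4 : ℝ) := by
                rw [← Real.rpow_natCast, ← Real.rpow_mul hP'.le]; norm_num
            _ ≤ _ := by gcongr
        have h1 : 4 * (P : ℝ) ^ 4 / Z ≤ (2 * (P * (Z : ℝ) ^ (-(1 / 4) : ℝ))) ^ 2 := by
          calc 4 * (P : ℝ) ^ 4 / Z = 4 * P ^ 2 * (P ^ 2 / Z) := by ring
            _ ≤ 4 * P ^ 2 * (((Z : ℝ) ^ (1 / 4 : ℝ)) ^ 2 / Z) := by gcongr
            _ = _ := by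
              rw [mul_pow, mul_pow, ← Real.rpow_mul_natCast hZ'.le, ← Real.rpow_mul_natCast hZ'.le]
              nth_rewrite 2 [← Real.rpow_one (Z : ℝ)]
              rw [← Real.rpow_sub hZ']
              norm_num; ring
        have h2 : (P : ℝ) * (P : ℝ) ^ ((3 : ℝ) / 4) ≤ (P * (P : ℝ) ^ (-(1 / 8) : ℝ)) ^ 2 := by
          apply le_of_eq
          rw [mul_pow, sq (P : ℝ), mul_assoc, ← Real.rpow_mul_natCast hP'.le]
          nth_rewrite 4 [← Real.rpow_one (P : ℝ)]
          rw [← Real.rpow_add hP']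
          norm_num
        have h3 : E ≤ 2 * (P * (Z : ℝ) ^ (-(1 / 4) : ℝ)) + P * (P : ℝ) ^ (-(1 / 8) : ℝ) := by
          refine abs_le_of_sq_le_sq' ?_ (by positivity) |>.2
          nlinarith
        linarith
    · left
      have h8' : (Z : ℝ) ^ 8 ≤ P := by exact_mod_cast (not_le.mp h8).le
      have h1 : (P : ℝ) / Z ≤ P * (Z : ℝ) ^ (-(1 / 4) : ℝ) := by
        rw [div_eq_mul_inv, ← Real.rpow_neg_one]
        gcongr
        norm_num
      have h2 : 4 * (Z : ℝ) ^ 2 * Real.sqrt P ≤ 4 * (P * (P : ℝ) ^ (-(1 / 8) : ℝ)) := by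
        have hz2 : (Z : ℝ) ^ 2 ≤ (P : ℝ) ^ (1 / 4 : ℝ) := by
          calc (Z : ℝ) ^ 2 = ((Z : ℝ) ^ 8) ^ (1 / 4 : ℝ) := by
                rw [← Real.rpow_natCast, ← Real.rpow_natCast, ← Real.rpow_mul hZ'.le]; norm_num
            _ ≤ _ := by gcongr
        rw [Real.sqrt_eq_rpow]
        calc 4 * (Z : ℝ) ^ 2 * (P : ℝ) ^ (1 / 2 : ℝ)
            ≤ 4 * (P : ℝ) ^ (1 / 4 : ℝ) * (P : ℝ) ^ (1 / 2 : ℝ) := by gcongr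
          _ = 4 * (P : ℝ) ^ (3 / 4 : ℝ) := by
              rw [mul_assoc, ← Real.rpow_add hP']; norm_num
          _ ≤ 4 * (P : ℝ) ^ (1 + -(1 / 8) : ℝ) := by
              gcongr
              norm_num
          _ = _ := by rw [Real.rpow_add hP', Real.rpow_one]
      linarith
  rw [mul_add, mul_add]
  rcases hkey with h | ⟨h4, h⟩
  · refine h.trans ?_
    have h0 : 0 ≤ (P : ℝ) * (if Z ≤ P ^ 4 then (P : ℝ) ^ (-(1 / 384) : ℝ) else 0) := by
      split_ifs <;> positivity
    nlinarith
  · rw [if_pos h4]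
    nlinarith

/-- The product of `1 + (D/p)` over the odd primes `p ∣ n`. -/
noncomputable def rootWeight (D : ℤ) (n : ℕ) : ℝ :=
  ∏ p ∈ n.primeFactors.erase 2, (1 + (J(D | p) : ℝ))

noncomputable def rootWeightSum (D : ℤ) (N : ℕ) : ℝ := ∑ n ∈ Icc 1 N, rootWeight D n

theorem rootWeight_nonneg (D : ℤ) (n : ℕ) : 0 ≤ rootWeight D n :=
  prod_nonneg fun p _ => by
    have := (abs_le.mp (abs_jacobiSym_le_one D p)).1
    linarith

theorem rootWeightSum_nonneg (D : ℤ) (N : ℕ) : 0 ≤ rootWeightSum D N :=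
  sum_nonneg fun n _ => rootWeight_nonneg D n

theorem jacobiSym_prod_right (a : ℤ) (t : Finset ℕ) (ht : ∀ p ∈ t, p ≠ 0) :
    J(a | ∏ p ∈ t, p) = ∏ p ∈ t, J(a | p) := by
  induction t using Finset.induction_on with
  | empty => simp
  | insert q s hq ih =>
    rw [prod_insert hq, prod_insert hq, jacobiSym.mul_right' _ (ht q (mem_insert_self _ _)), ih]
    · exact fun p hp => ht p (mem_insert_of_mem hp)
    · exact prod_ne_zero_iff.mpr fun p hp => ht p (mem_insert_of_mem hp)

theorem rootWeight_eq_sum (D : ℤ) {n : ℕ} (hn : n ≠ 0) :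
    rootWeight D n = ∑ d ∈ n.divisors with Odd d ∧ Squarefree d, (J(D | d) : ℝ) := by
  rw [rootWeight, prod_one_add]
  have hprime : ∀ t ∈ (n.primeFactors.erase 2).powerset, ∀ p ∈ t, p.Prime := fun t ht p hp =>
    Nat.prime_of_mem_primeFactors (mem_of_mem_erase (mem_powerset.mp ht hp))
  refine sum_nbij' (fun t => ∏ p ∈ t, p) Nat.primeFactors ?_ ?_ ?_ ?_ ?_
  · intro t ht
    rw [mem_filter, Nat.mem_divisors]
    refine ⟨⟨?_, hn⟩, ?_, ?_⟩
    · exact prod_primes_dvd n (fun p hp => (hprime t ht p hp).prime) fun p hp =>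
        Nat.dvd_of_mem_primeFactors (mem_of_mem_erase (mem_powerset.mp ht hp))
    · refine prod_induction _ Odd (fun _ _ => Odd.mul) odd_one fun p hp => ?_
      exact (hprime t ht p hp).odd_of_ne_two (ne_of_mem_erase (mem_powerset.mp ht hp))
    · refine squarefree_prod_of_pairwise_isCoprime (fun p hp q hq hpq => ?_) fun p hp =>
        (hprime t ht p hp).squarefree
      exact Nat.coprime_iff_isRelPrime.mp
        ((Nat.coprime_primes (hprime t ht p hp) (hprime t ht q hq)).mpr hpq)
  · intro d hd
    rw [mem_filter, Nat.mem_divisors] at hd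
    rw [mem_powerset]
    intro p hp
    refine mem_erase.mpr ⟨?_, Nat.primeFactors_mono hd.1.1 hn hp⟩
    rintro rfl
    exact (Nat.not_even_iff_odd.mpr hd.2.1) (even_iff_two_dvd.mpr (Nat.dvd_of_mem_primeFactors hp))
  · intro t ht
    exact Nat.primeFactors_prod (hprime t ht)
  · intro d hd
    exact Nat.prod_primeFactors_of_squarefree (mem_filter.mp hd).2.2
  · intro t ht
    rw [jacobiSym_prod_right D t fun p hp => (hprime t ht p hp).ne_zero, Int.cast_prod]

theorem rootWeightSum_eq (D : ℤ) (N : ℕ) :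
    rootWeightSum D N = ∑ d ∈ Icc 1 N,
      if Odd d ∧ Squarefree d then (J(D | d) : ℝ) * ((N / d : ℕ) : ℝ) else 0 := by
  have h : ∀ n ∈ Icc 1 N, rootWeight D n = ∑ d ∈ Icc 1 N,
      if d ∣ n then (if Odd d ∧ Squarefree d then (J(D | d) : ℝ) else 0) else 0 := by
    intro n hn
    rw [mem_Icc] at hn
    rw [rootWeight_eq_sum D (by omega), sum_filter, ← sum_filter (fun d => d ∣ n)]
    refine sum_congr ?_ fun _ _ => rfl
    ext d
    rw [Nat.mem_divisors, mem_filter, mem_Icc]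
    constructor
    · rintro ⟨h1, h2⟩
      exact ⟨⟨Nat.pos_of_dvd_of_pos h1 (by omega), (Nat.le_of_dvd (by omega) h1).trans hn.2⟩, h1⟩
    · rintro ⟨-, h1⟩
      exact ⟨h1, by omega⟩
  rw [rootWeightSum, sum_congr rfl h, sum_comm]
  refine sum_congr rfl fun d _ => ?_
  rw [← sum_filter, sum_const, nsmul_eq_mul]
  have : #{n ∈ Icc 1 N | d ∣ n} = N / d := Nat.Ioc_filter_dvd_card_eq_div N d
  rw [this]
  split_ifs
  · ring
  · simp

theorem sum_Ico_two_pow (f : ℕ → ℝ) (n : ℕ) :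
    ∑ d ∈ Ico 1 (2 ^ n), f d = ∑ j ∈ range n, ∑ d ∈ Ico (2 ^ j) (2 * 2 ^ j), f d := by
  induction n with
  | zero => simp
  | succ n ih =>
    rw [sum_range_succ, ← ih, ← pow_succ',
      sum_Ico_consecutive f Nat.one_le_two_pow (Nat.pow_le_pow_right (by norm_num) (by omega))]

/-- The weights of `rootWeightSum`, restricted to `Z ≤ d`. -/
noncomputable def twistWeight (k : ℤ) (N Z d : ℕ) : ℝ :=
  if (Odd d ∧ Squarefree d) ∧ Z ≤ d ∧ d ≤ N then (J(k | d) : ℝ) * ((N / d : ℕ) : ℝ) / N else 0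

theorem abs_twistWeight_le (k : ℤ) {N Z : ℕ} (hZ : 0 < Z) (d : ℕ) :
    |twistWeight k N Z d| ≤ 1 / Z := by
  have hZ' : (0 : ℝ) < Z := by exact_mod_cast hZ
  unfold twistWeight
  split_ifs with h
  · obtain ⟨-, h1, h2⟩ := h
    have hd' : (0 : ℝ) < d := by exact_mod_cast hZ.trans_le h1
    have hN' : (0 : ℝ) < N := by exact_mod_cast (hZ.trans_le h1).trans_le h2
    rw [abs_div, abs_mul, Nat.abs_cast, Nat.abs_cast, div_le_iff₀ hN']
    calc |(J(k | d) : ℝ)| * ((N / d : ℕ) : ℝ) ≤ 1 * ((N : ℝ) / d) := by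
          gcongr
          · exact abs_jacobiSym_le_one _ _
          · exact Nat.cast_div_le
      _ ≤ 1 * ((N : ℝ) / Z) := by gcongr
      _ = _ := by ring
  · simp

theorem rootWeightSum_eq_sum_dyadicSum (k : ℤ) {N : ℕ} (hN : 0 < N) (l : ℕ) :
    rootWeightSum (k * l) N =
      N * ∑ j ∈ range (Nat.log 2 N + 1), dyadicSum (twistWeight k N (2 ^ j)) (2 ^ j) l := by
  have hN' : (0 : ℝ) < N := by exact_mod_cast hN
  have h1 : ∀ j, dyadicSum (twistWeight k N (2 ^ j)) (2 ^ j) l =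
      ∑ d ∈ Ico (2 ^ j) (2 * 2 ^ j), twistWeight k N 1 d * (J(l | d) : ℝ) := by
    intro j
    refine sum_congr rfl fun d hd => ?_
    rw [mem_Ico] at hd
    have h2 : 1 ≤ d := Nat.one_le_two_pow.trans hd.1
    simp only [twistWeight, hd.1, h2]
  simp_rw [h1]
  rw [← sum_Ico_two_pow (fun d => twistWeight k N 1 d * (J(l | d) : ℝ)), rootWeightSum_eq, mul_sum]
  have hsub : Icc 1 N ⊆ Ico 1 (2 ^ (Nat.log 2 N + 1)) := by
    intro d hd
    rw [mem_Icc] at hd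
    rw [mem_Ico]
    exact ⟨hd.1, hd.2.trans_lt (Nat.lt_pow_succ_log_self (by norm_num) N)⟩
  symm
  rw [← sum_subset hsub]
  · refine sum_congr rfl fun d hd => ?_
    rw [mem_Icc] at hd
    simp only [twistWeight, hd.1, hd.2, and_true]
    split_ifs
    · rw [jacobiSym.mul_left]; push_cast; field_simp
    · simp
  · intro d _ hd2
    rw [twistWeight, if_neg]
    · simp
    · rintro ⟨-, h1, h2⟩
      exact hd2 (mem_Icc.mpr ⟨h1, h2⟩)

theorem exists_sum_sq_rootWeightSum_le : ∃ K : ℝ, 1 ≤ K ∧ ∀ (k : ℤ) (P₁ P₂ N : ℕ), 0 < P₁ → 0 < P₂ →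
    0 < N → ∑ b ∈ Icc 1 P₁ ×ˢ Icc 1 P₂, rootWeightSum (k * (b.1 * b.2 : ℕ)) N ^ 2 ≤
      K * (N ^ 2 * (P₁ * P₂ : ℕ) *
        (1 + Real.log (2 * N) * ((P₁ * P₂ : ℕ) : ℝ) ^ (-(1 / 16) : ℝ)) ^ 2) := by
  obtain ⟨K, hK1, hK⟩ := exists_dyadicEnergy_le
  set r : ℝ := (2 : ℝ) ^ (-(1 / 8) : ℝ) with hr
  have hr0 : 0 < r := by positivity
  have hr1 : r < 1 := Real.rpow_lt_one_of_one_lt_of_neg (by norm_num) (by norm_num)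
  set K₁ : ℝ := 1 / (1 - r) + 6145 with hK₁
  have hK₁1 : 6145 ≤ K₁ := by
    have : 0 ≤ 1 / (1 - r) := by
      apply div_nonneg zero_le_one; linarith
    linarith
  have hl2 : 1 / 2 ≤ Real.log 2 := by
    have := Real.log_two_gt_d9; linarith
  refine ⟨K * K₁ ^ 2, ?_, fun k P₁ P₂ N hP₁ hP₂ hN => ?_⟩
  · have := one_le_pow₀ (show 1 ≤ K₁ by linarith) (n := 2)
    nlinarith
  have hPpos : 0 < P₁ * P₂ := Nat.mul_pos hP₁ hP₂
  have hE := fun j => hK (twistWeight k N (2 ^ j)) (2 ^ j) P₁ P₂ (by positivity) hP₁ hP₂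
    (abs_twistWeight_le k (by positivity))
    (fun d hd => by
      by_contra hc
      exact hd (by rw [twistWeight, if_neg]; exact fun h => hc h.1))
  simp_rw [rootWeightSum_eq_sum_dyadicSum k hN, mul_pow, ← mul_sum]
  set L : ℕ → ℕ × ℕ → ℝ := fun j b => dyadicSum (twistWeight k N (2 ^ j)) (2 ^ j) (b.1 * b.2)
    with hL
  have hE' : ∀ j, ∑ b ∈ Icc 1 P₁ ×ˢ Icc 1 P₂, L j b ^ 2 =
    dyadicEnergy (twistWeight k N (2 ^ j)) P₁ P₂ (2 ^ j) := fun j => rfl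
  set B := Icc 1 P₁ ×ˢ Icc 1 P₂
  set P := P₁ * P₂ with hP
  have hP' : (0 : ℝ) < P := by exact_mod_cast hPpos
  have hP1 : (1 : ℝ) ≤ P := by exact_mod_cast hPpos
  have hN1 : (1 : ℝ) ≤ N := by exact_mod_cast hN
  set q : ℝ := (P : ℝ) ^ (-(1 / 16) : ℝ) with hq
  set s : ℝ := (P : ℝ) ^ (-(1 / 768) : ℝ) with hs
  have hq0 : 0 < q := by positivity
  have hs0 : 0 < s := by positivity
  set v : ℕ → ℝ := fun j => r ^ j + q + if 2 ^ j ≤ P ^ 4 then s else 0 with hv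
  have hv0 : ∀ j, 0 < v j := by
    intro j
    have : 0 ≤ if 2 ^ j ≤ P ^ 4 then s else 0 := by split_ifs <;> positivity
    simp only [hv]; positivity
  have hEv : ∀ j, ∑ b ∈ B, L j b ^ 2 ≤ K * P * v j ^ 2 := by
    intro j
    rw [hE' j]
    refine (hE j).trans ?_
    rw [mul_assoc]
    gcongr
    have h1 : ((2 ^ j : ℕ) : ℝ) ^ (-(1 / 4) : ℝ) = (r ^ j) ^ 2 := by
      push_cast
      rw [hr, ← pow_mul, ← Real.rpow_mul_natCast (by norm_num), ← Real.rpow_natCast,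
        ← Real.rpow_mul (by norm_num)]
      congr 1; push_cast; ring
    have h2 : (P : ℝ) ^ (-(1 / 8) : ℝ) = q ^ 2 := by
      rw [hq, ← Real.rpow_mul_natCast hP'.le]; norm_num
    have h3 : (P : ℝ) ^ (-(1 / 384) : ℝ) = s ^ 2 := by
      rw [hs, ← Real.rpow_mul_natCast hP'.le]; norm_num
    rw [h1, h2, h3]
    have hrj : 0 < r ^ j := by positivity
    simp only [hv]
    split_ifs
    · nlinarith [mul_pos hrj hq0, mul_pos hrj hs0, mul_pos hq0 hs0]
    · nlinarith [mul_pos hrj hq0]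
  set n := Nat.log 2 N + 1 with hn
  have hsumv : ∑ j ∈ range n, v j ≤ K₁ * (1 + Real.log (2 * N) * q) := by
    have h1 : ∑ j ∈ range n, r ^ j ≤ 1 / (1 - r) := by
      rw [geom_sum_eq hr1.ne, ← neg_div_neg_eq, neg_sub, neg_sub]
      have : 0 < 1 - r := by linarith
      gcongr
      have := pow_pos hr0 n; linarith
    have hlogN : (n : ℝ) ≤ 2 * Real.log (2 * N) := by
      have : (2 : ℝ) ^ Nat.log 2 N ≤ N := by exact_mod_cast Nat.pow_log_le_self 2 hN.ne'
      have h3 : (Nat.log 2 N : ℝ) * Real.log 2 ≤ Real.log N := by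
        rw [← Real.log_pow]; exact Real.log_le_log (by positivity) this
      rw [Real.log_mul (by norm_num) (by linarith), hn]
      push_cast
      nlinarith [Nat.cast_nonneg (α := ℝ) (Nat.log 2 N)]
    have h3 : ∑ j ∈ range n, (if 2 ^ j ≤ P ^ 4 then s else 0) ≤ 6145 := by
      rw [← sum_filter, sum_const, nsmul_eq_mul]
      have hcard : (#{j ∈ range n | 2 ^ j ≤ P ^ 4} : ℝ) ≤ 8 * Real.log P + 1 := by
        have hsub : {j ∈ range n | 2 ^ j ≤ P ^ 4} ⊆ range (Nat.log 2 (P ^ 4) + 1) := by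
          intro j hj
          rw [mem_filter] at hj
          rw [mem_range]
          have := Nat.le_log_of_pow_le (by norm_num) hj.2
          omega
        have h4 := card_le_card hsub
        rw [card_range] at h4
        have h5 : (2 : ℝ) ^ Nat.log 2 (P ^ 4) ≤ (P : ℝ) ^ 4 := by
          exact_mod_cast Nat.pow_log_le_self 2 (pow_ne_zero 4 hPpos.ne')
        have h6 : (Nat.log 2 (P ^ 4) : ℝ) * Real.log 2 ≤ 4 * Real.log P := by
          have := Real.log_le_log (by positivity) h5
          rw [Real.log_pow, Real.log_pow] at this
          exact_mod_cast this
        calc (#{j ∈ range n | 2 ^ j ≤ P ^ 4} : ℝ) ≤ (Nat.log 2 (P ^ 4) : ℝ) + 1 := by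
              exact_mod_cast h4
          _ ≤ _ := by nlinarith [Nat.cast_nonneg (α := ℝ) (Nat.log 2 (P ^ 4))]
      have hlogP : Real.log P ≤ 768 * (P : ℝ) ^ (1 / 768 : ℝ) := by
        have := Real.log_le_rpow_div hP'.le (show (0 : ℝ) < 1 / 768 by norm_num)
        linarith
      have hs1 : s ≤ 1 := Real.rpow_le_one_of_one_le_of_nonpos hP1 (by norm_num)
      have hPs : (P : ℝ) ^ (1 / 768 : ℝ) * s = 1 := by
        rw [hs, ← Real.rpow_add hP']; norm_num
      calc _ ≤ (8 * (768 * (P : ℝ) ^ (1 / 768 : ℝ)) + 1) * s := by gcongr; linarith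
        _ = 6144 * ((P : ℝ) ^ (1 / 768 : ℝ) * s) + s := by ring
        _ ≤ _ := by rw [hPs]; linarith
    simp only [hv]
    rw [sum_add_distrib, sum_add_distrib, sum_const, card_range, nsmul_eq_mul]
    have hl0 : 0 ≤ Real.log (2 * N) := Real.log_nonneg (by linarith)
    have h4 : (n : ℝ) * q ≤ 2 * (Real.log (2 * N) * q) := by nlinarith
    have h5 : 0 ≤ Real.log (2 * N) * q := by positivity
    nlinarith
  have hmain : ∑ b ∈ B, (∑ j ∈ range n, L j b) ^ 2 ≤ K * P * (∑ j ∈ range n, v j) ^ 2 := by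
    calc ∑ b ∈ B, (∑ j ∈ range n, L j b) ^ 2
        ≤ ∑ b ∈ B, (∑ j ∈ range n, v j) * ∑ j ∈ range n, L j b ^ 2 / v j := by
          refine sum_le_sum fun b _ => ?_
          refine sum_sq_le_sum_mul_sum_of_sq_le_mul _ (fun j _ => (hv0 j).le)
            (fun j _ => by have := hv0 j; positivity) fun j _ => le_of_eq ?_
          have := (hv0 j).ne'
          field_simp
      _ = (∑ j ∈ range n, v j) * ∑ j ∈ range n, (∑ b ∈ B, L j b ^ 2) / v j := by
          rw [← mul_sum, sum_comm]
          simp_rw [sum_div]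
      _ ≤ (∑ j ∈ range n, v j) * ∑ j ∈ range n, K * P * v j := by
          have : 0 ≤ ∑ j ∈ range n, v j := sum_nonneg fun j _ => (hv0 j).le
          gcongr with j _
          rw [div_le_iff₀ (hv0 j)]
          calc _ ≤ _ := hEv j
            _ = _ := by ring
      _ = _ := by rw [← mul_sum]; ring
  have hv0' : 0 ≤ ∑ j ∈ range n, v j := sum_nonneg fun j _ => (hv0 j).le
  calc (N : ℝ) ^ 2 * ∑ b ∈ B, (∑ j ∈ range n, L j b) ^ 2
      ≤ N ^ 2 * (K * P * (K₁ * (1 + Real.log (2 * N) * q)) ^ 2) := by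
        gcongr
        refine hmain.trans ?_
        gcongr
    _ = _ := by ring

theorem eq_or_eq_neg_of_parallel {x y x' y' : ℤ} (h : IsCoprime x y) (h' : IsCoprime x' y')
    (hx : x ≠ 0) (hp : x * y' = x' * y) : (x', y') = (x, y) ∨ (x', y') = (-x, -y) := by
  have h1 : x ∣ x' := h.dvd_of_dvd_mul_right ⟨y', hp.symm⟩
  have h2 : x' ∣ x := h'.dvd_of_dvd_mul_right ⟨y, hp⟩
  rcases Int.natAbs_eq_natAbs_iff.mp (Int.natAbs_eq_of_dvd_dvd h1 h2) with h3 | h3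
  · left
    subst h3
    rw [mul_left_cancel₀ hx hp]
  · right
    have hx' : x' = -x := by rw [h3, neg_neg]
    subst hx'
    have : y' = -y := mul_left_cancel₀ hx (by rw [hp]; ring)
    rw [this]

theorem dvd_det_of_mul_inv_eq {q : ℕ} {x y x' y' : ℤ} (hy : IsCoprime (q : ℤ) y)
    (hy' : IsCoprime (q : ℤ) y')
    (h : (x : ZMod q) * (y : ZMod q)⁻¹ = (x' : ZMod q) * (y' : ZMod q)⁻¹) :
    (q : ℤ) ∣ x * y' - x' * y := by
  have h1 := ZMod.coe_int_mul_inv_eq_one hy.symm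
  have h2 := ZMod.coe_int_mul_inv_eq_one hy'.symm
  rw [← ZMod.intCast_zmod_eq_zero_iff_dvd]
  push_cast
  calc (x : ZMod q) * y' - x' * y
      = (x * (y : ZMod q)⁻¹) * (y' * y) - x' * y := by
        linear_combination (-(x : ZMod q) * y') * h1
    _ = 0 := by rw [h]; linear_combination ((x' : ZMod q) * y) * h2

theorem card_parallel_le_two {F : Finset (ℤ × ℤ)} (hco : ∀ s ∈ F, IsCoprime s.1 s.2)
    (hne : ∀ s ∈ F, s.1 ≠ 0) {s : ℤ × ℤ} (hs : s ∈ F) {T : Finset (ℤ × ℤ)} (hT : T ⊆ F)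
    (hpar : ∀ t ∈ T, s.1 * t.2 = t.1 * s.2) : #T ≤ 2 := by
  have : T ⊆ {(s.1, s.2), (-s.1, -s.2)} := by
    intro t ht
    have := eq_or_eq_neg_of_parallel (hco s hs) (hco t (hT ht)) (hne s hs) (hpar t ht)
    rw [mem_insert, mem_singleton]
    exact this
  exact (card_le_card this).trans card_le_two

theorem card_class_le {q : ℕ} (hq : 0 < q) {C₀ C₁ : ℕ} (hC₀ : 0 < C₀) (hC₁ : 0 < C₁)
    (F : Finset (ℤ × ℤ)) (hco : ∀ s ∈ F, IsCoprime s.1 s.2)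
    (hb₀ : ∀ s ∈ F, C₀ ≤ s.1.natAbs ∧ s.1.natAbs < 2 * C₀)
    (hb₁ : ∀ s ∈ F, C₁ ≤ s.2.natAbs ∧ s.2.natAbs < 2 * C₁)
    (hdet : ∀ s ∈ F, ∀ t ∈ F, (q : ℤ) ∣ s.1 * t.2 - t.1 * s.2) :
    (#F : ℝ) ≤ 12 + 32 * ((C₀ * C₁ : ℝ) / q) := by
  have hq' : (0 : ℝ) < q := by exact_mod_cast hq
  have hne : ∀ s ∈ F, s.1 ≠ 0 := fun s hs h => by
    have := (hb₀ s hs).1; rw [h] at this; simp at this; omega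
  have := card_le_of_det_gap F (fun s => (s.1 : ℝ)) (fun s => (s.2 : ℝ)) (2 * C₀) (2 * C₁) q
    (by positivity) (by positivity) hq'
    (fun s hs => by
      rw [← Int.cast_abs, Int.abs_eq_natAbs]; exact_mod_cast (hb₀ s hs).2.le)
    (fun s hs => by
      rw [← Int.cast_abs, Int.abs_eq_natAbs]; exact_mod_cast (hb₁ s hs).2.le)
    (fun s hs => Or.inl (by exact_mod_cast hne s hs))
    (fun s hs t ht h => by
      have h0 : s.1 * t.2 - t.1 * s.2 ≠ 0 := by exact_mod_cast h
      have := Int.le_of_dvd (abs_pos.mpr h0) ((dvd_abs _ _).mpr (hdet s hs t ht))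
      exact_mod_cast this)
    (fun s hs T hT hp => card_parallel_le_two hco hne hs hT fun t ht => by
      have := hp t ht
      exact_mod_cast sub_eq_zero.mp this)
  calc _ ≤ _ := this
    _ = _ := by ring

theorem card_class_le_of_opposite {q : ℕ} (hq : 0 < q) {C₀ C₁ : ℕ} (hC₀ : 0 < C₀) (hC₁ : 0 < C₁)
    (F : Finset (ℤ × ℤ)) (hco : ∀ s ∈ F, IsCoprime s.1 s.2)
    (hb₀ : ∀ s ∈ F, C₀ ≤ s.1.natAbs ∧ s.1.natAbs < 2 * C₀)
    (hb₁ : ∀ s ∈ F, C₁ ≤ s.2.natAbs ∧ s.2.natAbs < 2 * C₁)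
    (hdet : ∀ s ∈ F, ∀ t ∈ F, (q : ℤ) ∣ s.1 * t.2 - t.1 * s.2)
    {u₀ u₁ : ℤ} (hu : u₀ * u₁ < 0) {M : ℝ} (hM : 0 < M)
    (hval : ∀ s ∈ F, |((u₀ * s.1 ^ 2 + u₁ * s.2 ^ 2 : ℤ) : ℝ)| ≤ M * q)
    {ρ : ℝ} (hρ : ∀ s ∈ F, |(s.1 : ℝ)| * |(s.2 : ℝ)| = ρ * (s.1 * s.2)) (hρ2 : ρ ^ 2 = 1) :
    (#F : ℝ) ≤ 12 + 32 * (M / Real.sqrt |((u₀ * u₁ : ℤ) : ℝ)|) := by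
  have hq' : (0 : ℝ) < q := by exact_mod_cast hq
  have hC₀' : (0 : ℝ) < C₀ := by exact_mod_cast hC₀
  have hC₁' : (0 : ℝ) < C₁ := by exact_mod_cast hC₁
  have hne : ∀ s ∈ F, s.1 ≠ 0 := fun s hs h => by
    have := (hb₀ s hs).1; rw [h] at this; simp at this; omega
  have hu₀ : u₀ ≠ 0 := by rintro rfl; simp at hu
  have hu₁ : u₁ ≠ 0 := by rintro rfl; simp at hu
  set α := Real.sqrt |(u₀ : ℝ)| with hα
  set β := Real.sqrt |(u₁ : ℝ)| with hβ
  have hα0 : 0 < α := Real.sqrt_pos.mpr (abs_pos.mpr (by exact_mod_cast hu₀))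
  have hβ0 : 0 < β := Real.sqrt_pos.mpr (abs_pos.mpr (by exact_mod_cast hu₁))
  have hα2 : α ^ 2 = |(u₀ : ℝ)| := Real.sq_sqrt (abs_nonneg _)
  have hβ2 : β ^ 2 = |(u₁ : ℝ)| := Real.sq_sqrt (abs_nonneg _)
  have hαβ : Real.sqrt |((u₀ * u₁ : ℤ) : ℝ)| = α * β := by
    rw [hα, hβ, ← Real.sqrt_mul (abs_nonneg _), ← abs_mul]; push_cast; rfl
  set V := max (α * C₀) (β * C₁) with hV
  have hV0 : 0 < V := lt_of_lt_of_le (by positivity) (le_max_left _ _)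
  have habs₀ : ∀ s ∈ F, (C₀ : ℝ) ≤ |(s.1 : ℝ)| ∧ |(s.1 : ℝ)| ≤ 2 * C₀ := fun s hs => by
    rw [← Int.cast_abs, Int.abs_eq_natAbs]
    exact ⟨by exact_mod_cast (hb₀ s hs).1, by exact_mod_cast (hb₀ s hs).2.le⟩
  have habs₁ : ∀ s ∈ F, (C₁ : ℝ) ≤ |(s.2 : ℝ)| ∧ |(s.2 : ℝ)| ≤ 2 * C₁ := fun s hs => by
    rw [← Int.cast_abs, Int.abs_eq_natAbs]
    exact ⟨by exact_mod_cast (hb₁ s hs).1, by exact_mod_cast (hb₁ s hs).2.le⟩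
  have hv : ∀ s ∈ F, |α * (s.1 : ℝ) + ρ * β * s.2| = α * |(s.1 : ℝ)| + β * |(s.2 : ℝ)| := by
    intro s hs
    rw [← abs_of_nonneg (show 0 ≤ α * |(s.1 : ℝ)| + β * |(s.2 : ℝ)| by positivity),
      ← sq_eq_sq_iff_abs_eq_abs]
    have h1 := hρ s hs
    have h2 := sq_abs (s.1 : ℝ)
    have h3 := sq_abs (s.2 : ℝ)
    linear_combination (β ^ 2 * (s.2 : ℝ) ^ 2) * hρ2 - α ^ 2 * h2 - β ^ 2 * h3 - 2 * α * β * h1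
  have hvlow : ∀ s ∈ F, V ≤ |α * (s.1 : ℝ) + ρ * β * s.2| := by
    intro s hs
    rw [hv s hs]
    have h1 := mul_le_mul_of_nonneg_left (habs₀ s hs).1 hα0.le
    have h2 := mul_le_mul_of_nonneg_left (habs₁ s hs).1 hβ0.le
    refine max_le ?_ ?_
    · have : 0 ≤ β * |(s.2 : ℝ)| := by positivity
      linarith
    · have : 0 ≤ α * |(s.1 : ℝ)| := by positivity
      linarith
  have hvup : ∀ s ∈ F, |α * (s.1 : ℝ) + ρ * β * s.2| ≤ 4 * V := by
    intro s hs
    rw [hv s hs]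
    have h1 := mul_le_mul_of_nonneg_left (habs₀ s hs).2 hα0.le
    have h2 := mul_le_mul_of_nonneg_left (habs₁ s hs).2 hβ0.le
    have h3 := le_max_left (α * C₀) (β * C₁)
    have h4 := le_max_right (α * C₀) (β * C₁)
    linarith
  have huv : ∀ s ∈ F, |α * (s.1 : ℝ) - ρ * β * s.2| * |α * (s.1 : ℝ) + ρ * β * s.2| ≤ M * q := by
    intro s hs
    refine le_trans (le_of_eq ?_) (hval s hs)
    rw [← abs_mul]
    have h1 : (α * (s.1 : ℝ) - ρ * β * s.2) * (α * (s.1 : ℝ) + ρ * β * s.2) =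
        |(u₀ : ℝ)| * s.1 ^ 2 - |(u₁ : ℝ)| * s.2 ^ 2 := by
      rw [← hα2, ← hβ2]; linear_combination (-(β ^ 2 * (s.2 : ℝ) ^ 2)) * hρ2
    rw [h1]
    push_cast
    rcases lt_or_gt_of_ne hu₀ with h | h
    · have h' : 0 < u₁ := by by_contra hc; nlinarith
      rw [abs_of_neg (show (u₀ : ℝ) < 0 by exact_mod_cast h),
        abs_of_pos (show (0 : ℝ) < u₁ by exact_mod_cast h'), ← abs_neg]
      congr 1; ring
    · have h' : u₁ < 0 := by by_contra hc; nlinarith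
      rw [abs_of_pos (show (0 : ℝ) < u₀ by exact_mod_cast h),
        abs_of_neg (show (u₁ : ℝ) < 0 by exact_mod_cast h')]
      congr 1; ring
  have hρ0 : |ρ| = 1 := by
    have : |ρ| ^ 2 = 1 := by rw [sq_abs, hρ2]
    exact (pow_eq_one_iff_of_nonneg (abs_nonneg _) two_ne_zero).mp this
  have hdets : ∀ s t : ℤ × ℤ, (α * (s.1 : ℝ) - ρ * β * s.2) * (α * (t.1 : ℝ) + ρ * β * t.2) -
      (α * (t.1 : ℝ) - ρ * β * t.2) * (α * (s.1 : ℝ) + ρ * β * s.2) =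
      2 * ρ * (α * β) * ((s.1 * t.2 - t.1 * s.2 : ℤ) : ℝ) := by
    intro s t; push_cast; ring
  have hρne : ρ ≠ 0 := by rintro rfl; simp at hρ2
  have := card_le_of_det_gap F (fun s => α * (s.1 : ℝ) - ρ * β * s.2)
    (fun s => α * (s.1 : ℝ) + ρ * β * s.2) (M * q / V) (4 * V) (2 * (α * β) * q)
    (by positivity) (by positivity) (by positivity)
    (fun s hs => by
      rw [le_div_iff₀ hV0]
      exact (mul_le_mul_of_nonneg_left (hvlow s hs) (abs_nonneg _)).trans (huv s hs))
    hvup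
    (fun s hs => Or.inr (abs_pos.mp (hV0.trans_le (hvlow s hs))))
    (fun s hs t ht h => by
      rw [hdets] at h ⊢
      have h0 : s.1 * t.2 - t.1 * s.2 ≠ 0 := by
        intro hc; rw [hc] at h; simp at h
      have := Int.le_of_dvd (abs_pos.mpr h0) ((dvd_abs _ _).mpr (hdet s hs t ht))
      have h2 : (q : ℝ) ≤ |((s.1 * t.2 - t.1 * s.2 : ℤ) : ℝ)| := by exact_mod_cast this
      rw [abs_mul, abs_mul, abs_mul, hρ0, abs_of_pos (mul_pos hα0 hβ0), abs_two, mul_one]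
      gcongr)
    (fun s hs T hT hp => card_parallel_le_two hco hne hs hT fun t ht => by
      have := hp t ht
      rw [hdets] at this
      have h3 : ((s.1 * t.2 - t.1 * s.2 : ℤ) : ℝ) = 0 := by
        rcases mul_eq_zero.mp this with h | h
        · exfalso
          have : 2 * ρ * (α * β) ≠ 0 := by positivity
          exact this h
        · exact h
      have h4 : s.1 * t.2 - t.1 * s.2 = 0 := by exact_mod_cast h3
      linarith)
  rw [hαβ]
  calc _ ≤ _ := this
    _ = 12 + 16 * (M / (α * β)) := by field_simp; ring
    _ ≤ _ := by gcongr; norm_num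

theorem two_pow_card_primeFactors_le_card_divisors {n : ℕ} (hn : n ≠ 0) :
    2 ^ #n.primeFactors ≤ #n.divisors := by
  rw [Nat.card_divisors hn, ← prod_const]
  refine prod_le_prod' fun p hp => ?_
  have := (Nat.prime_of_mem_primeFactors hp).factorization_pos_of_dvd hn
    (Nat.dvd_of_mem_primeFactors hp)
  omega

theorem rootWeight_eq_two_pow {D : ℤ} {n : ℕ}
    (h : ∀ p : ℕ, p.Prime → p ≠ 2 → p ∣ n → J(D | p) = 1) :
    rootWeight D n = 2 ^ #(n.primeFactors.erase 2) := by
  rw [rootWeight, ← prod_const]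
  refine prod_congr rfl fun p hp => ?_
  obtain ⟨h2, hp⟩ := mem_erase.mp hp
  rw [h p (Nat.prime_of_mem_primeFactors hp) h2 (Nat.dvd_of_mem_primeFactors hp)]
  norm_num

theorem sqrtBound_le_mul_rootWeight {D : ℤ} {α t γ : ℕ} (hα : α ≠ 0) (ht : t ≠ 0) (hγ : γ ≠ 0)
    (h : ∀ p : ℕ, p.Prime → p ≠ 2 → p ∣ α * t * γ ^ 2 → J(D | p) = 1) :
    (sqrtBound (α * t * γ ^ 2) : ℝ) ≤ 4 * (#t.divisors * (rootWeight D α * rootWeight D γ)) := by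
  have h1 := sqrtBound_le (α * t * γ ^ 2)
  rw [rootWeight_eq_two_pow fun p hp h2 hd =>
      h p hp h2 (dvd_mul_of_dvd_left (dvd_mul_of_dvd_left hd _) _),
    rootWeight_eq_two_pow fun p hp h2 hd =>
      h p hp h2 (dvd_mul_of_dvd_right (dvd_pow hd two_ne_zero) _)]
  have hsub : (α * t * γ ^ 2).primeFactors.erase 2 ⊆
      t.primeFactors ∪ (α.primeFactors.erase 2 ∪ γ.primeFactors.erase 2) := by
    intro p hp
    rw [Nat.primeFactors_mul (mul_ne_zero hα ht) (pow_ne_zero _ hγ), Nat.primeFactors_mul hα ht,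
      Nat.primeFactors_pow _ two_ne_zero] at hp
    simp only [mem_erase, mem_union] at hp ⊢
    tauto
  have hcard : #((α * t * γ ^ 2).primeFactors.erase 2) ≤
      #t.primeFactors + (#(α.primeFactors.erase 2) + #(γ.primeFactors.erase 2)) :=
    (card_le_card hsub).trans ((card_union_le _ _).trans (by gcongr; exact card_union_le _ _))
  have h3 := two_pow_card_primeFactors_le_card_divisors ht
  have : sqrtBound (α * t * γ ^ 2) ≤
      4 * (#t.divisors * (2 ^ #(α.primeFactors.erase 2) * 2 ^ #(γ.primeFactors.erase 2))) :=
    calc _ ≤ _ := h1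
      _ ≤ 4 * 2 ^ (#t.primeFactors + (#(α.primeFactors.erase 2) + #(γ.primeFactors.erase 2))) := by
        gcongr; norm_num
      _ ≤ _ := by
        rw [pow_add, pow_add]; gcongr
  exact_mod_cast this

theorem jacobiSym_neg_mul_eq_one {p : ℕ} {u₀ u₁ x y : ℤ}
    (hu : IsCoprime (p : ℤ) u₀) (hx : IsCoprime (p : ℤ) x) (hy : IsCoprime (p : ℤ) y)
    (h : (p : ℤ) ∣ u₀ * x ^ 2 + u₁ * y ^ 2) : J(-(u₀ * u₁) | p) = 1 := by
  have h1 : J(-(u₀ * u₁) * y ^ 2 | p) = J((u₀ * x) ^ 2 | p) := by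
    apply jacobiSym.mod_left'
    rw [← Int.ModEq, Int.modEq_iff_dvd]
    obtain ⟨k, hk⟩ := h
    exact ⟨u₀ * k, by linear_combination u₀ * hk⟩
  rwa [jacobiSym.mul_left, jacobiSym.sq_one' (Int.isCoprime_iff_gcd_eq_one.mp hy.symm),
    jacobiSym.sq_one' (Int.isCoprime_iff_gcd_eq_one.mp (hu.symm.mul_left hx.symm)), mul_one] at h1

theorem card_fiber_le {q : ℕ} (hq : 0 < q) {C₀ C₁ : ℕ} (hC₀ : 0 < C₀) (hC₁ : 0 < C₁)
    {u₀ u₁ : ℤ} (hu₀ : IsCoprime (q : ℤ) u₀) (hu₁ : IsCoprime (q : ℤ) u₁) (hne : u₀ * u₁ ≠ 0)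
    {M : ℝ} (hM : 0 < M) (T : Finset (ℤ × ℤ)) (hco : ∀ s ∈ T, IsCoprime s.1 s.2)
    (hb₀ : ∀ s ∈ T, C₀ ≤ s.1.natAbs ∧ s.1.natAbs < 2 * C₀)
    (hb₁ : ∀ s ∈ T, C₁ ≤ s.2.natAbs ∧ s.2.natAbs < 2 * C₁)
    (hq₁ : ∀ s ∈ T, IsCoprime (q : ℤ) s.2)
    (hdvd : ∀ s ∈ T, (q : ℤ) ∣ u₀ * s.1 ^ 2 + u₁ * s.2 ^ 2)
    (hval : ∀ s ∈ T, |((u₀ * s.1 ^ 2 + u₁ * s.2 ^ 2 : ℤ) : ℝ)| ≤ M * q) :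
    (#T : ℝ) ≤ 2 * sqrtBound q *
      (12 + 32 * min ((C₀ * C₁ : ℝ) / q) (M / Real.sqrt |((u₀ * u₁ : ℤ) : ℝ)|)) := by
  have : NeZero q := ⟨hq.ne'⟩
  have hq' : (0 : ℝ) < q := by exact_mod_cast hq
  set W := min ((C₀ * C₁ : ℝ) / q) (M / Real.sqrt |((u₀ * u₁ : ℤ) : ℝ)|) with hW
  have hW0 : 0 ≤ W := le_min (by positivity) (by positivity)
  set u : ZMod q := -(u₁ : ZMod q) * (u₀ : ZMod q)⁻¹ with hu
  have hinv₀ := ZMod.coe_int_mul_inv_eq_one hu₀.symm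
  have huu : IsUnit u := by
    have h1 := (ZMod.coe_int_isUnit_iff_isCoprime u₁ q).mpr hu₁
    exact h1.neg.mul (IsUnit.of_mul_eq_one _ ((mul_comm _ _).trans hinv₀))
  let f : ℤ × ℤ → ZMod q × Bool := fun s =>
    ((s.1 : ZMod q) * (s.2 : ZMod q)⁻¹, decide (0 < s.1 * s.2))
  set R : Finset (ZMod q × Bool) := ({x : ZMod q | x ^ 2 = u} : Finset _) ×ˢ univ with hR
  have hRcard : #R ≤ 2 * sqrtBound q := by
    have h1 := card_sqrt_le q hq.ne' u huu
    rw [Nat.card_eq_fintype_card, Fintype.card_subtype] at h1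
    rw [hR, card_product, card_univ, Fintype.card_bool]
    omega
  have hmaps : ∀ s ∈ T, f s ∈ R := by
    intro s hs
    have h1 := ZMod.coe_int_mul_inv_eq_one (hq₁ s hs).symm
    have h2 := (ZMod.intCast_zmod_eq_zero_iff_dvd _ q).mpr (hdvd s hs)
    push_cast at h2
    simp only [hR, mem_product, mem_univ, and_true, mem_filter, true_and, f]
    rw [hu]
    generalize (s.2 : ZMod q)⁻¹ = z at *
    generalize (u₀ : ZMod q)⁻¹ = w at *
    linear_combination z ^ 2 * w * h2 - (s.1 : ZMod q) ^ 2 * z ^ 2 * hinv₀ -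
      u₁ * w * (s.2 * z + 1) * h1
  have hclass : ∀ r ∈ R, (#{s ∈ T | f s = r} : ℝ) ≤ 12 + 32 * W := by
    rintro ⟨x, σ⟩ -
    set F : Finset (ℤ × ℤ) := {s ∈ T | f s = (x, σ)} with hF
    have hFT : ∀ s ∈ F, s ∈ T := fun s hs => (mem_filter.mp hs).1
    have hFx : ∀ s ∈ F, (s.1 : ZMod q) * (s.2 : ZMod q)⁻¹ = x := fun s hs =>
      (Prod.ext_iff.mp (mem_filter.mp hs).2).1
    have hFσ : ∀ s ∈ F, decide (0 < s.1 * s.2) = σ := fun s hs =>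
      (Prod.ext_iff.mp (mem_filter.mp hs).2).2
    have hdet : ∀ s ∈ F, ∀ t ∈ F, (q : ℤ) ∣ s.1 * t.2 - t.1 * s.2 := fun s hs t ht =>
      dvd_det_of_mul_inv_eq (hq₁ s (hFT s hs)) (hq₁ t (hFT t ht)) ((hFx s hs).trans (hFx t ht).symm)
    have h1 := card_class_le hq hC₀ hC₁ F (fun s hs => hco s (hFT s hs))
      (fun s hs => hb₀ s (hFT s hs)) (fun s hs => hb₁ s (hFT s hs)) hdet
    have h2 : (#F : ℝ) ≤ 12 + 32 * (M / Real.sqrt |((u₀ * u₁ : ℤ) : ℝ)|) := by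
      rcases F.eq_empty_or_nonempty with he | ⟨s, hs⟩
      · rw [he, card_empty, Nat.cast_zero]; positivity
      rcases lt_or_gt_of_ne hne with hn | hp
      · have hne' : ∀ s ∈ F, s.1 * s.2 ≠ 0 := by
          intro s hs h
          have h3 := (hb₀ s (hFT s hs)).1
          have h4 := (hb₁ s (hFT s hs)).1
          rcases mul_eq_zero.mp h with h | h
          · rw [h, Int.natAbs_zero] at h3; omega
          · rw [h, Int.natAbs_zero] at h4; omega
        refine card_class_le_of_opposite hq hC₀ hC₁ F (fun s hs => hco s (hFT s hs))
          (fun s hs => hb₀ s (hFT s hs)) (fun s hs => hb₁ s (hFT s hs)) hdet hn hM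
          (fun s hs => hval s (hFT s hs)) (ρ := if σ then 1 else -1) ?_ (by split_ifs <;> norm_num)
        intro s hs
        have h3 := hFσ s hs
        rw [← abs_mul]
        split_ifs with h4
        · rw [h4, decide_eq_true_iff] at h3
          rw [one_mul, abs_of_pos]; exact_mod_cast h3
        · rw [Bool.eq_false_of_not_eq_true h4, decide_eq_false_iff_not] at h3
          rw [neg_one_mul, abs_of_neg]
          have := lt_of_le_of_ne (not_lt.mp h3) (hne' s hs)
          exact_mod_cast this
      · refine h1.trans ?_
        gcongr 12 + 32 * ?_
        set v := Real.sqrt |((u₀ * u₁ : ℤ) : ℝ)| with hv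
        have hv0 : 0 < v := Real.sqrt_pos.mpr (abs_pos.mpr (by exact_mod_cast hne))
        have hv2 : v ^ 2 = |((u₀ * u₁ : ℤ) : ℝ)| := Real.sq_sqrt (abs_nonneg _)
        rw [div_le_div_iff₀ hq' hv0]
        have hx : (C₀ : ℝ) ≤ |(s.1 : ℝ)| := by
          rw [← Int.cast_abs, Int.abs_eq_natAbs]; exact_mod_cast (hb₀ s (hFT s hs)).1
        have hy : (C₁ : ℝ) ≤ |(s.2 : ℝ)| := by
          rw [← Int.cast_abs, Int.abs_eq_natAbs]; exact_mod_cast (hb₁ s (hFT s hs)).1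
        refine le_trans ?_ (hval s (hFT s hs))
        have hxy : (C₀ : ℝ) * C₁ * v ≤ |(s.1 : ℝ)| * |(s.2 : ℝ)| * v := by gcongr
        refine hxy.trans (abs_le_of_sq_le_sq ?_ (abs_nonneg _) |>.trans' (le_abs_self _))
        rw [mul_pow, mul_pow, hv2, sq_abs, sq_abs, sq_abs, abs_of_pos (by exact_mod_cast hp)]
        push_cast
        have hp' : (0 : ℝ) < u₀ * u₁ := by exact_mod_cast hp
        have : 0 ≤ (u₀ * u₁ : ℝ) * (s.1 ^ 2 * s.2 ^ 2) := by positivity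
        nlinarith [sq_nonneg ((u₀ : ℝ) * s.1 ^ 2 - u₁ * s.2 ^ 2)]
    rw [hW]
    rcases min_choice ((C₀ * C₁ : ℝ) / q) (M / Real.sqrt |((u₀ * u₁ : ℤ) : ℝ)|) with h | h <;>
      rw [h]
    · exact h1
    · exact h2
  rw [card_eq_sum_card_fiberwise hmaps]
  push_cast
  calc ∑ r ∈ R, (#{s ∈ T | f s = r} : ℝ) ≤ ∑ r ∈ R, (12 + 32 * W) := sum_le_sum hclass
    _ = #R * (12 + 32 * W) := by rw [sum_const, nsmul_eq_mul]
    _ ≤ _ := by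
      gcongr
      exact_mod_cast hRcard

/-- The coordinate triples `(a, b, c)` as one point. -/
abbrev Triple : Type := (Fin 3 → ℤ) × (Fin 3 → ℤ) × (Fin 3 → ℤ)

/-- The arithmetic conditions on a counted point, without the size conditions. -/
structure IsPt (x : Triple) : Prop where
  a_ne : ∀ i, x.1 i ≠ 0
  b_ne : ∀ i, x.2.1 i ≠ 0
  c_ne : ∀ i, x.2.2 i ≠ 0
  eqn : ∑ i, x.1 i * x.2.1 i * x.2.2 i ^ 2 = 0
  aa : ∀ i j, i ≠ j → IsCoprime (x.1 i) (x.1 j)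
  ac : ∀ i j, i ≠ j → IsCoprime (x.1 i) (x.2.2 j)
  cc : ∀ i j, i ≠ j → IsCoprime (x.2.2 i) (x.2.2 j)
  bbb : ∀ d : ℤ, (∀ i, d ∣ x.2.1 i) → IsUnit d
  abb : ∀ i j k, i ≠ j → j ≠ k → i ≠ k → ∀ d : ℤ, d ∣ x.1 i → d ∣ x.2.1 j → d ∣ x.2.1 k → IsUnit d

/-- The coordinates of the point lie in the dyadic box with lower corner `(A, B, C)`. -/
structure InBox (A B C : Fin 3 → ℕ) (x : Triple) : Prop where
  a_le : ∀ i, A i ≤ (x.1 i).natAbs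
  a_lt : ∀ i, (x.1 i).natAbs < 2 * A i
  b_le : ∀ i, B i ≤ (x.2.1 i).natAbs
  b_lt : ∀ i, (x.2.1 i).natAbs < 2 * B i
  c_le : ∀ i, C i ≤ (x.2.2 i).natAbs
  c_lt : ∀ i, (x.2.2 i).natAbs < 2 * C i

/-- The parameters attached to a point in the sum over the special index `2`. -/
structure HasKey (a₀ a₁ s₀ s₁ s₂ s₃ : ℤ) (e t β₀ β₁ α γ : ℕ) (x : Triple) : Prop where
  a0 : x.1 0 = a₀
  a1 : x.1 1 = a₁
  a2 : x.1 2 = s₂ * α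
  b0 : x.2.1 0 = s₀ * ((t * e ^ 2 : ℕ) * β₀)
  b1 : x.2.1 1 = s₁ * ((t * e ^ 2 : ℕ) * β₁)
  c2 : x.2.2 2 = s₃ * (t * e * γ : ℕ)

/-- The quantity controlling the number of points per residue class. -/
noncomputable def classWidth (A B C : Fin 3 → ℕ) : ℝ :=
  min ((C 0 * C 1 : ℝ) / (A 2 * C 2 ^ 2)) (2 * B 2 / Real.sqrt (A 0 * A 1 * (B 0 * B 1)))

theorem isUnit_natCast_prime_false {p : ℕ} (hp : p.Prime) (h : IsUnit (p : ℤ)) : False :=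
  (Nat.prime_iff_prime_int.mp hp).not_isUnit h

theorem natAbs_eq_of_sq_eq_one {s : ℤ} (hs : s ^ 2 = 1) (n : ℕ) : (s * n).natAbs = n := by
  rw [Int.natAbs_mul, Int.natAbs_natCast]
  rcases sq_eq_one_iff.mp hs with h | h <;> simp [h]

theorem card_hasKey_le {A B C : Fin 3 → ℕ} (hA : ∀ i, 0 < A i) (hB : ∀ i, 0 < B i)
    (hC : ∀ i, 0 < C i) {a₀ a₁ s₀ s₁ s₂ s₃ : ℤ} {e t β₀ β₁ α γ : ℕ}
    (hs₀ : s₀ ^ 2 = 1) (hs₁ : s₁ ^ 2 = 1) (hs₂ : s₂ ^ 2 = 1) (hs₃ : s₃ ^ 2 = 1)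
    (hβ : Nat.Coprime β₀ β₁) (T : Finset Triple)
    (hT : ∀ x ∈ T, IsPt x ∧ InBox A B C x ∧ HasKey a₀ a₁ s₀ s₁ s₂ s₃ e t β₀ β₁ α γ x) :
    (#T : ℝ) ≤ 8 * (#t.divisors * (rootWeight (-(a₀ * a₁ * (s₀ * s₁)) * (β₀ * β₁ : ℕ)) α *
      rootWeight (-(a₀ * a₁ * (s₀ * s₁)) * (β₀ * β₁ : ℕ)) γ)) *
      (12 + 32 * ((t * e ^ 2 : ℕ) * classWidth A B C)) := by
  set D := -(a₀ * a₁ * (s₀ * s₁)) * (β₀ * β₁ : ℕ) with hD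
  have hw := rootWeight_nonneg D α
  have hw' := rootWeight_nonneg D γ
  have hW0 : 0 ≤ classWidth A B C := le_min (by positivity) (by positivity)
  rcases T.eq_empty_or_nonempty with he | ⟨x₀, hx₀⟩
  · rw [he, card_empty, Nat.cast_zero]; positivity
  obtain ⟨P₀, I₀, k₀⟩ := hT x₀ hx₀
  have hα : 0 < α := Nat.pos_of_ne_zero fun h => P₀.a_ne 2 (by rw [k₀.a2, h]; simp)
  have hγ : 0 < γ := Nat.pos_of_ne_zero fun h => P₀.c_ne 2 (by rw [k₀.c2, h]; simp)
  have ht : 0 < t := Nat.pos_of_ne_zero fun h => P₀.c_ne 2 (by rw [k₀.c2, h]; simp)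
  have hee : 0 < e := Nat.pos_of_ne_zero fun h => P₀.c_ne 2 (by rw [k₀.c2, h]; simp)
  have hβ₀ : 0 < β₀ := Nat.pos_of_ne_zero fun h => P₀.b_ne 0 (by rw [k₀.b0, h]; simp)
  have hβ₁ : 0 < β₁ := Nat.pos_of_ne_zero fun h => P₀.b_ne 1 (by rw [k₀.b1, h]; simp)
  have hs₀' : s₀ ≠ 0 := by rintro rfl; norm_num at hs₀
  have hs₁' : s₁ ≠ 0 := by rintro rfl; norm_num at hs₁
  have ha₀ : a₀ ≠ 0 := k₀.a0 ▸ P₀.a_ne 0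
  have ha₁ : a₁ ≠ 0 := k₀.a1 ▸ P₀.a_ne 1
  set u₀ : ℤ := a₀ * (s₀ * β₀) with hu₀
  set u₁ : ℤ := a₁ * (s₁ * β₁) with hu₁
  have hβ₀z : (β₀ : ℤ) ≠ 0 := by exact_mod_cast hβ₀.ne'
  have hβ₁z : (β₁ : ℤ) ≠ 0 := by exact_mod_cast hβ₁.ne'
  have hune : u₀ * u₁ ≠ 0 := by rw [hu₀, hu₁]; positivity
  set q := α * t * γ ^ 2 with hq
  have hqpos : 0 < q := by positivity
  have heqn : ∀ x ∈ T, u₀ * x.2.2 0 ^ 2 + u₁ * x.2.2 1 ^ 2 = -(s₂ * x.2.1 2 * q) := by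
    intro x hx
    obtain ⟨P, -, k⟩ := hT x hx
    have h := P.eqn
    rw [Fin.sum_univ_three, k.a0, k.a1, k.a2, k.b0, k.b1, k.c2] at h
    have hg : ((t * e ^ 2 : ℕ) : ℤ) ≠ 0 := by positivity
    refine mul_left_cancel₀ hg ?_
    rw [hu₀, hu₁, hq]
    push_cast at h ⊢
    linear_combination h - (s₂ * α * x.2.1 2 * (t * e * γ) ^ 2) * hs₃
  have hdvd : ∀ x ∈ T, (q : ℤ) ∣ u₀ * x.2.2 0 ^ 2 + u₁ * x.2.2 1 ^ 2 := fun x hx => by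
    rw [heqn x hx]; exact (Dvd.intro_left _ rfl).neg_right
  have hpr : ∀ x ∈ T, ∀ p : ℕ, p.Prime → p ∣ q →
      (¬ (p : ℤ) ∣ x.1 0 ∧ ¬ (p : ℤ) ∣ x.1 1) ∧ (¬ (p : ℤ) ∣ x.2.2 0 ∧ ¬ (p : ℤ) ∣ x.2.2 1) := by
    intro x hx p hp hpq
    obtain ⟨P, -, k⟩ := hT x hx
    have hcase : (p : ℤ) ∣ x.1 2 ∨ (p : ℤ) ∣ x.2.2 2 := by
      rw [hq, hp.dvd_mul, hp.dvd_mul] at hpq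
      rcases hpq with (h | h) | h
      · left; rw [k.a2]; exact Dvd.dvd.mul_left (by exact_mod_cast h) _
      · right; rw [k.c2]; refine Dvd.dvd.mul_left ?_ _
        exact_mod_cast dvd_mul_of_dvd_left (dvd_mul_of_dvd_left h _) _
      · right; rw [k.c2]; refine Dvd.dvd.mul_left ?_ _
        exact_mod_cast dvd_mul_of_dvd_right (hp.dvd_of_dvd_pow h) _
    have key : ∀ y : ℤ, IsCoprime y (x.1 2) → IsCoprime y (x.2.2 2) → ¬ (p : ℤ) ∣ y := by
      intro y h1 h2 h
      rcases hcase with h3 | h3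
      · exact isUnit_natCast_prime_false hp (h1.isUnit_of_dvd' h h3)
      · exact isUnit_natCast_prime_false hp (h2.isUnit_of_dvd' h h3)
    exact ⟨⟨key _ (P.aa 0 2 (by decide)) (P.ac 0 2 (by decide)),
      key _ (P.aa 1 2 (by decide)) (P.ac 1 2 (by decide))⟩,
      key _ (P.ac 2 0 (by decide)).symm (P.cc 0 2 (by decide)),
      key _ (P.ac 2 1 (by decide)).symm (P.cc 1 2 (by decide))⟩
  have hcop : ∀ y : ℤ, (∀ p : ℕ, p.Prime → p ∣ q → ¬ (p : ℤ) ∣ y) → IsCoprime (q : ℤ) y := by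
    intro y h
    rw [Int.isCoprime_iff_gcd_eq_one, Int.gcd, Int.natAbs_natCast]
    refine Nat.coprime_of_dvd fun p hp h1 h2 => h p hp h1 ?_
    exact Int.natCast_dvd.mpr h2
  have hsdvd : ∀ (p : ℕ) (s : ℤ) (n : ℕ), s ^ 2 = 1 → (p : ℤ) ∣ s * n → p ∣ n := by
    intro p s n hs h
    have := Int.natAbs_dvd_natAbs.mpr h
    rwa [Int.natAbs_natCast, natAbs_eq_of_sq_eq_one hs] at this
  have hβc : ∀ p : ℕ, p.Prime → p ∣ β₀ → p ∣ β₁ → False := fun p hp h h' =>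
    hp.one_lt.ne' (Nat.dvd_one.mp (hβ ▸ Nat.dvd_gcd h h'))
  have hcu₀ : IsCoprime (q : ℤ) u₀ := by
    refine hcop _ fun p hp hpq h => ?_
    have hp' := Nat.prime_iff_prime_int.mp hp
    obtain ⟨⟨h1, h2⟩, h3, h4⟩ := hpr x₀ hx₀ p hp hpq
    rw [k₀.a0] at h1
    rw [k₀.a1] at h2
    have hd := (Int.natCast_dvd_natCast.mpr hpq).trans (hdvd x₀ hx₀)
    have h5 : (p : ℤ) ∣ u₁ * x₀.2.2 1 ^ 2 := (dvd_add_right (Dvd.dvd.mul_right h _)).mp hd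
    have h6 : p ∣ β₀ := hsdvd p s₀ β₀ hs₀ ((hp'.dvd_mul.mp h).resolve_left h1)
    have h7 : (p : ℤ) ∣ u₁ := (hp'.dvd_mul.mp h5).resolve_right fun h => h4 (hp'.dvd_of_dvd_pow h)
    exact hβc p hp h6 (hsdvd p s₁ β₁ hs₁ ((hp'.dvd_mul.mp h7).resolve_left h2))
  have hcu₁ : IsCoprime (q : ℤ) u₁ := by
    refine hcop _ fun p hp hpq h => ?_
    have hp' := Nat.prime_iff_prime_int.mp hp
    obtain ⟨⟨h1, h2⟩, h3, h4⟩ := hpr x₀ hx₀ p hp hpq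
    rw [k₀.a0] at h1
    rw [k₀.a1] at h2
    have hd := (Int.natCast_dvd_natCast.mpr hpq).trans (hdvd x₀ hx₀)
    have h5 : (p : ℤ) ∣ u₀ * x₀.2.2 0 ^ 2 := (dvd_add_left (Dvd.dvd.mul_right h _)).mp hd
    have h6 : p ∣ β₁ := hsdvd p s₁ β₁ hs₁ ((hp'.dvd_mul.mp h).resolve_left h2)
    have h7 : (p : ℤ) ∣ u₀ := (hp'.dvd_mul.mp h5).resolve_right fun h => h3 (hp'.dvd_of_dvd_pow h)
    exact hβc p hp (hsdvd p s₀ β₀ hs₀ ((hp'.dvd_mul.mp h7).resolve_left h1)) h6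
  have hinj : Set.InjOn (fun x : Triple => (x.2.2 0, x.2.2 1)) T := by
    intro x hx y hy hxy
    obtain ⟨-, -, k⟩ := hT x hx
    obtain ⟨-, -, l⟩ := hT y hy
    simp only [Prod.mk.injEq] at hxy
    have h1 := heqn x hx
    rw [hxy.1, hxy.2, heqn y hy] at h1
    have hqz : (q : ℤ) ≠ 0 := by exact_mod_cast hqpos.ne'
    have hs₂' : s₂ ≠ 0 := by rintro rfl; norm_num at hs₂
    have h2 : x.2.1 2 = y.2.1 2 := by
      have := mul_right_cancel₀ hqz (neg_injective h1)
      exact (mul_left_cancel₀ hs₂' this).symm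
    refine Prod.ext ?_ (Prod.ext ?_ ?_)
    · funext i
      fin_cases i
      · exact k.a0.trans l.a0.symm
      · exact k.a1.trans l.a1.symm
      · exact k.a2.trans l.a2.symm
    · funext i
      fin_cases i
      · exact k.b0.trans l.b0.symm
      · exact k.b1.trans l.b1.symm
      · exact h2
    · funext i
      fin_cases i
      · exact hxy.1
      · exact hxy.2
      · exact k.c2.trans l.c2.symm
  have hB2 : (0 : ℝ) < B 2 := by exact_mod_cast hB 2
  have hval : ∀ x ∈ T, |((u₀ * x.2.2 0 ^ 2 + u₁ * x.2.2 1 ^ 2 : ℤ) : ℝ)| ≤ 2 * B 2 * q := by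
    intro x hx
    have h1 : (u₀ * x.2.2 0 ^ 2 + u₁ * x.2.2 1 ^ 2).natAbs ≤ 2 * B 2 * q := by
      rw [heqn x hx, Int.natAbs_neg, mul_assoc, Int.natAbs_mul, Int.natAbs_mul, Int.natAbs_natCast]
      have h2 : s₂.natAbs = 1 := by simpa using natAbs_eq_of_sq_eq_one hs₂ 1
      rw [h2, one_mul]
      exact Nat.mul_le_mul_right _ ((hT x hx).2.1.b_lt 2).le
    rw [← Int.cast_abs, Int.abs_eq_natAbs]
    exact_mod_cast h1
  have hmain := card_fiber_le hqpos (hC 0) (hC 1) hcu₀ hcu₁ hune (M := 2 * B 2) (by positivity)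
    (T.image fun x : Triple => (x.2.2 0, x.2.2 1))
    (forall_mem_image.mpr fun x hx => (hT x hx).1.cc 0 1 (by decide))
    (forall_mem_image.mpr fun x hx => ⟨(hT x hx).2.1.c_le 0, (hT x hx).2.1.c_lt 0⟩)
    (forall_mem_image.mpr fun x hx => ⟨(hT x hx).2.1.c_le 1, (hT x hx).2.1.c_lt 1⟩)
    (forall_mem_image.mpr fun x hx => hcop _ fun p hp hpq => (hpr x hx p hp hpq).2.2)
    (forall_mem_image.mpr fun x hx => hdvd x hx)
    (forall_mem_image.mpr fun x hx => hval x hx)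
  rw [card_image_of_injOn hinj] at hmain
  have hsb : (sqrtBound q : ℝ) ≤ 4 * (#t.divisors * (rootWeight D α * rootWeight D γ)) := by
    refine sqrtBound_le_mul_rootWeight hα.ne' ht.ne' hγ.ne' fun p hp _ hpq => ?_
    have hDu : D = -(u₀ * u₁) := by rw [hD, hu₀, hu₁]; push_cast; ring
    have hpq' := Int.natCast_dvd_natCast.mpr hpq
    have hpc := hpr x₀ hx₀ p hp hpq
    have hp' := Nat.prime_iff_prime_int.mp hp
    rw [hDu]
    exact jacobiSym_neg_mul_eq_one (hcu₀.of_isCoprime_of_dvd_left hpq')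
      ((hp'.coprime_iff_not_dvd).mpr hpc.2.1) ((hp'.coprime_iff_not_dvd).mpr hpc.2.2)
      (hpq'.trans (hdvd x₀ hx₀))
  set g := t * e ^ 2 with hg
  have hgpos : (0 : ℝ) < (g : ℕ) := by rw [hg]; positivity
  have hAr : ∀ i, (0 : ℝ) < A i := fun i => by exact_mod_cast hA i
  have hBr : ∀ i, (0 : ℝ) < B i := fun i => by exact_mod_cast hB i
  have hCr : ∀ i, (0 : ℝ) < C i := fun i => by exact_mod_cast hC i
  have hqr : (0 : ℝ) < q := by exact_mod_cast hqpos
  have hqlow : (A 2 * C 2 ^ 2 : ℝ) ≤ g * q := by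
    have h1 := I₀.a_le 2
    have h2 := I₀.c_le 2
    rw [k₀.a2, natAbs_eq_of_sq_eq_one hs₂] at h1
    rw [k₀.c2, natAbs_eq_of_sq_eq_one hs₃] at h2
    have : A 2 * C 2 ^ 2 ≤ g * q := by
      calc A 2 * C 2 ^ 2 ≤ α * (t * e * γ) ^ 2 := by gcongr
        _ = _ := by rw [hg, hq]; ring
    exact_mod_cast this
  have hulow : (A 0 * A 1 * (B 0 * B 1) : ℝ) ≤ g ^ 2 * |((u₀ * u₁ : ℤ) : ℝ)| := by
    have h1 := I₀.a_le 0
    have h2 := I₀.a_le 1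
    have h3 := I₀.b_le 0
    have h4 := I₀.b_le 1
    rw [k₀.a0] at h1
    rw [k₀.a1] at h2
    rw [k₀.b0, ← Nat.cast_mul, natAbs_eq_of_sq_eq_one hs₀] at h3
    rw [k₀.b1, ← Nat.cast_mul, natAbs_eq_of_sq_eq_one hs₁] at h4
    have : A 0 * A 1 * (B 0 * B 1) ≤ g ^ 2 * (u₀ * u₁).natAbs := by
      calc A 0 * A 1 * (B 0 * B 1) ≤ a₀.natAbs * a₁.natAbs * (g * β₀ * (g * β₁)) := by gcongr
        _ = _ := by
          rw [hu₀, hu₁, Int.natAbs_mul, Int.natAbs_mul a₀, Int.natAbs_mul a₁,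
            natAbs_eq_of_sq_eq_one hs₀, natAbs_eq_of_sq_eq_one hs₁]
          ring
    rw [← Int.cast_abs, Int.abs_eq_natAbs]
    exact_mod_cast this
  have hwidth : min ((C 0 * C 1 : ℝ) / q) (2 * B 2 / Real.sqrt |((u₀ * u₁ : ℤ) : ℝ)|) ≤
      g * classWidth A B C := by
    have hu0 : 0 < |((u₀ * u₁ : ℤ) : ℝ)| := abs_pos.mpr (by exact_mod_cast hune)
    have h2 := hAr 2
    have h3 := hCr 2
    have h4 := hAr 0
    have h5 := hAr 1
    have h6 := hBr 0
    have h7 := hBr 1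
    rw [classWidth, mul_min_of_nonneg _ _ hgpos.le]
    refine min_le_min ?_ ?_
    · rw [← mul_div_assoc, div_le_div_iff₀ hqr (by positivity)]
      calc (C 0 * C 1 : ℝ) * (A 2 * C 2 ^ 2) ≤ (C 0 * C 1 : ℝ) * (g * q) := by gcongr
        _ = _ := by ring
    · have h1 : Real.sqrt (A 0 * A 1 * (B 0 * B 1)) ≤ g * Real.sqrt |((u₀ * u₁ : ℤ) : ℝ)| := by
        rw [Real.sqrt_le_left (by positivity), mul_pow, Real.sq_sqrt hu0.le]
        exact hulow
      rw [← mul_div_assoc, div_le_div_iff₀ (Real.sqrt_pos.mpr hu0)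
        (Real.sqrt_pos.mpr (by positivity))]
      calc 2 * (B 2 : ℝ) * Real.sqrt (A 0 * A 1 * (B 0 * B 1))
          ≤ 2 * (B 2 : ℝ) * (g * Real.sqrt |((u₀ * u₁ : ℤ) : ℝ)|) := by gcongr
        _ = _ := by ring
  calc (#T : ℝ) ≤ _ := hmain
    _ ≤ 2 * (4 * (#t.divisors * (rootWeight D α * rootWeight D γ))) *
        (12 + 32 * (g * classWidth A B C)) := by gcongr
    _ = _ := by ring

theorem exists_sign_mul {n : ℤ} : ∃ s ∈ ({1, -1} : Finset ℤ), n = s * n.natAbs := by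
  rcases Int.natAbs_eq n with h | h
  · exact ⟨1, by simp, by rw [one_mul]; exact h⟩
  · exact ⟨-1, by simp, by rw [neg_one_mul]; exact h⟩

theorem IsPt.gcd_dvd {x : Triple} (P : IsPt x) :
    Nat.gcd (x.2.1 0).natAbs (x.2.1 1).natAbs ∣ (x.2.2 2).natAbs ^ 2 := by
  set g := Nat.gcd (x.2.1 0).natAbs (x.2.1 1).natAbs with hg
  have h0 : (g : ℤ) ∣ x.2.1 0 := Int.natCast_dvd.mpr (Nat.gcd_dvd_left _ _)
  have h1 : (g : ℤ) ∣ x.2.1 1 := Int.natCast_dvd.mpr (Nat.gcd_dvd_right _ _)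
  have hco : ∀ y : ℤ, (∀ d : ℤ, d ∣ x.2.1 0 → d ∣ x.2.1 1 → d ∣ y → IsUnit d) →
      IsCoprime (g : ℤ) y := by
    intro y h
    rw [Int.isCoprime_iff_gcd_eq_one, Int.gcd, Int.natAbs_natCast]
    refine Nat.coprime_of_dvd fun p hp hpg hpy => ?_
    have hpg' : (p : ℤ) ∣ g := Int.natCast_dvd_natCast.mpr hpg
    exact isUnit_natCast_prime_false hp
      (h p (hpg'.trans h0) (hpg'.trans h1) (Int.natCast_dvd.mpr hpy))
  have ha : IsCoprime (g : ℤ) (x.1 2) := hco _ fun d h h' h2 =>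
    P.abb 2 0 1 (by decide) (by decide) (by decide) d h2 h h'
  have hb : IsCoprime (g : ℤ) (x.2.1 2) := hco _ fun d h h' h2 => P.bbb d fun i => by
    fin_cases i
    · exact h
    · exact h'
    · exact h2
  have hd : (g : ℤ) ∣ x.1 2 * x.2.1 2 * x.2.2 2 ^ 2 := by
    have h := P.eqn
    rw [Fin.sum_univ_three] at h
    rw [eq_neg_of_add_eq_zero_right h]
    refine (dvd_add ?_ ?_).neg_right
    · exact (h0.mul_left _).mul_right _
    · exact (h1.mul_left _).mul_right _
  have h3 := (ha.mul_right hb).dvd_of_dvd_mul_left hd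
  have := Int.natCast_dvd.mp h3
  rwa [Int.natAbs_pow] at this

theorem exists_factor_of_dvd_sq {g c : ℕ} (hg : 0 < g) (h : g ∣ c ^ 2) :
    ∃ t e γ : ℕ, g = t * e ^ 2 ∧ c = t * e * γ := by
  obtain ⟨e, γ, hco, he, hγ⟩ := Nat.exists_coprime g c
  set d := Nat.gcd g c with hd
  have hd0 : 0 < d := Nat.gcd_pos_of_pos_left _ hg
  have h1 : e ∣ d := by
    have h2 : d * e ∣ d * (d * γ ^ 2) := by
      have : d * (d * γ ^ 2) = c ^ 2 := by rw [hγ]; ring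
      rw [this, mul_comm d e, ← he]; exact h
    exact (hco.pow_right 2).dvd_of_dvd_mul_right (Nat.dvd_of_mul_dvd_mul_left hd0 h2)
  obtain ⟨t, ht⟩ := h1
  exact ⟨t, e, γ, by rw [he, ht]; ring, by rw [hγ, ht]; ring⟩

theorem IsPt.exists_hasKey {x : Triple} (P : IsPt x) :
    ∃ s₀ ∈ ({1, -1} : Finset ℤ), ∃ s₁ ∈ ({1, -1} : Finset ℤ), ∃ s₂ ∈ ({1, -1} : Finset ℤ),
    ∃ s₃ ∈ ({1, -1} : Finset ℤ), ∃ e t β₀ β₁ α γ : ℕ, Nat.Coprime β₀ β₁ ∧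
      HasKey (x.1 0) (x.1 1) s₀ s₁ s₂ s₃ e t β₀ β₁ α γ x := by
  obtain ⟨s₀, hs₀, h₀⟩ := exists_sign_mul (n := x.2.1 0)
  obtain ⟨s₁, hs₁, h₁⟩ := exists_sign_mul (n := x.2.1 1)
  obtain ⟨s₂, hs₂, h₂⟩ := exists_sign_mul (n := x.1 2)
  obtain ⟨s₃, hs₃, h₃⟩ := exists_sign_mul (n := x.2.2 2)
  have hg : 0 < Nat.gcd (x.2.1 0).natAbs (x.2.1 1).natAbs :=
    Nat.gcd_pos_of_pos_left _ (Int.natAbs_pos.mpr (P.b_ne 0))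
  obtain ⟨t, e, γ, hgt, hc⟩ := exists_factor_of_dvd_sq hg P.gcd_dvd
  obtain ⟨β₀, β₁, hco, hβ₀, hβ₁⟩ := Nat.exists_coprime (x.2.1 0).natAbs (x.2.1 1).natAbs
  refine ⟨s₀, hs₀, s₁, hs₁, s₂, hs₂, s₃, hs₃, e, t, β₀, β₁, _, γ, hco, rfl, rfl, h₂, ?_, ?_, ?_⟩
  · rw [h₀]; congr 1
    rw [hβ₀, hgt]; push_cast; ring
  · rw [h₁]; congr 1
    rw [hβ₁, hgt]; push_cast; ring
  · rw [h₃, hc]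

theorem exists_sum_rootWeightSum_mul_le : ∃ K : ℝ, 1 ≤ K ∧ ∀ (k : ℤ) (P₁ P₂ N₁ N₂ : ℕ),
    ∑ b ∈ Icc 1 P₁ ×ˢ Icc 1 P₂, rootWeightSum (k * (b.1 * b.2 : ℕ)) N₁ *
      rootWeightSum (k * (b.1 * b.2 : ℕ)) N₂ ≤
    K * (N₁ * N₂ * ((P₁ * P₂ : ℕ) *
      ((1 + Real.log (2 * N₁) * ((P₁ * P₂ : ℕ) : ℝ) ^ (-(1 / 16) : ℝ)) *
      (1 + Real.log (2 * N₂) * ((P₁ * P₂ : ℕ) : ℝ) ^ (-(1 / 16) : ℝ))))) := by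
  obtain ⟨K, hK1, hK⟩ := exists_sum_sq_rootWeightSum_le
  refine ⟨K, hK1, fun k P₁ P₂ N₁ N₂ => ?_⟩
  have hlog : ∀ N : ℕ, 0 ≤ Real.log (2 * N) := fun N => by
    exact_mod_cast Real.log_natCast_nonneg (2 * N)
  have hl₁ := hlog N₁
  have hl₂ := hlog N₂
  have hR : 0 ≤ K * (N₁ * N₂ * ((P₁ * P₂ : ℕ) *
      ((1 + Real.log (2 * N₁) * ((P₁ * P₂ : ℕ) : ℝ) ^ (-(1 / 16) : ℝ)) *
      (1 + Real.log (2 * N₂) * ((P₁ * P₂ : ℕ) : ℝ) ^ (-(1 / 16) : ℝ))))) := by positivity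
  rcases Nat.eq_zero_or_pos P₁ with rfl | hP₁
  · simp
  rcases Nat.eq_zero_or_pos P₂ with rfl | hP₂
  · simp
  rcases Nat.eq_zero_or_pos N₁ with rfl | hN₁
  · simp [rootWeightSum]
  rcases Nat.eq_zero_or_pos N₂ with rfl | hN₂
  · simp [rootWeightSum]
  refine abs_le_of_sq_le_sq' ?_ hR |>.2
  refine (sum_mul_sq_le_sq_mul_sq _ _ _).trans ?_
  refine (mul_le_mul (hK k P₁ P₂ N₁ hP₁ hP₂ hN₁) (hK k P₁ P₂ N₂ hP₁ hP₂ hN₂)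
    (sum_nonneg fun _ _ => sq_nonneg _) (by positivity)).trans (le_of_eq (by ring))

theorem mul_one_add_mul_rpow_le {Q P g L₁ L₂ : ℝ} (hQ : 0 ≤ Q) (hP : 0 < P) (hg : 1 ≤ g)
    (hL₁ : 0 ≤ L₁) (hL₂ : 0 ≤ L₂) (h : Q ≤ 4 * (P / g ^ 2)) :
    Q * ((1 + L₁ * Q ^ (-(1 / 16) : ℝ)) * (1 + L₂ * Q ^ (-(1 / 16) : ℝ))) ≤
      4 * (P * g ^ (-(7 / 4) : ℝ)) *
        ((1 + L₁ * P ^ (-(1 / 16) : ℝ)) * (1 + L₂ * P ^ (-(1 / 16) : ℝ))) := by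
  have hg0 : 0 < g := by linarith
  rcases hQ.eq_or_lt with rfl | hQ0
  · rw [zero_mul]; positivity
  set X := P / g ^ 2 with hX
  have hX0 : 0 < X := by positivity
  set s := X ^ (-(1 / 16) : ℝ) with hs
  set r := Q ^ (-(1 / 16) : ℝ) with hr
  set p := P ^ (-(1 / 16) : ℝ) with hp
  have hs0 : 0 < s := by positivity
  have h4 : ∀ θ : ℝ, 0 ≤ θ → θ ≤ 1 → Q ^ θ ≤ 4 * X ^ θ := fun θ h0 h1 => by
    calc Q ^ θ ≤ (4 * X) ^ θ := by gcongr
      _ = 4 ^ θ * X ^ θ := Real.mul_rpow (by norm_num) hX0.le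
      _ ≤ 4 * X ^ θ := by
        gcongr
        calc (4 : ℝ) ^ θ ≤ 4 ^ (1 : ℝ) := by gcongr; norm_num
          _ = 4 := Real.rpow_one _
  have e1 : ∀ Y : ℝ, 0 < Y → Y * Y ^ (-(1 / 16) : ℝ) = Y ^ (15 / 16 : ℝ) := fun Y hY => by
    nth_rewrite 1 [← Real.rpow_one Y]
    rw [← Real.rpow_add hY]; norm_num
  have e2 : ∀ Y : ℝ, 0 < Y → Y * (Y ^ (-(1 / 16) : ℝ)) ^ 2 = Y ^ (14 / 16 : ℝ) := fun Y hY => by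
    rw [← Real.rpow_mul_natCast hY.le]
    nth_rewrite 1 [← Real.rpow_one Y]
    rw [← Real.rpow_add hY]; norm_num
  have h15 : Q * r ≤ 4 * (X * s) := by
    rw [hr, hs, e1 Q hQ0, e1 X hX0]; exact h4 _ (by norm_num) (by norm_num)
  have h14 : Q * r ^ 2 ≤ 4 * (X * s ^ 2) := by
    rw [hr, hs, e2 Q hQ0, e2 X hX0]; exact h4 _ (by norm_num) (by norm_num)
  have hsp : s = p * g ^ (1 / 8 : ℝ) := by
    rw [hs, hX, Real.div_rpow hP.le (by positivity), ← hp, div_eq_mul_inv,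
      ← Real.rpow_neg (by positivity), ← Real.rpow_natCast, ← Real.rpow_mul hg0.le]
    norm_num
  have hg8 : 1 ≤ g ^ (1 / 8 : ℝ) := Real.one_le_rpow hg (by norm_num)
  have hp0 : 0 < p := by positivity
  have hL : ∀ L : ℝ, 0 ≤ L → 1 + L * s ≤ g ^ (1 / 8 : ℝ) * (1 + L * p) := fun L hL => by
    rw [hsp]; nlinarith
  calc Q * ((1 + L₁ * r) * (1 + L₂ * r))
      = Q + (L₁ + L₂) * (Q * r) + L₁ * L₂ * (Q * r ^ 2) := by ring
    _ ≤ 4 * X + (L₁ + L₂) * (4 * (X * s)) + L₁ * L₂ * (4 * (X * s ^ 2)) := by gcongr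
    _ = 4 * X * ((1 + L₁ * s) * (1 + L₂ * s)) := by ring
    _ ≤ 4 * X * ((g ^ (1 / 8 : ℝ) * (1 + L₁ * p)) * (g ^ (1 / 8 : ℝ) * (1 + L₂ * p))) := by
      gcongr
      · exact hL _ hL₁
      · exact hL _ hL₂
    _ = 4 * (P * ((g ^ 2)⁻¹ * (g ^ (1 / 8 : ℝ)) ^ 2)) * ((1 + L₁ * p) * (1 + L₂ * p)) := by
      rw [hX]; ring
    _ = _ := by
      congr 3
      rw [← Real.rpow_mul_natCast hg0.le, ← Real.rpow_natCast, ← Real.rpow_neg hg0.le,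
        ← Real.rpow_add hg0]
      norm_num

theorem exists_sum_Icc_rpow_le : ∃ Z : ℝ, 1 ≤ Z ∧ ∀ N : ℕ,
    ∑ n ∈ Icc 1 N, (n : ℝ) ^ (-(5 / 4) : ℝ) ≤ Z := by
  have hs : Summable fun n : ℕ => (n : ℝ) ^ (-(5 / 4) : ℝ) :=
    Real.summable_nat_rpow.mpr (by norm_num)
  refine ⟨max 1 (∑' n : ℕ, (n : ℝ) ^ (-(5 / 4) : ℝ)), le_max_left _ _, fun N => ?_⟩
  exact (hs.sum_le_tsum _ fun n _ => by positivity).trans (le_max_right _ _)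

open Classical in
/-- The points of `S` with given key. -/
noncomputable def keyFiber (S : Finset Triple) (o : ℤ × ℤ × ℤ × ℤ × ℤ × ℤ) (e t : ℕ) (β : ℕ × ℕ)
    (α γ : ℕ) : Finset Triple :=
  {x ∈ S | Nat.Coprime β.1 β.2 ∧
    HasKey o.1 o.2.1 o.2.2.1 o.2.2.2.1 o.2.2.2.2.1 o.2.2.2.2.2 e t β.1 β.2 α γ x}

/-- The range of the leading coefficients and the signs. -/
noncomputable def outerRange (A : Fin 3 → ℕ) : Finset (ℤ × ℤ × ℤ × ℤ × ℤ × ℤ) :=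
  Icc (-(2 * A 0 : ℤ)) (2 * A 0) ×ˢ Icc (-(2 * A 1 : ℤ)) (2 * A 1) ×ˢ
    {1, -1} ×ˢ {1, -1} ×ˢ {1, -1} ×ˢ {1, -1}

theorem card_outerRange_le {A : Fin 3 → ℕ} (hA : ∀ i, 0 < A i) :
    #(outerRange A) ≤ 400 * (A 0 * A 1) := by
  have h : ∀ i, #(Icc (-(2 * A i : ℤ)) (2 * A i)) ≤ 5 * A i := fun i => by
    rw [Int.card_Icc]; have := hA i; omega
  have h2 : #({1, -1} : Finset ℤ) = 2 := by decide
  rw [outerRange, card_product, card_product, card_product, card_product, card_product, h2]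
  calc _ ≤ 5 * A 0 * (5 * A 1 * (2 * (2 * (2 * 2)))) := by gcongr <;> exact h _
    _ = _ := by ring

theorem le_div_of_mul_lt {a b c : ℕ} (ha : 0 < a) (h : a * b < c) : b ≤ c / a :=
  (Nat.le_div_iff_mul_le ha).mpr (by rw [mul_comm]; exact h.le)

theorem card_le_sum_keyFiber {A B C : Fin 3 → ℕ} (S : Finset Triple)
    (hS : ∀ x ∈ S, IsPt x ∧ InBox A B C x) :
    #S ≤ ∑ o ∈ outerRange A, ∑ e ∈ Icc 1 (2 * C 2), ∑ t ∈ Icc 1 (2 * C 2),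
      ∑ β ∈ Icc 1 (2 * B 0 / (t * e ^ 2)) ×ˢ Icc 1 (2 * B 1 / (t * e ^ 2)),
        ∑ α ∈ Icc 1 (2 * A 2), ∑ γ ∈ Icc 1 (2 * C 2 / (t * e)), #(keyFiber S o e t β α γ) := by
  classical
  have hsub : S ⊆ (outerRange A).biUnion fun o => (Icc 1 (2 * C 2)).biUnion fun e =>
      (Icc 1 (2 * C 2)).biUnion fun t =>
      (Icc 1 (2 * B 0 / (t * e ^ 2)) ×ˢ Icc 1 (2 * B 1 / (t * e ^ 2))).biUnion fun β =>
      (Icc 1 (2 * A 2)).biUnion fun α => (Icc 1 (2 * C 2 / (t * e))).biUnion fun γ =>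
      keyFiber S o e t β α γ := by
    intro x hx
    obtain ⟨P, I⟩ := hS x hx
    obtain ⟨s₀, hs₀, s₁, hs₁, s₂, hs₂, s₃, hs₃, e, t, β₀, β₁, α, γ, hco, k⟩ := P.exists_hasKey
    have hsq : ∀ s ∈ ({1, -1} : Finset ℤ), s ^ 2 = 1 := by decide
    have hα : 0 < α := Nat.pos_of_ne_zero fun h => P.a_ne 2 (by rw [k.a2, h]; simp)
    have hγ : 0 < γ := Nat.pos_of_ne_zero fun h => P.c_ne 2 (by rw [k.c2, h]; simp)
    have ht : 0 < t := Nat.pos_of_ne_zero fun h => P.c_ne 2 (by rw [k.c2, h]; simp)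
    have he : 0 < e := Nat.pos_of_ne_zero fun h => P.c_ne 2 (by rw [k.c2, h]; simp)
    have hβ₀ : 0 < β₀ := Nat.pos_of_ne_zero fun h => P.b_ne 0 (by rw [k.b0, h]; simp)
    have hβ₁ : 0 < β₁ := Nat.pos_of_ne_zero fun h => P.b_ne 1 (by rw [k.b1, h]; simp)
    have b₀ := I.b_lt 0
    have b₁ := I.b_lt 1
    have a₂ := I.a_lt 2
    have c₂ := I.c_lt 2
    rw [k.b0, ← Nat.cast_mul, natAbs_eq_of_sq_eq_one (hsq _ hs₀)] at b₀
    rw [k.b1, ← Nat.cast_mul, natAbs_eq_of_sq_eq_one (hsq _ hs₁)] at b₁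
    rw [k.a2, natAbs_eq_of_sq_eq_one (hsq _ hs₂)] at a₂
    rw [k.c2, natAbs_eq_of_sq_eq_one (hsq _ hs₃)] at c₂
    have a₀ := I.a_lt 0
    have a₁ := I.a_lt 1
    have hte : t * e ≤ 2 * C 2 := by nlinarith [Nat.mul_pos ht he]
    simp only [mem_biUnion]
    refine ⟨(x.1 0, x.1 1, s₀, s₁, s₂, s₃), ?_, e, mem_Icc.mpr ⟨he, by nlinarith⟩,
      t, mem_Icc.mpr ⟨ht, by nlinarith⟩, (β₀, β₁), ?_, α, mem_Icc.mpr ⟨hα, a₂.le⟩,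
      γ, mem_Icc.mpr ⟨hγ, le_div_of_mul_lt (by positivity) c₂⟩, ?_⟩
    · simp only [outerRange, mem_product, mem_Icc]
      exact ⟨⟨by omega, by omega⟩, ⟨by omega, by omega⟩, hs₀, hs₁, hs₂, hs₃⟩
    · rw [mem_product, mem_Icc, mem_Icc]
      exact ⟨⟨hβ₀, le_div_of_mul_lt (by positivity) b₀⟩, hβ₁, le_div_of_mul_lt (by positivity) b₁⟩
    · exact mem_filter.mpr ⟨hx, hco, k⟩
  refine (card_le_card hsub).trans ?_
  refine card_biUnion_le.trans (sum_le_sum fun o _ => ?_)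
  refine card_biUnion_le.trans (sum_le_sum fun e _ => ?_)
  refine card_biUnion_le.trans (sum_le_sum fun t _ => ?_)
  refine card_biUnion_le.trans (sum_le_sum fun β _ => ?_)
  refine card_biUnion_le.trans (sum_le_sum fun α _ => ?_)
  exact card_biUnion_le

theorem card_keyFiber_le {A B C : Fin 3 → ℕ} (hA : ∀ i, 0 < A i) (hB : ∀ i, 0 < B i)
    (hC : ∀ i, 0 < C i) {S : Finset Triple} (hS : ∀ x ∈ S, IsPt x ∧ InBox A B C x)
    {o : ℤ × ℤ × ℤ × ℤ × ℤ × ℤ} (ho : o ∈ outerRange A) (e t : ℕ) (β : ℕ × ℕ) (α γ : ℕ) :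
    (#(keyFiber S o e t β α γ) : ℝ) ≤
      8 * (#t.divisors * (rootWeight (-(o.1 * o.2.1 * (o.2.2.1 * o.2.2.2.1)) * (β.1 * β.2 : ℕ)) α *
      rootWeight (-(o.1 * o.2.1 * (o.2.2.1 * o.2.2.2.1)) * (β.1 * β.2 : ℕ)) γ)) *
      (12 + 32 * ((t * e ^ 2 : ℕ) * classWidth A B C)) := by
  classical
  have hsq : ∀ s ∈ ({1, -1} : Finset ℤ), s ^ 2 = 1 := by decide
  simp only [outerRange, mem_product] at ho
  obtain ⟨-, -, h₀, h₁, h₂, h₃⟩ := ho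
  by_cases hco : Nat.Coprime β.1 β.2
  · exact card_hasKey_le hA hB hC (hsq _ h₀) (hsq _ h₁) (hsq _ h₂) (hsq _ h₃) hco _
      fun x hx => ⟨(hS x (mem_filter.mp hx).1).1, (hS x (mem_filter.mp hx).1).2,
        (mem_filter.mp hx).2.2⟩
  · have : keyFiber S o e t β α γ = ∅ := filter_eq_empty_iff.mpr fun x _ h => hco h.1
    rw [this, card_empty, Nat.cast_zero]
    have hw := rootWeight_nonneg (-(o.1 * o.2.1 * (o.2.2.1 * o.2.2.2.1)) * (β.1 * β.2 : ℕ)) α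
    have hw' := rootWeight_nonneg (-(o.1 * o.2.1 * (o.2.2.1 * o.2.2.2.1)) * (β.1 * β.2 : ℕ)) γ
    have hW0 : 0 ≤ classWidth A B C := le_min (by positivity) (by positivity)
    positivity

set_option maxHeartbeats 1000000 in
theorem exists_card_hardBox_le : ∃ K : ℝ, 1 ≤ K ∧ ∀ A B C : Fin 3 → ℕ, (∀ i, 0 < A i) →
    (∀ i, 0 < B i) → (∀ i, 0 < C i) → ∀ S : Finset Triple, (∀ x ∈ S, IsPt x ∧ InBox A B C x) →
    (#S : ℝ) ≤ K * ((A 0 * A 1 * A 2) * (B 0 * B 1) * C 2 * (1 + classWidth A B C) *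
      ((1 + Real.log (4 * A 2) * (B 0 * B 1 : ℝ) ^ (-(1 / 16) : ℝ)) *
      (1 + Real.log (4 * C 2) * (B 0 * B 1 : ℝ) ^ (-(1 / 16) : ℝ)))) := by
  obtain ⟨K, hK1, hK⟩ := exists_sum_rootWeightSum_mul_le
  obtain ⟨Z, hZ1, hZ⟩ := exists_sum_Icc_rpow_le
  obtain ⟨d, hd1, hd⟩ := card_divisors_le_rpow (1 / 2) (by norm_num)
  refine ⟨400 * (4096 * d * K) * (Z * Z), ?_, fun A B C hA hB hC S hS => ?_⟩
  · have h1 : 1 ≤ d * K := one_le_mul_of_one_le_of_one_le hd1 hK1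
    have h2 : 1 ≤ Z * Z := one_le_mul_of_one_le_of_one_le hZ1 hZ1
    nlinarith
  have hAr : ∀ i, (1 : ℝ) ≤ A i := fun i => by exact_mod_cast hA i
  have hBr : ∀ i, (1 : ℝ) ≤ B i := fun i => by exact_mod_cast hB i
  have hCr : ∀ i, (1 : ℝ) ≤ C i := fun i => by exact_mod_cast hC i
  have hW0 : 0 ≤ classWidth A B C := le_min (by positivity) (by positivity)
  set W := classWidth A B C with hW
  have hP0 : (0 : ℝ) < B 0 * B 1 := mul_pos (by linarith [hBr 0]) (by linarith [hBr 1])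
  set lA := Real.log (4 * A 2) with hlA
  set lC := Real.log (4 * C 2) with hlC
  have hlA0 : 0 ≤ lA := Real.log_nonneg (by linarith [hAr 2])
  have hlC0 : 0 ≤ lC := Real.log_nonneg (by linarith [hCr 2])
  set E := (1 + lA * (B 0 * B 1 : ℝ) ^ (-(1 / 16) : ℝ)) *
    (1 + lC * (B 0 * B 1 : ℝ) ^ (-(1 / 16) : ℝ)) with hE
  have hE0 : 0 ≤ E := by positivity
  set G := 4096 * d * K * (A 2 * C 2 * (B 0 * B 1 : ℝ) * (1 + W) * E) with hG
  have hinner : ∀ o ∈ outerRange A, ∀ e ∈ Icc 1 (2 * C 2), ∀ t ∈ Icc 1 (2 * C 2),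
      ∑ β ∈ Icc 1 (2 * B 0 / (t * e ^ 2)) ×ˢ Icc 1 (2 * B 1 / (t * e ^ 2)),
        ∑ α ∈ Icc 1 (2 * A 2), ∑ γ ∈ Icc 1 (2 * C 2 / (t * e)), (#(keyFiber S o e t β α γ) : ℝ) ≤
      G * ((e : ℝ) ^ (-(5 / 4) : ℝ) * (t : ℝ) ^ (-(5 / 4) : ℝ)) := by
    intro o ho e he t ht
    rw [mem_Icc] at he ht
    have he0 : (0 : ℝ) < e := by exact_mod_cast he.1
    have ht0 : (0 : ℝ) < t := by exact_mod_cast ht.1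
    have he1 : (1 : ℝ) ≤ e := by exact_mod_cast he.1
    have ht1 : (1 : ℝ) ≤ t := by exact_mod_cast ht.1
    set k := -(o.1 * o.2.1 * (o.2.2.1 * o.2.2.2.1)) with hk
    set g : ℕ := t * e ^ 2 with hg
    have hgr : (g : ℝ) = t * e ^ 2 := by rw [hg]; push_cast; ring
    have hg1 : (1 : ℝ) ≤ g := by rw [hgr]; nlinarith [one_le_pow₀ he1 (n := 2)]
    have hg0 : (0 : ℝ) < g := by linarith
    set N := 2 * C 2 / (t * e) with hN
    have hNle : (N : ℝ) ≤ 2 * C 2 / (t * e) := by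
      rw [hN]; refine Nat.cast_div_le.trans (le_of_eq ?_); push_cast; ring
    have hQle : ((2 * B 0 / g * (2 * B 1 / g) : ℕ) : ℝ) ≤ 4 * (B 0 * B 1 / (g : ℝ) ^ 2) := by
      push_cast
      calc ((2 * B 0 / g : ℕ) : ℝ) * ((2 * B 1 / g : ℕ) : ℝ)
          ≤ ((2 * B 0 : ℕ) / (g : ℝ)) * ((2 * B 1 : ℕ) / (g : ℝ)) := by
            gcongr <;> exact Nat.cast_div_le
        _ = _ := by push_cast; field_simp; ring
    have hlN : Real.log (2 * N) ≤ lC := by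
      rcases Nat.eq_zero_or_pos N with h | h
      · rw [h]; simpa using hlC0
      · refine Real.log_le_log (by positivity) ?_
        have : N ≤ 2 * C 2 := Nat.div_le_self _ _
        have : (N : ℝ) ≤ 2 * C 2 := by exact_mod_cast this
        linarith
    have hlN0 : 0 ≤ Real.log (2 * N) := by exact_mod_cast Real.log_natCast_nonneg (2 * N)
    have hl2A : Real.log (2 * (2 * A 2 : ℕ)) = lA := by rw [hlA]; push_cast; ring_nf
    have hKP := hK k (2 * B 0 / g) (2 * B 1 / g) (2 * A 2) N
    rw [hl2A] at hKP
    calc _ ≤ ∑ β ∈ Icc 1 (2 * B 0 / g) ×ˢ Icc 1 (2 * B 1 / g),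
          ∑ α ∈ Icc 1 (2 * A 2), ∑ γ ∈ Icc 1 N,
          8 * (#t.divisors * (rootWeight (k * (β.1 * β.2 : ℕ)) α *
            rootWeight (k * (β.1 * β.2 : ℕ)) γ)) * (12 + 32 * (g * W)) := by
          refine sum_le_sum fun β _ => sum_le_sum fun α _ => sum_le_sum fun γ _ => ?_
          exact card_keyFiber_le hA hB hC hS ho e t β α γ
      _ = 8 * #t.divisors * (12 + 32 * (g * W)) *
          ∑ β ∈ Icc 1 (2 * B 0 / g) ×ˢ Icc 1 (2 * B 1 / g),
            rootWeightSum (k * (β.1 * β.2 : ℕ)) (2 * A 2) *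
              rootWeightSum (k * (β.1 * β.2 : ℕ)) N := by
          rw [mul_sum]
          refine sum_congr rfl fun β _ => ?_
          rw [rootWeightSum, rootWeightSum, sum_mul_sum, mul_sum]
          refine sum_congr rfl fun α _ => ?_
          rw [mul_sum]
          exact sum_congr rfl fun γ _ => by ring
      _ ≤ 8 * (d * (t : ℝ) ^ (1 / 2 : ℝ)) * (32 * (g * (1 + W))) *
          (K * ((2 * A 2 : ℕ) * (2 * C 2 / (t * e)) *
            (4 * (B 0 * B 1 * (g : ℝ) ^ (-(7 / 4) : ℝ)) * E))) := by
          have h1 : (12 : ℝ) + 32 * (g * W) ≤ 32 * (g * (1 + W)) := by nlinarith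
          have h2 := hd t (by omega)
          have h3 : (0 : ℝ) ≤ 12 + 32 * (g * W) := by positivity
          have h4 : ((2 * B 0 / g * (2 * B 1 / g) : ℕ) : ℝ) *
              ((1 + lA * ((2 * B 0 / g * (2 * B 1 / g) : ℕ) : ℝ) ^ (-(1 / 16) : ℝ)) *
              (1 + Real.log (2 * N) * ((2 * B 0 / g * (2 * B 1 / g) : ℕ) : ℝ) ^ (-(1 / 16) : ℝ))) ≤
              4 * (B 0 * B 1 * (g : ℝ) ^ (-(7 / 4) : ℝ)) * E := by
            refine le_trans ?_ (mul_one_add_mul_rpow_le (Nat.cast_nonneg _) hP0 hg1 hlA0 hlC0 hQle)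
            gcongr
          gcongr
          · exact sum_nonneg fun β _ =>
              mul_nonneg (rootWeightSum_nonneg _ _) (rootWeightSum_nonneg _ _)
          · refine hKP.trans ?_
            gcongr
      _ = G * ((t : ℝ) ^ (1 / 2 : ℝ) * (g * (g : ℝ) ^ (-(7 / 4) : ℝ)) / (t * e)) := by
          rw [hG]; push_cast
          generalize (g : ℝ) ^ (-(7 / 4) : ℝ) = y
          generalize (t : ℝ) ^ (1 / 2 : ℝ) = z
          clear_value E W
          ring
      _ ≤ G * ((e : ℝ) ^ (-(5 / 4) : ℝ) * (t : ℝ) ^ (-(5 / 4) : ℝ)) := by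
          have hG0 : 0 ≤ G := by positivity
          gcongr
          have h5 : (g : ℝ) * (g : ℝ) ^ (-(7 / 4) : ℝ) =
              (t : ℝ) ^ (-(3 / 4) : ℝ) * (e : ℝ) ^ (-(3 / 2) : ℝ) := by
            nth_rewrite 1 [← Real.rpow_one (g : ℝ)]
            rw [← Real.rpow_add hg0, hgr, Real.mul_rpow ht0.le (by positivity),
              ← Real.rpow_natCast, ← Real.rpow_mul he0.le]
            norm_num
          have h6 : (t : ℝ) ^ (1 / 2 : ℝ) * ((t : ℝ) ^ (-(3 / 4) : ℝ) * (e : ℝ) ^ (-(3 / 2) : ℝ)) /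
              (t * e) = (e : ℝ) ^ (-(5 / 2) : ℝ) * (t : ℝ) ^ (-(5 / 4) : ℝ) := by
            rw [div_eq_mul_inv, mul_inv, ← Real.rpow_neg_one (t : ℝ), ← Real.rpow_neg_one (e : ℝ)]
            have ht' : (t : ℝ) ^ (-(5 / 4) : ℝ) = (t : ℝ) ^ (1 / 2 : ℝ) * (t : ℝ) ^ (-(3 / 4) : ℝ) *
                (t : ℝ) ^ (-1 : ℝ) := by
              rw [← Real.rpow_add ht0, ← Real.rpow_add ht0]; norm_num
            have he' : (e : ℝ) ^ (-(5 / 2) : ℝ) =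
                (e : ℝ) ^ (-(3 / 2) : ℝ) * (e : ℝ) ^ (-1 : ℝ) := by
              rw [← Real.rpow_add he0]; norm_num
            rw [ht', he']; ring
          rw [h5, h6]
          gcongr
          norm_num
  calc (#S : ℝ) ≤ _ := Nat.cast_le.mpr (card_le_sum_keyFiber S hS)
    _ ≤ ∑ o ∈ outerRange A, ∑ e ∈ Icc 1 (2 * C 2), ∑ t ∈ Icc 1 (2 * C 2),
        G * ((e : ℝ) ^ (-(5 / 4) : ℝ) * (t : ℝ) ^ (-(5 / 4) : ℝ)) := by
      push_cast
      exact sum_le_sum fun o ho => sum_le_sum fun e he => sum_le_sum fun t ht =>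
        hinner o ho e he t ht
    _ = #(outerRange A) * (G * ((∑ e ∈ Icc 1 (2 * C 2), (e : ℝ) ^ (-(5 / 4) : ℝ)) *
        ∑ t ∈ Icc 1 (2 * C 2), (t : ℝ) ^ (-(5 / 4) : ℝ))) := by
      rw [sum_const, nsmul_eq_mul, sum_mul_sum]
      simp only [mul_sum]
    _ ≤ (400 * (A 0 * A 1)) * (G * (Z * Z)) := by
      have hG0 : 0 ≤ G := by positivity
      gcongr
      · exact_mod_cast card_outerRange_le hA
      · exact hZ _
      · exact hZ _
    _ = _ := by rw [hG]; ring

theorem IsPt.comp_perm {x : Triple} (h : IsPt x) (σ : Equiv.Perm (Fin 3)) :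
    IsPt (x.1 ∘ σ, x.2.1 ∘ σ, x.2.2 ∘ σ) where
  a_ne i := h.a_ne (σ i)
  b_ne i := h.b_ne (σ i)
  c_ne i := h.c_ne (σ i)
  eqn := (Equiv.sum_comp σ fun i => x.1 i * x.2.1 i * x.2.2 i ^ 2).trans h.eqn
  aa i j hij := h.aa _ _ (σ.injective.ne hij)
  ac i j hij := h.ac _ _ (σ.injective.ne hij)
  cc i j hij := h.cc _ _ (σ.injective.ne hij)
  bbb d hd := h.bbb d fun i => by simpa using hd (σ.symm i)
  abb i j k hij hjk hik := h.abb _ _ _ (σ.injective.ne hij) (σ.injective.ne hjk)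
    (σ.injective.ne hik)

theorem InBox.comp_perm {A B C : Fin 3 → ℕ} {x : Triple} (h : InBox A B C x)
    (σ : Equiv.Perm (Fin 3)) :
    InBox (A ∘ σ) (B ∘ σ) (C ∘ σ) (x.1 ∘ σ, x.2.1 ∘ σ, x.2.2 ∘ σ) where
  a_le i := h.a_le (σ i)
  a_lt i := h.a_lt (σ i)
  b_le i := h.b_le (σ i)
  b_lt i := h.b_lt (σ i)
  c_le i := h.c_le (σ i)
  c_lt i := h.c_lt (σ i)

theorem exists_card_eq_comp_perm {A B C : Fin 3 → ℕ} {S : Finset Triple}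
    (hS : ∀ x ∈ S, IsPt x ∧ InBox A B C x) (σ : Equiv.Perm (Fin 3)) :
    ∃ T : Finset Triple, #T = #S ∧
      ∀ x ∈ T, IsPt x ∧ InBox (A ∘ σ) (B ∘ σ) (C ∘ σ) x := by
  classical
  refine ⟨S.image fun x => (x.1 ∘ σ, x.2.1 ∘ σ, x.2.2 ∘ σ), card_image_of_injective _ ?_,
    forall_mem_image.mpr fun x hx => ⟨(hS x hx).1.comp_perm σ, (hS x hx).2.comp_perm σ⟩⟩
  intro x y hxy
  simp only [Prod.mk.injEq] at hxy
  have hinj := σ.surjective.injective_comp_right (γ := ℤ)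
  exact Prod.ext (hinj hxy.1) (Prod.ext (hinj hxy.2.1) (hinj hxy.2.2))

/-- Integer vectors whose coordinates are at most twice the given bounds. -/
noncomputable def vecBox (N : Fin 3 → ℕ) : Finset (Fin 3 → ℤ) :=
  Fintype.piFinset fun i => Ioo (-(2 * N i : ℤ)) (2 * N i)

theorem mem_vecBox {N : Fin 3 → ℕ} {v : Fin 3 → ℤ} (h : ∀ i, (v i).natAbs < 2 * N i) :
    v ∈ vecBox N := by
  refine Fintype.mem_piFinset.mpr fun i => ?_
  rw [mem_Ioo]
  have := h i
  omega

theorem card_vecBox_le (N : Fin 3 → ℕ) : #(vecBox N) ≤ 64 * (N 0 * N 1 * N 2) := by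
  rw [vecBox, Fintype.card_piFinset, Fin.prod_univ_three]
  have h : ∀ i, #(Ioo (-(2 * N i : ℤ)) (2 * N i)) ≤ 4 * N i := fun i => by
    rw [Int.card_Ioo]; omega
  calc _ ≤ 4 * N 0 * (4 * N 1) * (4 * N 2) :=
        Nat.mul_le_mul (Nat.mul_le_mul (h 0) (h 1)) (h 2)
    _ = _ := by ring

theorem exists_bezout_of_forall_dvd {v : Fin 3 → ℤ} (h : ∀ d : ℤ, (∀ i, d ∣ v i) → IsUnit d) :
    ∃ r s t : ℤ, r * v 0 + s * v 1 + t * v 2 = 1 := by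
  have h1 : IsCoprime (v 0) (Int.gcd (v 1) (v 2)) := by
    refine isCoprime_of_dvd _ _ (fun h0 => ?_) fun d hd _ h0 h1 => hd (h d fun i => ?_)
    · have := h 0 fun i => ?_
      · exact not_isUnit_zero this
      · have h2 := Int.gcd_eq_zero_iff.mp (Int.natCast_eq_zero.mp h0.2)
        fin_cases i
        · simp [h0.1]
        · simp [h2.1]
        · simp [h2.2]
    · fin_cases i
      · exact h0
      · exact h1.trans (Int.gcd_dvd_left _ _)
      · exact h1.trans (Int.gcd_dvd_right _ _)
  obtain ⟨r, s, hrs⟩ := h1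
  rw [Int.gcd_eq_gcd_ab] at hrs
  exact ⟨r, s * Int.gcdA (v 1) (v 2), s * Int.gcdB (v 1) (v 2), by linear_combination hrs⟩

theorem eq_or_eq_neg_of_parallel_three {v w : Fin 3 → ℤ}
    (hv : ∀ d : ℤ, (∀ i, d ∣ v i) → IsUnit d) (hw : ∀ d : ℤ, (∀ i, d ∣ w i) → IsUnit d)
    (hv0 : v 0 ≠ 0) (h1 : v 0 * w 1 = w 0 * v 1) (h2 : v 0 * w 2 = w 0 * v 2) :
    w = v ∨ w = -v := by
  obtain ⟨r, s, t, hv'⟩ := exists_bezout_of_forall_dvd hv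
  obtain ⟨r', s', t', hw'⟩ := exists_bezout_of_forall_dvd hw
  have d1 : v 0 ∣ w 0 := ⟨r * w 0 + s * w 1 + t * w 2, by
    linear_combination (-w 0) * hv' - s * h1 - t * h2⟩
  have d2 : w 0 ∣ v 0 := ⟨r' * v 0 + s' * v 1 + t' * v 2, by
    linear_combination (-v 0) * hw' + s' * h1 + t' * h2⟩
  rcases Int.natAbs_eq_natAbs_iff.mp (Int.natAbs_eq_of_dvd_dvd d1 d2) with h3 | h3
  · left
    have e1 : w 1 = v 1 := mul_left_cancel₀ hv0 (by rw [h1, h3])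
    have e2 : w 2 = v 2 := mul_left_cancel₀ hv0 (by rw [h2, h3])
    funext i
    fin_cases i
    exacts [h3.symm, e1, e2]
  · right
    have e1 : w 1 = -v 1 := mul_left_cancel₀ hv0 (by rw [h1, h3]; ring)
    have e2 : w 2 = -v 2 := mul_left_cancel₀ hv0 (by rw [h2, h3]; ring)
    funext i
    fin_cases i
    exacts [by simp [h3], e1, e2]

theorem card_le_of_fixed_ac {A B C : Fin 3 → ℕ} (hA : ∀ i, 0 < A i) (hB : ∀ i, 0 < B i)
    (hC : ∀ i, 0 < C i) {a c : Fin 3 → ℤ} (T : Finset Triple)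
    (hT : ∀ x ∈ T, (IsPt x ∧ InBox A B C x) ∧ x.1 = a ∧ x.2.2 = c) :
    (#T : ℝ) ≤ 12 + 32 * (B 0 * B 1 / (A 2 * C 2 ^ 2)) := by
  have hA2 : (0 : ℝ) < A 2 := by exact_mod_cast hA 2
  have hC2 : (0 : ℝ) < C 2 := by exact_mod_cast hC 2
  have hB0 : (0 : ℝ) < B 0 := by exact_mod_cast hB 0
  have hB1 : (0 : ℝ) < B 1 := by exact_mod_cast hB 1
  have key : ∀ s ∈ T, ∀ t ∈ T,
      a 0 * c 0 ^ 2 * (s.2.1 0 * t.2.1 1 - t.2.1 0 * s.2.1 1) =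
        a 2 * c 2 ^ 2 * (t.2.1 2 * s.2.1 1 - s.2.1 2 * t.2.1 1) := by
    intro s hs t ht
    obtain ⟨⟨p, -⟩, rfl, rfl⟩ := hT s hs
    obtain ⟨⟨q, -⟩, h1, h2⟩ := hT t ht
    have e1 := p.eqn
    have e2 := q.eqn
    rw [Fin.sum_univ_three] at e1 e2
    rw [h1, h2] at e2
    linear_combination t.2.1 1 * e1 - s.2.1 1 * e2
  have key0 : ∀ s ∈ T, ∀ t ∈ T,
      a 1 * c 1 ^ 2 * (s.2.1 0 * t.2.1 1 - t.2.1 0 * s.2.1 1) =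
        a 2 * c 2 ^ 2 * (t.2.1 0 * s.2.1 2 - s.2.1 0 * t.2.1 2) := by
    intro s hs t ht
    obtain ⟨⟨p, -⟩, rfl, rfl⟩ := hT s hs
    obtain ⟨⟨q, -⟩, h1, h2⟩ := hT t ht
    have e1 := p.eqn
    have e2 := q.eqn
    rw [Fin.sum_univ_three] at e1 e2
    rw [h1, h2] at e2
    linear_combination s.2.1 0 * e2 - t.2.1 0 * e1
  have := card_le_of_det_gap T (fun x => (x.2.1 0 : ℝ)) (fun x => (x.2.1 1 : ℝ)) (2 * B 0)
    (2 * B 1) (A 2 * C 2 ^ 2) (by positivity) (by positivity) (by positivity)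
    (fun x hx => by
      rw [← Int.cast_abs, Int.abs_eq_natAbs]; exact_mod_cast ((hT x hx).1.2.b_lt 0).le)
    (fun x hx => by
      rw [← Int.cast_abs, Int.abs_eq_natAbs]; exact_mod_cast ((hT x hx).1.2.b_lt 1).le)
    (fun x hx => Or.inl (by exact_mod_cast (hT x hx).1.1.b_ne 0))
    (fun s hs t ht h => by
      have h0 : s.2.1 0 * t.2.1 1 - t.2.1 0 * s.2.1 1 ≠ 0 := by exact_mod_cast h
      have hk := key s hs t ht
      obtain ⟨⟨p, q⟩, rfl, rfl⟩ := hT s hs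
      have hco : IsCoprime (s.1 2 * s.2.2 2 ^ 2) (s.1 0 * s.2.2 0 ^ 2) :=
        IsCoprime.mul_left
          ((p.aa 2 0 (by decide)).mul_right (p.ac 2 0 (by decide)).pow_right)
          ((p.ac 0 2 (by decide)).symm.pow_left.mul_right (p.cc 2 0 (by decide)).pow)
      have hd := hco.dvd_of_dvd_mul_left ⟨_, hk⟩
      have h1 := Int.natAbs_le_of_dvd_ne_zero hd h0
      have h2 : A 2 * C 2 ^ 2 ≤ (s.1 2 * s.2.2 2 ^ 2).natAbs := by
        rw [Int.natAbs_mul, Int.natAbs_pow]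
        exact Nat.mul_le_mul (q.a_le 2) (Nat.pow_le_pow_left (q.c_le 2) 2)
      have h3 : ((A 2 * C 2 ^ 2 : ℕ) : ℝ) ≤
          ((s.2.1 0 * t.2.1 1 - t.2.1 0 * s.2.1 1).natAbs : ℕ) := Nat.cast_le.mpr (h2.trans h1)
      rw [Nat.cast_natAbs] at h3
      exact_mod_cast h3)
    (fun s hs U hU hp => by
      have hsub : U ⊆ {s, (s.1, -s.2.1, s.2.2)} := by
        intro t ht
        have htT := hU ht
        have h0 : s.2.1 0 * t.2.1 1 - t.2.1 0 * s.2.1 1 = 0 := by exact_mod_cast hp t ht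
        have hk := key0 s hs t htT
        obtain ⟨⟨p, -⟩, h1, h2⟩ := hT s hs
        obtain ⟨⟨q, -⟩, h3, h4⟩ := hT t htT
        have hw : a 2 * c 2 ^ 2 ≠ 0 := by
          rw [← h1, ← h2]; exact mul_ne_zero (p.a_ne 2) (pow_ne_zero 2 (p.c_ne 2))
        rw [h0, mul_zero] at hk
        have h5 := (mul_eq_zero.mp hk.symm).resolve_left hw
        rw [mem_insert, mem_singleton]
        rcases eq_or_eq_neg_of_parallel_three p.bbb q.bbb (p.b_ne 0) (sub_eq_zero.mp h0)
          (sub_eq_zero.mp h5).symm with h | h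
        · left; exact Prod.ext (h3.trans h1.symm) (Prod.ext h (h4.trans h2.symm))
        · right; exact Prod.ext (h3.trans h1.symm) (Prod.ext h (h4.trans h2.symm))
      exact (card_le_card hsub).trans card_le_two)
  calc _ ≤ _ := this
    _ = _ := by ring

theorem card_le_of_forall_fiber {α β : Type*} [DecidableEq β] {S : Finset α} {f : α → β}
    {t : Finset β} {n : ℝ} (hf : ∀ x ∈ S, f x ∈ t)
    (hn : ∀ b ∈ t, (#{x ∈ S | f x = b} : ℝ) ≤ n) : (#S : ℝ) ≤ #t * n := by
  rw [card_eq_sum_card_fiberwise hf, Nat.cast_sum]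
  simpa using sum_le_card_nsmul t _ n hn

theorem card_box_le_ac {A B C : Fin 3 → ℕ} (hA : ∀ i, 0 < A i) (hB : ∀ i, 0 < B i)
    (hC : ∀ i, 0 < C i) (S : Finset Triple) (hS : ∀ x ∈ S, IsPt x ∧ InBox A B C x) :
    (#S : ℝ) ≤ 4096 * ((A 0 * A 1 * A 2) * (C 0 * C 1 * C 2)) *
      (12 + 32 * (B 0 * B 1 / (A 2 * C 2 ^ 2))) := by
  classical
  refine (card_le_of_forall_fiber (f := fun x : Triple => (x.1, x.2.2)) (t := vecBox A ×ˢ vecBox C)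
    (fun x hx => mem_product.mpr ⟨mem_vecBox (hS x hx).2.a_lt, mem_vecBox (hS x hx).2.c_lt⟩)
    fun b _ => card_le_of_fixed_ac hA hB hC (a := b.1) (c := b.2) _ fun x hx => ?_).trans ?_
  · rw [mem_filter] at hx
    exact ⟨hS x hx.1, (Prod.ext_iff.mp hx.2).1, (Prod.ext_iff.mp hx.2).2⟩
  · refine mul_le_mul_of_nonneg_right ?_ (by positivity)
    rw [card_product]
    have := Nat.mul_le_mul (card_vecBox_le A) (card_vecBox_le C)
    calc ((#(vecBox A) * #(vecBox C) : ℕ) : ℝ)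
        ≤ ((64 * (A 0 * A 1 * A 2) * (64 * (C 0 * C 1 * C 2)) : ℕ) : ℝ) := Nat.cast_le.mpr this
      _ = _ := by push_cast; ring

theorem card_box_le_bc {A B C : Fin 3 → ℕ} (S : Finset Triple)
    (hS : ∀ x ∈ S, IsPt x ∧ InBox A B C x) :
    (#S : ℝ) ≤ 65536 * ((A 0 * A 1) * (B 0 * B 1 * B 2) * (C 0 * C 1 * C 2)) := by
  classical
  set I : ℕ → Finset ℤ := fun N => Ioo (-(2 * N : ℤ)) (2 * N) with hI
  have hIc : ∀ N, #(I N) ≤ 4 * N := fun N => by rw [hI, Int.card_Ioo]; omega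
  have hmem : ∀ (z : ℤ) (N : ℕ), z.natAbs < 2 * N → z ∈ I N := fun z N h => by
    rw [hI, mem_Ioo]; omega
  have h1 : #S ≤ #((I (A 0) ×ˢ I (A 1)) ×ˢ (vecBox B ×ˢ vecBox C)) := by
    refine card_le_card_of_injOn (fun x : Triple => ((x.1 0, x.1 1), x.2)) (fun x hx => ?_) ?_
    · obtain ⟨-, q⟩ := hS x hx
      simp only [coe_product, Set.mem_prod, mem_coe]
      exact ⟨⟨hmem _ _ (q.a_lt 0), hmem _ _ (q.a_lt 1)⟩, mem_vecBox q.b_lt, mem_vecBox q.c_lt⟩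
    · intro x hx y hy hxy
      simp only [Prod.mk.injEq] at hxy
      obtain ⟨⟨h0, h1⟩, h2⟩ := hxy
      refine Prod.ext ?_ h2
      have e1 := (hS x hx).1.eqn
      have e2 := (hS y hy).1.eqn
      rw [Fin.sum_univ_three] at e1 e2
      rw [← h0, ← h1, ← h2] at e2
      have hne : x.2.1 2 * x.2.2 2 ^ 2 ≠ 0 :=
        mul_ne_zero ((hS x hx).1.b_ne 2) (pow_ne_zero 2 ((hS x hx).1.c_ne 2))
      have h3 : x.1 2 = y.1 2 := mul_right_cancel₀ hne (by linear_combination e1 - e2)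
      funext i
      fin_cases i
      exacts [h0, h1, h3]
  rw [card_product, card_product, card_product] at h1
  have h2 := h1.trans (Nat.mul_le_mul (Nat.mul_le_mul (hIc (A 0)) (hIc (A 1)))
    (Nat.mul_le_mul (card_vecBox_le B) (card_vecBox_le C)))
  calc (#S : ℝ) ≤ _ := Nat.cast_le.mpr h2
    _ = _ := by push_cast; ring

theorem rpow_neg_mul_one_add_le {R Q y z : ℝ} (hR : 1 ≤ R) (hQ0 : 0 ≤ Q) (hQ1 : Q ≤ 1)
    (hy : 0 ≤ y) (hz : z ≤ y + 2 * Real.log R) :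
    R ^ (-(1 / 12) : ℝ) * (1 + z * Q) ≤ 25 + y * Q := by
  have hR0 : 0 < R := by linarith
  have hl : 0 ≤ Real.log R := Real.log_nonneg hR
  have h1 : R ^ (-(1 / 12) : ℝ) ≤ 1 := Real.rpow_le_one_of_one_le_of_nonpos hR (by norm_num)
  have h0 : 0 < R ^ (-(1 / 12) : ℝ) := Real.rpow_pos_of_pos hR0 _
  have h2 : R ^ (-(1 / 12) : ℝ) * Real.log R ≤ 12 := by
    have h := Real.log_le_rpow_div hR0.le (ε := 1 / 12) (by norm_num)
    calc _ ≤ R ^ (-(1 / 12) : ℝ) * (R ^ (1 / 12 : ℝ) / (1 / 12)) := by gcongr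
      _ = 12 * (R ^ (-(1 / 12) : ℝ) * R ^ (1 / 12 : ℝ)) := by ring
      _ = 12 := by rw [← Real.rpow_add hR0]; norm_num
  have h3 : z * Q ≤ y * Q + 2 * Real.log R := by
    nlinarith [mul_le_mul_of_nonneg_right hz hQ0, mul_le_mul_of_nonneg_left hQ1 hl]
  calc _ ≤ R ^ (-(1 / 12) : ℝ) * (1 + (y * Q + 2 * Real.log R)) := by gcongr
    _ = R ^ (-(1 / 12) : ℝ) * (1 + y * Q) + 2 * (R ^ (-(1 / 12) : ℝ) * Real.log R) := by ring
    _ ≤ 1 * (1 + y * Q) + 2 * 12 := by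
      have : 0 ≤ y * Q := mul_nonneg hy hQ0
      gcongr
    _ = _ := by ring

theorem mul_log_factors_le {ε : ℝ} (hε : 0 < ε) {a b c Q : ℝ} (ha : 1 ≤ a) (hb : 1 ≤ b)
    (hbc : b ≤ c) (habc : a ^ 2 ≤ (b * c) ^ 3) (hQ0 : 0 ≤ Q) (hQ1 : Q ≤ 1) :
    b ^ (2 / 3 : ℝ) * c ^ (1 / 3 : ℝ) *
      ((1 + Real.log (4 * a) * Q) * (1 + Real.log (4 * c) * Q)) ≤
    (27 + 3 / ε) * 25 * (b ^ (1 / 2 : ℝ) * c ^ (1 / 2 : ℝ) *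
      ((1 + min a b ^ ε * Q) * (1 + Real.log (2 * b) * Q))) := by
  have hb0 : 0 < b := by linarith
  have ha0 : 0 < a := by linarith
  have hc0 : 0 < c := by linarith
  set R := c / b with hRd
  have hR : 1 ≤ R := (one_le_div hb0).mpr hbc
  have hR0 : 0 < R := by linarith
  have hc : c = b * R := by rw [hRd]; field_simp
  have hlR : 0 ≤ Real.log R := Real.log_nonneg hR
  have hlc : Real.log c = Real.log b + Real.log R := by
    rw [hc, Real.log_mul hb0.ne' hR0.ne']
  have hla : 0 ≤ Real.log a := Real.log_nonneg ha
  have hlb : 0 ≤ Real.log b := Real.log_nonneg hb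
  have hl2 : 0 ≤ Real.log 2 := Real.log_nonneg one_le_two
  have hl4 : Real.log 4 = 2 * Real.log 2 := by
    rw [show (4 : ℝ) = 2 ^ 2 by norm_num, Real.log_pow]; norm_num
  have hl21 : Real.log 2 ≤ 1 := by linarith [Real.log_two_lt_d9]
  have hm0 : 0 ≤ min a b := (lt_min ha0 hb0).le
  have hme : 0 ≤ min a b ^ ε / ε := div_nonneg (Real.rpow_nonneg hm0 _) hε.le
  have hlogA : Real.log (4 * a) ≤ (2 + 3 * (min a b ^ ε / ε)) + 2 * Real.log R := by
    rw [Real.log_mul (by norm_num) ha0.ne', hl4]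
    rcases le_total a b with h | h
    · rw [min_eq_left h] at hme ⊢
      linarith [Real.log_le_rpow_div ha0.le hε]
    · rw [min_eq_right h] at hme ⊢
      have h1 : Real.log (a ^ 2) ≤ Real.log ((b * c) ^ 3) := Real.log_le_log (by positivity) habc
      rw [Real.log_pow, Real.log_pow, Real.log_mul hb0.ne' hc0.ne', hlc] at h1
      push_cast at h1
      linarith [Real.log_le_rpow_div hb0.le hε]
  have hlogC : Real.log (4 * c) ≤ 2 * Real.log (2 * b) + 2 * Real.log R := by
    rw [Real.log_mul (by norm_num) hc0.ne', Real.log_mul (by norm_num) hb0.ne', hl4, hlc]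
    linarith
  have hl2b : 0 ≤ Real.log (2 * b) := Real.log_nonneg (by linarith)
  have h1 := rpow_neg_mul_one_add_le hR hQ0 hQ1 (by linarith) hlogA
  have h2 := rpow_neg_mul_one_add_le hR hQ0 hQ1 (by linarith) hlogC
  have hme' : 0 ≤ min a b ^ ε * Q := mul_nonneg (Real.rpow_nonneg hm0 _) hQ0
  have h1' : R ^ (-(1 / 12) : ℝ) * (1 + Real.log (4 * a) * Q) ≤
      (27 + 3 / ε) * (1 + min a b ^ ε * Q) := by
    refine h1.trans ?_
    have e1 : (0 : ℝ) < 3 / ε := by positivity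
    have e2 : 3 * (min a b ^ ε / ε) * Q = 3 / ε * (min a b ^ ε * Q) := by ring
    nlinarith
  have h2' : R ^ (-(1 / 12) : ℝ) * (1 + Real.log (4 * c) * Q) ≤
      25 * (1 + Real.log (2 * b) * Q) := by
    refine h2.trans ?_
    nlinarith [mul_nonneg hl2b hQ0]
  have hsplit : b ^ (2 / 3 : ℝ) * c ^ (1 / 3 : ℝ) =
      b ^ (1 / 2 : ℝ) * c ^ (1 / 2 : ℝ) * (R ^ (-(1 / 12) : ℝ) * R ^ (-(1 / 12) : ℝ)) := by
    rw [← Real.rpow_add hR0, hc, Real.mul_rpow hb0.le hR0.le, Real.mul_rpow hb0.le hR0.le,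
      ← mul_assoc, ← Real.rpow_add hb0, mul_assoc, mul_assoc, ← Real.rpow_add hR0, ← mul_assoc,
      ← Real.rpow_add hb0]
    norm_num
  have hC0 : 0 ≤ R ^ (-(1 / 12) : ℝ) * (1 + Real.log (4 * c) * Q) := by
    have : 0 ≤ Real.log (4 * c) := Real.log_nonneg (by linarith)
    positivity
  calc _ = b ^ (1 / 2 : ℝ) * c ^ (1 / 2 : ℝ) *
        ((R ^ (-(1 / 12) : ℝ) * (1 + Real.log (4 * a) * Q)) *
          (R ^ (-(1 / 12) : ℝ) * (1 + Real.log (4 * c) * Q))) := by rw [hsplit]; ring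
    _ ≤ b ^ (1 / 2 : ℝ) * c ^ (1 / 2 : ℝ) *
        (((27 + 3 / ε) * (1 + min a b ^ ε * Q)) * (25 * (1 + Real.log (2 * b) * Q))) := by
      gcongr
    _ = _ := by ring

theorem card_box_le_of_c_le_b {A B C : Fin 3 → ℕ}
    (hA : ∀ i, 0 < A i) (hB : ∀ i, 0 < B i) (hC : ∀ i, 0 < C i)
    (S : Finset Triple) (hS : ∀ x ∈ S, IsPt x ∧ InBox A B C x)
    (hmax : ∀ i, A i * B i * C i ^ 2 ≤ A 2 * B 2 * C 2 ^ 2)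
    (hcb : (∏ i, (C i : ℝ)) ≤ ∏ i, (B i : ℝ)) :
    (#S : ℝ) ≤ 2 ^ 17 * ((∏ i, (A i : ℝ)) ^ (2 / 3 : ℝ) * (∏ i, (B i : ℝ)) ^ (2 / 3 : ℝ) *
      (∏ i, (C i : ℝ)) ^ (1 / 3 : ℝ) +
      (∏ i, (A i : ℝ)) * ((∏ i, (B i : ℝ)) ^ (1 / 2 : ℝ) * (∏ i, (C i : ℝ)) ^ (1 / 2 : ℝ))) := by
  have hAr : ∀ i, (0 : ℝ) < A i := fun i => by exact_mod_cast hA i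
  have hBr : ∀ i, (0 : ℝ) < B i := fun i => by exact_mod_cast hB i
  have hCr : ∀ i, (0 : ℝ) < C i := fun i => by exact_mod_cast hC i
  have hmaxr : ∀ i, (A i * B i * C i ^ 2 : ℝ) ≤ A 2 * B 2 * C 2 ^ 2 :=
    fun i => by exact_mod_cast hmax i
  have h := card_box_le_ac hA hB hC S hS
  simp only [Fin.prod_univ_three] at hcb ⊢
  have a0 := hAr 0
  have a1 := hAr 1
  have a2 := hAr 2
  have b0 := hBr 0
  have b1 := hBr 1
  have b2 := hBr 2
  have c0 := hCr 0
  have c1 := hCr 1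
  have c2 := hCr 2
  set a : ℝ := A 0 * A 1 * A 2 with ha
  set b : ℝ := B 0 * B 1 * B 2 with hb
  set c : ℝ := C 0 * C 1 * C 2 with hc
  have ha0 : 0 < a := by positivity
  have hb0 : 0 < b := by positivity
  have hc0 : 0 < c := by positivity
  have h1 : a * c ≤ a * (b ^ (1 / 2 : ℝ) * c ^ (1 / 2 : ℝ)) := by
    gcongr
    calc c = c ^ (1 / 2 : ℝ) * c ^ (1 / 2 : ℝ) := by rw [← Real.rpow_add hc0]; norm_num
      _ ≤ _ := by gcongr
  have h2 : a * c * (B 0 * B 1 / (A 2 * C 2 ^ 2)) ≤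
      a ^ (2 / 3 : ℝ) * b ^ (2 / 3 : ℝ) * c ^ (1 / 3 : ℝ) := by
    refine le_of_pow_le_pow_left₀ (n := 3) (by norm_num) (by positivity) ?_
    have e1 : (a ^ (2 / 3 : ℝ) * b ^ (2 / 3 : ℝ) * c ^ (1 / 3 : ℝ)) ^ 3 = a ^ 2 * b ^ 2 * c := by
      rw [mul_pow, mul_pow, ← Real.rpow_mul_natCast ha0.le, ← Real.rpow_mul_natCast hb0.le,
        ← Real.rpow_mul_natCast hc0.le]
      norm_num
    have e2 : a * b * c ^ 2 ≤ (A 2 * B 2 * C 2 ^ 2) ^ 3 := by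
      calc a * b * c ^ 2
          = (A 0 * B 0 * C 0 ^ 2) * (A 1 * B 1 * C 1 ^ 2) * (A 2 * B 2 * C 2 ^ 2 : ℝ) := by
            rw [ha, hb, hc]; ring
        _ ≤ (A 2 * B 2 * C 2 ^ 2) * (A 2 * B 2 * C 2 ^ 2) * (A 2 * B 2 * C 2 ^ 2 : ℝ) := by
            exact mul_le_mul_of_nonneg_right (mul_le_mul (hmaxr 0) (hmaxr 1) (by positivity)
              (by positivity)) (by positivity)
        _ = _ := by ring
    rw [e1, ← mul_div_assoc, div_pow, div_le_iff₀ (by positivity)]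
    refine le_of_mul_le_mul_right (a := (B 2 : ℝ) ^ 3) ?_ (by positivity)
    calc (a * c * (B 0 * B 1)) ^ 3 * B 2 ^ 3 = a ^ 2 * b ^ 2 * c * (a * b * c ^ 2) := by
          rw [hb]; ring
      _ ≤ a ^ 2 * b ^ 2 * c * (A 2 * B 2 * C 2 ^ 2) ^ 3 := by gcongr
      _ = _ := by ring
  calc (#S : ℝ) ≤ _ := h
    _ = 4096 * 12 * (a * c) + 2 ^ 17 * (a * c * (B 0 * B 1 / (A 2 * C 2 ^ 2))) := by ring
    _ ≤ 2 ^ 17 * (a * (b ^ (1 / 2 : ℝ) * c ^ (1 / 2 : ℝ))) +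
        2 ^ 17 * (a ^ (2 / 3 : ℝ) * b ^ (2 / 3 : ℝ) * c ^ (1 / 3 : ℝ)) := by
      gcongr
      norm_num
    _ = _ := by ring

theorem card_box_le_of_le_a {A B C : Fin 3 → ℕ}
    (hB : ∀ i, 0 < B i) (hC : ∀ i, 0 < C i)
    (S : Finset Triple) (hS : ∀ x ∈ S, IsPt x ∧ InBox A B C x) (hmax : ∀ i, A i ≤ A 2)
    (habc : ((∏ i, (B i : ℝ)) * ∏ i, (C i : ℝ)) ^ 3 ≤ (∏ i, (A i : ℝ)) ^ 2) :
    (#S : ℝ) ≤ 65536 *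
      ((∏ i, (A i : ℝ)) * ((∏ i, (B i : ℝ)) ^ (1 / 2 : ℝ) * (∏ i, (C i : ℝ)) ^ (1 / 2 : ℝ))) := by
  have hBr : ∀ i, (0 : ℝ) < B i := fun i => by exact_mod_cast hB i
  have hCr : ∀ i, (0 : ℝ) < C i := fun i => by exact_mod_cast hC i
  have h := card_box_le_bc S hS
  simp only [Fin.prod_univ_three] at habc ⊢
  have b0 := hBr 0
  have b1 := hBr 1
  have b2 := hBr 2
  have c0 := hCr 0
  have c1 := hCr 1
  have c2 := hCr 2
  set b : ℝ := B 0 * B 1 * B 2 with hb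
  set c : ℝ := C 0 * C 1 * C 2 with hc
  have hb0 : 0 < b := by positivity
  have hc0 : 0 < c := by positivity
  have h1 : b * c ≤ (A 2 : ℝ) ^ 2 := by
    refine le_of_pow_le_pow_left₀ (n := 3) (by norm_num) (by positivity) (habc.trans ?_)
    calc (A 0 * A 1 * A 2 : ℝ) ^ 2 ≤ (A 2 * A 2 * A 2 : ℝ) ^ 2 := by
          gcongr <;> exact hmax _
      _ = _ := by ring
  have h2 : b ^ (1 / 2 : ℝ) * c ^ (1 / 2 : ℝ) ≤ A 2 := by
    rw [← Real.mul_rpow hb0.le hc0.le, ← Real.sqrt_eq_rpow]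
    exact Real.sqrt_le_iff.mpr ⟨by positivity, h1⟩
  have h3 : b * c = b ^ (1 / 2 : ℝ) * c ^ (1 / 2 : ℝ) * (b ^ (1 / 2 : ℝ) * c ^ (1 / 2 : ℝ)) := by
    rw [← Real.mul_rpow hb0.le hc0.le, ← Real.rpow_add (by positivity)]; norm_num
  calc (#S : ℝ) ≤ _ := h
    _ = 65536 * (A 0 * A 1 * (b * c)) := by ring
    _ = 65536 * (A 0 * A 1 * (b ^ (1 / 2 : ℝ) * c ^ (1 / 2 : ℝ) *
        (b ^ (1 / 2 : ℝ) * c ^ (1 / 2 : ℝ)))) := by rw [← h3]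
    _ ≤ 65536 * (A 0 * A 1 * (A 2 * (b ^ (1 / 2 : ℝ) * c ^ (1 / 2 : ℝ)))) := by gcongr
    _ = _ := by ring

theorem mul_one_add_classWidth_le {A B C : Fin 3 → ℕ}
    (hA : ∀ i, 0 < A i) (hB : ∀ i, 0 < B i) (hC : ∀ i, 0 < C i)
    (hmin : ∀ i, C 2 * B i ≤ C i * B 2) :
    (B 0 * B 1) * C 2 * (1 + classWidth A B C) ≤
      3 * ((∏ i, (B i : ℝ)) ^ (2 / 3 : ℝ) * (∏ i, (C i : ℝ)) ^ (1 / 3 : ℝ)) := by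
  have hAr : ∀ i, (1 : ℝ) ≤ A i := fun i => by exact_mod_cast hA i
  have hBr : ∀ i, (0 : ℝ) < B i := fun i => by exact_mod_cast hB i
  have hCr : ∀ i, (0 : ℝ) < C i := fun i => by exact_mod_cast hC i
  have hminr : ∀ i, (C 2 * B i : ℝ) ≤ C i * B 2 := fun i => by exact_mod_cast hmin i
  simp only [Fin.prod_univ_three]
  have a0 : (0 : ℝ) < A 0 := by exact_mod_cast hA 0
  have a1 : (0 : ℝ) < A 1 := by exact_mod_cast hA 1
  have a2 : (0 : ℝ) < A 2 := by exact_mod_cast hA 2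
  have b0 := hBr 0
  have b1 := hBr 1
  have b2 := hBr 2
  have c0 := hCr 0
  have c1 := hCr 1
  have c2 := hCr 2
  set b : ℝ := B 0 * B 1 * B 2 with hb
  set c : ℝ := C 0 * C 1 * C 2 with hc
  have hb0 : 0 < b := by positivity
  have hc0 : 0 < c := by positivity
  have e1 : (b ^ (2 / 3 : ℝ) * c ^ (1 / 3 : ℝ)) ^ 3 = b ^ 2 * c := by
    rw [mul_pow, ← Real.rpow_mul_natCast hb0.le, ← Real.rpow_mul_natCast hc0.le]
    norm_num
  have h1 : (B 0 * B 1) * C 2 ≤ b ^ (2 / 3 : ℝ) * c ^ (1 / 3 : ℝ) := by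
    refine le_of_pow_le_pow_left₀ (n := 3) (by norm_num) (by positivity) ?_
    rw [e1]
    calc ((B 0 * B 1) * C 2 : ℝ) ^ 3
        = (B 0 * B 1) ^ 2 * C 2 * ((C 2 * B 0) * (C 2 * B 1) : ℝ) := by ring
      _ ≤ (B 0 * B 1) ^ 2 * C 2 * ((C 0 * B 2) * (C 1 * B 2) : ℝ) := by
        exact mul_le_mul_of_nonneg_left (mul_le_mul (hminr 0) (hminr 1) (by positivity)
          (by positivity)) (by positivity)
      _ = _ := by rw [hb, hc]; ring
  have hW0 : 0 ≤ classWidth A B C := le_min (by positivity) (by positivity)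
  have h2 : (B 0 * B 1) * C 2 * classWidth A B C ≤ 2 * (b ^ (2 / 3 : ℝ) * c ^ (1 / 3 : ℝ)) := by
    refine le_of_pow_le_pow_left₀ (n := 3) (by norm_num) (by positivity) ?_
    have h3 : classWidth A B C ^ 3 ≤ C 0 * C 1 / (A 2 * C 2 ^ 2) *
        (4 * B 2 ^ 2 / (A 0 * A 1 * (B 0 * B 1))) := by
      calc classWidth A B C ^ 3 = classWidth A B C * classWidth A B C ^ 2 := by ring
        _ ≤ C 0 * C 1 / (A 2 * C 2 ^ 2) *
          (2 * B 2 / Real.sqrt (A 0 * A 1 * (B 0 * B 1))) ^ 2 := by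
          gcongr
          · exact min_le_left _ _
          · exact min_le_right _ _
        _ = _ := by rw [div_pow, Real.sq_sqrt (by positivity)]; ring
    have h4 : (1 : ℝ) ≤ A 0 * A 1 * A 2 := by
      have := one_le_mul_of_one_le_of_one_le
        (one_le_mul_of_one_le_of_one_le (hAr 0) (hAr 1)) (hAr 2)
      exact this
    rw [mul_pow, mul_pow 2, e1]
    calc _ ≤ ((B 0 * B 1) * C 2 : ℝ) ^ 3 * (C 0 * C 1 / (A 2 * C 2 ^ 2) *
        (4 * B 2 ^ 2 / (A 0 * A 1 * (B 0 * B 1)))) := by gcongr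
      _ = 4 * (b ^ 2 * c) / (A 0 * A 1 * A 2) := by rw [hb, hc]; field_simp
      _ ≤ 4 * (b ^ 2 * c) := div_le_self (by positivity) h4
      _ ≤ _ := by
        have : 0 ≤ b ^ 2 * c := by positivity
        linarith
  calc _ = (B 0 * B 1) * C 2 + (B 0 * B 1) * C 2 * classWidth A B C := by ring
    _ ≤ _ := by linarith

theorem le_prod_three {N : Fin 3 → ℕ} (hN : ∀ i, 0 < N i) : (N 2 : ℝ) ≤ ∏ i, (N i : ℝ) := by
  rw [Fin.prod_univ_three]
  have h : 1 * N 2 ≤ N 0 * N 1 * N 2 :=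
    Nat.mul_le_mul_right _ (Nat.mul_pos (hN 0) (hN 1))
  rw [one_mul] at h
  exact_mod_cast h

theorem exists_card_hardBox_le_prod : ∃ K : ℝ, 1 ≤ K ∧ ∀ {A B C : Fin 3 → ℕ},
    (∀ i, 0 < A i) → (∀ i, 0 < B i) → (∀ i, 0 < C i) →
    (∀ i, C 2 * B i ≤ C i * B 2) → ∀ m : ℝ, 0 < m → (∀ i j, i ≠ j → m ≤ B i * B j) →
    ∀ S : Finset Triple, (∀ x ∈ S, IsPt x ∧ InBox A B C x) →
    (#S : ℝ) ≤ K * ((∏ i, (A i : ℝ)) *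
      ((∏ i, (B i : ℝ)) ^ (2 / 3 : ℝ) * (∏ i, (C i : ℝ)) ^ (1 / 3 : ℝ) *
      ((1 + Real.log (4 * ∏ i, (A i : ℝ)) * m ^ (-(1 / 16) : ℝ)) *
        (1 + Real.log (4 * ∏ i, (C i : ℝ)) * m ^ (-(1 / 16) : ℝ))))) := by
  obtain ⟨K, hK1, hK⟩ := exists_card_hardBox_le
  refine ⟨K * 3, by linarith, fun {A B C} hA hB hC hmin m hm0 hm S hS => ?_⟩
  have h := hK A B C hA hB hC S hS
  have h1 := mul_one_add_classWidth_le hA hB hC hmin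
  have hA1 : (1 : ℝ) ≤ A 2 := by exact_mod_cast hA 2
  have hC1 : (1 : ℝ) ≤ C 2 := by exact_mod_cast hC 2
  have hlA : Real.log (4 * A 2) ≤ Real.log (4 * ∏ i, (A i : ℝ)) :=
    Real.log_le_log (by linarith) (by linarith [le_prod_three hA])
  have hlC : Real.log (4 * C 2) ≤ Real.log (4 * ∏ i, (C i : ℝ)) :=
    Real.log_le_log (by linarith) (by linarith [le_prod_three hC])
  have hlA0 : 0 ≤ Real.log (4 * A 2) := Real.log_nonneg (by linarith)
  have hlC0 : 0 ≤ Real.log (4 * C 2) := Real.log_nonneg (by linarith)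
  have hlA0' := hlA0.trans hlA
  have hlC0' := hlC0.trans hlC
  have hp : ((B 0 * B 1 : ℝ)) ^ (-(1 / 16) : ℝ) ≤ m ^ (-(1 / 16) : ℝ) :=
    Real.rpow_le_rpow_of_nonpos hm0 (hm 0 1 (by decide)) (by norm_num)
  have hp0 : 0 ≤ ((B 0 * B 1 : ℝ)) ^ (-(1 / 16) : ℝ) := Real.rpow_nonneg (by positivity) _
  have hpA : (A 0 * A 1 * A 2 : ℝ) = ∏ i, (A i : ℝ) :=
    (Fin.prod_univ_three (fun i => (A i : ℝ))).symm
  rw [hpA] at h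
  have hW0 : 0 ≤ classWidth A B C := le_min (by positivity) (by positivity)
  calc (#S : ℝ) ≤ _ := h
    _ = K * ((∏ i, (A i : ℝ)) * ((B 0 * B 1) * C 2 * (1 + classWidth A B C) *
        ((1 + Real.log (4 * A 2) * (B 0 * B 1 : ℝ) ^ (-(1 / 16) : ℝ)) *
          (1 + Real.log (4 * C 2) * (B 0 * B 1 : ℝ) ^ (-(1 / 16) : ℝ))))) := by ring
    _ ≤ K * ((∏ i, (A i : ℝ)) *
          (3 * ((∏ i, (B i : ℝ)) ^ (2 / 3 : ℝ) * (∏ i, (C i : ℝ)) ^ (1 / 3 : ℝ)) *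
      ((1 + Real.log (4 * ∏ i, (A i : ℝ)) * m ^ (-(1 / 16) : ℝ)) *
        (1 + Real.log (4 * ∏ i, (C i : ℝ)) * m ^ (-(1 / 16) : ℝ))))) := by gcongr
    _ = _ := by ring

theorem exists_card_box_le {ε : ℝ} (hε : 0 < ε) : ∃ K : ℝ, 0 ≤ K ∧ ∀ {A B C : Fin 3 → ℕ},
    (∀ i, 0 < A i) → (∀ i, 0 < B i) → (∀ i, 0 < C i) →
    ∀ m : ℝ, 1 ≤ m → (∀ i j, i ≠ j → m ≤ B i * B j) →
    ∀ S : Finset Triple, (∀ x ∈ S, IsPt x ∧ InBox A B C x) →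
    (#S : ℝ) ≤ K * ((∏ i, (A i : ℝ)) ^ (2 / 3 : ℝ) * (∏ i, (B i : ℝ)) ^ (2 / 3 : ℝ) *
        (∏ i, (C i : ℝ)) ^ (1 / 3 : ℝ) +
      (∏ i, (A i : ℝ)) * ((∏ i, (B i : ℝ)) ^ (1 / 2 : ℝ) * (∏ i, (C i : ℝ)) ^ (1 / 2 : ℝ) *
      ((1 + min (∏ i, (A i : ℝ)) (∏ i, (B i : ℝ)) ^ ε * m ^ (-(1 / 16) : ℝ)) *
        (1 + Real.log (2 * ∏ i, (B i : ℝ)) * m ^ (-(1 / 16) : ℝ))))) := by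
  obtain ⟨K, hK1, hK⟩ := exists_card_hardBox_le_prod
  refine ⟨2 ^ 17 + K * ((27 + 3 / ε) * 25), by positivity,
    fun {A B C} hA hB hC m hm1 hm S hS => ?_⟩
  have hprod : ∀ (σ : Equiv.Perm (Fin 3)) (N : Fin 3 → ℕ),
      ∏ i, ((N ∘ σ) i : ℝ) = ∏ i, (N i : ℝ) := fun σ N => Equiv.prod_comp σ fun i => (N i : ℝ)
  have hone : ∀ N : Fin 3 → ℕ, (∀ i, 0 < N i) → (1 : ℝ) ≤ ∏ i, (N i : ℝ) := fun N hN => by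
    exact_mod_cast Finset.prod_pos fun i _ => hN i
  have ha := hone A hA
  have hb := hone B hB
  have hc := hone C hC
  set a := ∏ i, (A i : ℝ) with had
  set b := ∏ i, (B i : ℝ) with hbd
  set c := ∏ i, (C i : ℝ) with hcd
  set Q := m ^ (-(1 / 16) : ℝ) with hQ
  have hQ0 : 0 ≤ Q := Real.rpow_nonneg (by linarith) _
  have hQ1 : Q ≤ 1 := Real.rpow_le_one_of_one_le_of_nonpos hm1 (by norm_num)
  have hm0 : 0 ≤ min a b ^ ε := Real.rpow_nonneg (le_min (by linarith) (by linarith)) _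
  have hl0 : 0 ≤ Real.log (2 * b) := Real.log_nonneg (by linarith)
  have hF : 1 ≤ (1 + min a b ^ ε * Q) * (1 + Real.log (2 * b) * Q) :=
    one_le_mul_of_one_le_of_one_le (le_add_of_nonneg_right (by positivity))
      (le_add_of_nonneg_right (by positivity))
  set F := (1 + min a b ^ ε * Q) * (1 + Real.log (2 * b) * Q) with hFd
  have hT1 : 0 ≤ a ^ (2 / 3 : ℝ) * b ^ (2 / 3 : ℝ) * c ^ (1 / 3 : ℝ) := by positivity
  have hT2 : 0 ≤ a * (b ^ (1 / 2 : ℝ) * c ^ (1 / 2 : ℝ)) := by positivity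
  have hT2F : a * (b ^ (1 / 2 : ℝ) * c ^ (1 / 2 : ℝ)) ≤
      a * (b ^ (1 / 2 : ℝ) * c ^ (1 / 2 : ℝ) * F) :=
    (le_mul_of_one_le_right hT2 hF).trans_eq (by ring)
  have hK' : 0 ≤ K * ((27 + 3 / ε) * 25) := by positivity
  have hreduce : ∀ t : ℝ, t ≤ 2 ^ 17 * (a ^ (2 / 3 : ℝ) * b ^ (2 / 3 : ℝ) * c ^ (1 / 3 : ℝ) +
      a * (b ^ (1 / 2 : ℝ) * c ^ (1 / 2 : ℝ))) →
      t ≤ (2 ^ 17 + K * ((27 + 3 / ε) * 25)) * (a ^ (2 / 3 : ℝ) * b ^ (2 / 3 : ℝ) *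
        c ^ (1 / 3 : ℝ) + a * (b ^ (1 / 2 : ℝ) * c ^ (1 / 2 : ℝ) * F)) := by
    intro t ht
    refine ht.trans ?_
    gcongr
    linarith
  rcases le_total c b with hcb | hbc
  · obtain ⟨k, hk⟩ := Finite.exists_max fun i => A i * B i * C i ^ 2
    obtain ⟨T, hTc, hT⟩ := exists_card_eq_comp_perm hS (Equiv.swap k 2)
    have h := card_box_le_of_c_le_b (A := A ∘ Equiv.swap k 2) (B := B ∘ Equiv.swap k 2)
      (C := C ∘ Equiv.swap k 2) (fun i => hA _) (fun i => hB _) (fun i => hC _) T hT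
      (fun i => by simpa using hk _) (by rw [hprod, hprod]; exact hcb)
    rw [hprod, hprod, hprod, hTc] at h
    exact hreduce _ h
  rcases le_total ((b * c) ^ 3) (a ^ 2) with habc | habc
  · obtain ⟨k, hk⟩ := Finite.exists_max A
    obtain ⟨T, hTc, hT⟩ := exists_card_eq_comp_perm hS (Equiv.swap k 2)
    have h := card_box_le_of_le_a (A := A ∘ Equiv.swap k 2) (B := B ∘ Equiv.swap k 2)
      (C := C ∘ Equiv.swap k 2) (fun i => hB _) (fun i => hC _) T hT
      (fun i => by simpa using hk _) (by rw [hprod, hprod, hprod]; exact habc)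
    rw [hprod, hprod, hprod, hTc] at h
    refine hreduce _ (h.trans ?_)
    norm_num only
    linarith
  · obtain ⟨k, hk⟩ := Finite.exists_min fun i => (C i : ℝ) / B i
    obtain ⟨T, hTc, hT⟩ := exists_card_eq_comp_perm hS (Equiv.swap k 2)
    have h := hK (A := A ∘ Equiv.swap k 2) (B := B ∘ Equiv.swap k 2)
      (C := C ∘ Equiv.swap k 2) (fun i => hA _) (fun i => hB _) (fun i => hC _) (fun i => by
      have h1 := hk (Equiv.swap k 2 i)
      rw [div_le_div_iff₀ (by exact_mod_cast hB _) (by exact_mod_cast hB _)] at h1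
      simpa using (by exact_mod_cast h1 : C k * B (Equiv.swap k 2 i) ≤ C (Equiv.swap k 2 i) * B k))
      m (by linarith) (fun i j hij => hm _ _ ((Equiv.swap k 2).injective.ne hij)) T hT
    rw [hprod, hprod, hprod, hTc] at h
    have h2 := mul_log_factors_le hε ha hb hbc habc hQ0 hQ1
    calc (#S : ℝ) ≤ _ := h
      _ ≤ K * (a * ((27 + 3 / ε) * 25 * (b ^ (1 / 2 : ℝ) * c ^ (1 / 2 : ℝ) * F))) := by gcongr
      _ = K * ((27 + 3 / ε) * 25) * (0 + a * (b ^ (1 / 2 : ℝ) * c ^ (1 / 2 : ℝ) * F)) := by ring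
      _ ≤ _ := by
        have : 0 ≤ a * (b ^ (1 / 2 : ℝ) * c ^ (1 / 2 : ℝ) * F) := hT2.trans hT2F
        gcongr
        norm_num

/-- The exponents of the dyadic boxes meeting the region bounded by `X`. -/
noncomputable def dyadicExponents (X : Fin 3 → ℝ) : Finset (Fin 3 → ℕ) :=
  Fintype.piFinset fun i => range (Nat.log 2 ⌊X i⌋₊ + 1)

theorem two_pow_le_of_mem_dyadicExponents {X : Fin 3 → ℝ} (hX : ∀ i, 1 ≤ X i) {e : Fin 3 → ℕ}
    (he : e ∈ dyadicExponents X) (i : Fin 3) : (2 : ℝ) ^ e i ≤ X i := by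
  have h := Fintype.mem_piFinset.mp he i
  rw [mem_range, Nat.lt_succ_iff] at h
  have hf : ⌊X i⌋₊ ≠ 0 := (Nat.floor_pos.mpr (hX i)).ne'
  have h1 : 2 ^ e i ≤ ⌊X i⌋₊ :=
    (Nat.pow_le_pow_right two_pos h).trans (Nat.pow_log_le_self 2 hf)
  calc (2 : ℝ) ^ e i = ((2 ^ e i : ℕ) : ℝ) := by push_cast; rfl
    _ ≤ ⌊X i⌋₊ := Nat.cast_le.mpr h1
    _ ≤ X i := Nat.floor_le (by linarith [hX i])

theorem log_natAbs_mem_dyadicExponents {X : Fin 3 → ℝ} {v : Fin 3 → ℤ}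
    (h : ∀ i, |(v i : ℝ)| ≤ X i) :
    (fun i => Nat.log 2 (v i).natAbs) ∈ dyadicExponents X := by
  refine Fintype.mem_piFinset.mpr fun i => ?_
  rw [mem_range, Nat.lt_succ_iff]
  refine Nat.log_mono_right (Nat.le_floor ?_)
  rw [Nat.cast_natAbs]
  exact_mod_cast h i

theorem sum_range_pow_le {r : ℝ} (hr : 1 < r) (n : ℕ) :
    ∑ j ∈ range (n + 1), r ^ j ≤ r / (r - 1) * r ^ n := by
  rw [geom_sum_eq hr.ne', div_mul_eq_mul_div]
  have : 0 < r - 1 := by linarith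
  gcongr
  rw [pow_succ']
  linarith

theorem exists_sum_dyadicExponents_le {θ : ℝ} (hθ : 0 < θ) : ∃ K : ℝ, 0 ≤ K ∧
    ∀ X : Fin 3 → ℝ, (∀ i, 1 ≤ X i) →
      ∑ e ∈ dyadicExponents X, (∏ i, (2 : ℝ) ^ e i) ^ θ ≤ K * (∏ i, X i) ^ θ := by
  have hr : (1 : ℝ) < 2 ^ θ := Real.one_lt_rpow one_lt_two hθ
  set r : ℝ := 2 ^ θ with hrd
  have hr' : 0 < r - 1 := by linarith
  refine ⟨(r / (r - 1)) ^ 3, by positivity, fun X hX => ?_⟩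
  have hpow : ∀ n : ℕ, ((2 : ℝ) ^ n) ^ θ = r ^ n := fun n => by
    rw [hrd, ← Real.rpow_natCast, ← Real.rpow_natCast, ← Real.rpow_mul (by norm_num),
      ← Real.rpow_mul (by norm_num), mul_comm]
  calc ∑ e ∈ dyadicExponents X, (∏ i, (2 : ℝ) ^ e i) ^ θ
      = ∑ e ∈ dyadicExponents X, ∏ i, r ^ e i := by
        refine sum_congr rfl fun e _ => ?_
        rw [← Real.finsetProd_rpow _ _ fun i _ => by positivity]
        exact prod_congr rfl fun i _ => hpow _
    _ = ∏ i, ∑ j ∈ range (Nat.log 2 ⌊X i⌋₊ + 1), r ^ j := by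
        rw [dyadicExponents, Finset.prod_univ_sum]
    _ ≤ ∏ i, (r / (r - 1) * X i ^ θ) := by
        refine prod_le_prod (fun i _ => sum_nonneg fun j _ => by positivity) fun i _ => ?_
        refine (sum_range_pow_le hr _).trans ?_
        gcongr
        rw [← hpow]
        refine Real.rpow_le_rpow (by positivity) ?_ hθ.le
        calc (2 : ℝ) ^ Nat.log 2 ⌊X i⌋₊ = ((2 ^ Nat.log 2 ⌊X i⌋₊ : ℕ) : ℝ) := by push_cast; rfl
          _ ≤ ⌊X i⌋₊ := Nat.cast_le.mpr (Nat.pow_log_le_self 2 (Nat.floor_pos.mpr (hX i)).ne')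
          _ ≤ X i := Nat.floor_le (by linarith [hX i])
    _ = _ := by
        rw [prod_mul_distrib, prod_const, card_univ, Fintype.card_fin,
          Real.finsetProd_rpow _ _ fun i _ => by linarith [hX i]]

theorem exists_prod_eq_mul_mul {i j : Fin 3} (hij : i ≠ j) :
    ∃ k, ∀ f : Fin 3 → ℝ, ∏ l, f l = f i * f j * f k := by
  obtain ⟨k, hik, hjk, hk⟩ : ∃ k, i ≠ k ∧ j ≠ k ∧ (univ : Finset (Fin 3)) = {i, j, k} := by
    revert i j
    decide
  refine ⟨k, fun f => ?_⟩
  rw [hk, prod_insert (by simp [hij, hik]), prod_pair hjk, mul_assoc]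

theorem box_factor_le {ε : ℝ} (hε : 0 < ε) {a b a' b' m : ℝ} (ha' : 0 < a') (hb' : 1 ≤ b')
    (ha : a' ≤ a) (hb : b' ≤ b) (hm : 1 ≤ m) :
    b' ^ (1 / 2 : ℝ) * ((1 + min a' b' ^ ε * (max 1 (m * (b' / b))) ^ (-(1 / 16) : ℝ)) *
      (1 + Real.log (2 * b') * (max 1 (m * (b' / b))) ^ (-(1 / 16) : ℝ))) ≤
    2 * (b' ^ (3 / 8 : ℝ) * b ^ (1 / 8 : ℝ)) * ((1 + min a b ^ ε * m ^ (-(1 / 16) : ℝ)) *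
      (1 + Real.log b * m ^ (-(1 / 16) : ℝ))) := by
  have hb'0 : 0 < b' := by linarith
  have hb0 : 0 < b := by linarith
  have ha0 : 0 < a := by linarith
  have hm0 : 0 < m := by linarith
  have hr1 : 1 ≤ b / b' := (one_le_div hb'0).mpr hb
  set ρ := (b / b') ^ (1 / 16 : ℝ) with hρ
  have hρ1 : 1 ≤ ρ := Real.one_le_rpow hr1 (by norm_num)
  set μ := m ^ (-(1 / 16) : ℝ) with hμ
  have hμ0 : 0 < μ := Real.rpow_pos_of_pos hm0 _
  have hμ1 : μ ≤ 1 := Real.rpow_le_one_of_one_le_of_nonpos hm (by norm_num)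
  have hle : (max 1 (m * (b' / b))) ^ (-(1 / 16) : ℝ) ≤ μ * ρ := by
    calc _ ≤ (m * (b' / b)) ^ (-(1 / 16) : ℝ) :=
          Real.rpow_le_rpow_of_nonpos (by positivity) (le_max_right _ _) (by norm_num)
      _ = μ * (b' / b) ^ (-(1 / 16) : ℝ) := Real.mul_rpow hm0.le (by positivity)
      _ = μ * ρ := by
        rw [hρ, Real.rpow_neg (by positivity), ← Real.inv_rpow (by positivity), inv_div]
  have hμ'0 : 0 ≤ (max 1 (m * (b' / b))) ^ (-(1 / 16) : ℝ) :=
    Real.rpow_nonneg (le_max_of_le_left zero_le_one) _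
  have hstep : ∀ x y : ℝ, 0 ≤ x → x ≤ y →
      1 + x * (max 1 (m * (b' / b))) ^ (-(1 / 16) : ℝ) ≤ ρ * (1 + y * μ) := by
    intro x y hx hxy
    have hy := hx.trans hxy
    have h1 : x * (max 1 (m * (b' / b))) ^ (-(1 / 16) : ℝ) ≤ y * (μ * ρ) := by gcongr
    linarith
  have hmin0 : 0 ≤ min a' b' := (lt_min ha' hb'0).le
  have h1 := hstep (min a' b' ^ ε) (min a b ^ ε) (by positivity)
    (Real.rpow_le_rpow hmin0 (min_le_min ha hb) hε.le)
  have hlog0 : 0 ≤ Real.log (2 * b') := Real.log_nonneg (by linarith)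
  have h2 := hstep (Real.log (2 * b')) (Real.log (2 * b)) hlog0
    (Real.log_le_log (by linarith) (by linarith))
  have hlb : 0 ≤ Real.log b := Real.log_nonneg (by linarith)
  have h3 : 1 + Real.log (2 * b) * μ ≤ 2 * (1 + Real.log b * μ) := by
    rw [Real.log_mul two_ne_zero hb0.ne']
    have : Real.log 2 ≤ 1 := by linarith [Real.log_two_lt_d9]
    have : Real.log 2 * μ ≤ 1 * 1 := by gcongr
    have : 0 ≤ Real.log b * μ := by positivity
    linarith
  have h4 : b' ^ (1 / 2 : ℝ) * (ρ * ρ) = b' ^ (3 / 8 : ℝ) * b ^ (1 / 8 : ℝ) := by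
    rw [hρ, ← Real.rpow_add (by positivity), Real.div_rpow hb0.le hb'0.le, mul_div_assoc',
      mul_comm, mul_div_assoc, ← Real.rpow_sub hb'0, mul_comm]
    norm_num
  have hmin1 : 0 ≤ min a b ^ ε := Real.rpow_nonneg (le_min ha0.le hb0.le) _
  calc _ ≤ b' ^ (1 / 2 : ℝ) * ((ρ * (1 + min a b ^ ε * μ)) * (ρ * (2 * (1 + Real.log b * μ)))) := by
        have : 0 ≤ ρ * (1 + min a b ^ ε * μ) := by positivity
        have h5 := h2.trans (mul_le_mul_of_nonneg_left h3 (by linarith : 0 ≤ ρ))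
        gcongr
    _ = 2 * (b' ^ (1 / 2 : ℝ) * (ρ * ρ)) * ((1 + min a b ^ ε * μ) * (1 + Real.log b * μ)) := by
        ring
    _ = _ := by rw [h4]

theorem exists_card_dyadicBox_le {ε : ℝ} (hε : 0 < ε) : ∃ K : ℝ, 0 ≤ K ∧
    ∀ {A B C : Fin 3 → ℝ}, (∀ i, 1 ≤ A i) → (∀ i, 1 ≤ B i) →
    ∀ m : ℝ, 1 ≤ m → (∀ i j, i ≠ j → m ≤ B i * B j) →
    ∀ e ∈ dyadicExponents A, ∀ f ∈ dyadicExponents B, ∀ g ∈ dyadicExponents C,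
    ∀ S : Finset Triple,
      (∀ x ∈ S, IsPt x ∧ InBox (fun i => 2 ^ e i) (fun i => 2 ^ f i) (fun i => 2 ^ g i) x) →
    (#S : ℝ) ≤ K * ((∏ i, (2 : ℝ) ^ e i) ^ (2 / 3 : ℝ) * ((∏ i, (2 : ℝ) ^ f i) ^ (2 / 3 : ℝ) *
        (∏ i, (2 : ℝ) ^ g i) ^ (1 / 3 : ℝ)) +
      (∏ i, (2 : ℝ) ^ e i) ^ (1 : ℝ) * ((∏ i, (2 : ℝ) ^ f i) ^ (3 / 8 : ℝ) *
        (∏ i, (2 : ℝ) ^ g i) ^ (1 / 2 : ℝ)) * (2 * (∏ i, B i) ^ (1 / 8 : ℝ) *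
      ((1 + min (∏ i, A i) (∏ i, B i) ^ ε * m ^ (-(1 / 16) : ℝ)) *
        (1 + Real.log (∏ i, B i) * m ^ (-(1 / 16) : ℝ))))) := by
  obtain ⟨K, hK0, hK⟩ := exists_card_box_le hε
  refine ⟨K, hK0, fun {A B C} hA hB m hm1 hm e he f hf g hg S hS => ?_⟩
  have hb' : (1 : ℝ) ≤ ∏ i, (2 : ℝ) ^ f i :=
    Finset.one_le_prod fun i _ => one_le_pow₀ one_le_two
  have hb : ∏ i, (2 : ℝ) ^ f i ≤ ∏ i, B i :=
    prod_le_prod (fun i _ => by positivity) fun i _ => two_pow_le_of_mem_dyadicExponents hB hf i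
  have ha : ∏ i, (2 : ℝ) ^ e i ≤ ∏ i, A i :=
    prod_le_prod (fun i _ => by positivity) fun i _ => two_pow_le_of_mem_dyadicExponents hA he i
  have ha' : 0 < ∏ i, (2 : ℝ) ^ e i := by positivity
  have hc' : 0 < ∏ i, (2 : ℝ) ^ g i := by positivity
  have hbox := box_factor_le hε ha' hb' ha hb hm1
  have h := hK (A := fun i => 2 ^ e i) (B := fun i => 2 ^ f i) (C := fun i => 2 ^ g i)
    (fun i => by positivity) (fun i => by positivity) (fun i => by positivity)
    (max 1 (m * ((∏ i, (2 : ℝ) ^ f i) / ∏ i, B i))) (le_max_left _ _) (fun i j hij => by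
      push_cast
      refine max_le (one_le_mul_of_one_le_of_one_le (one_le_pow₀ one_le_two)
        (one_le_pow₀ one_le_two)) ?_
      obtain ⟨k, hk⟩ := exists_prod_eq_mul_mul hij
      rw [mul_div_assoc', div_le_iff₀ (by linarith), hk, hk B]
      calc m * ((2 : ℝ) ^ f i * 2 ^ f j * 2 ^ f k)
          ≤ B i * B j * ((2 : ℝ) ^ f i * 2 ^ f j * B k) := by
            have := hm i j hij
            have := two_pow_le_of_mem_dyadicExponents hB hf k
            have : 0 ≤ B i * B j := by linarith
            gcongr
        _ = _ := by ring) S hS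
  push_cast at h
  generalize ∏ i, (2 : ℝ) ^ e i = a' at *
  generalize ∏ i, (2 : ℝ) ^ f i = b' at *
  generalize ∏ i, (2 : ℝ) ^ g i = c' at *
  refine h.trans (mul_le_mul_of_nonneg_left (add_le_add (mul_assoc _ _ _).le ?_) hK0)
  have h2 := mul_le_mul_of_nonneg_left hbox (by positivity : 0 ≤ a' * c' ^ (1 / 2 : ℝ))
  rw [Real.rpow_one]
  linarith

/-- A sum of separable terms over a product of three finite sets. -/
theorem sum_product_mul_mul {α β γ : Type*} (s : Finset α) (t : Finset β) (u : Finset γ)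
    (f : α → ℝ) (g : β → ℝ) (h : γ → ℝ) :
    ∑ x ∈ s ×ˢ t ×ˢ u, f x.1 * (g x.2.1 * h x.2.2) =
      (∑ x ∈ s, f x) * ((∑ y ∈ t, g y) * ∑ z ∈ u, h z) := by
  rw [sum_mul_sum, ← sum_product', sum_mul_sum, ← sum_product']

theorem sum_dyadicExponents_mul_le {A B C : Fin 3 → ℝ} (hA : ∀ i, 1 ≤ A i) (hB : ∀ i, 1 ≤ B i)
    {θ₁ θ₂ θ₃ L₁ L₂ L₃ : ℝ} (h₁ : 0 ≤ L₁) (h₂ : 0 ≤ L₂)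
    (hA' : ∑ e ∈ dyadicExponents A, (∏ i, (2 : ℝ) ^ e i) ^ θ₁ ≤ L₁ * (∏ i, A i) ^ θ₁)
    (hB' : ∑ e ∈ dyadicExponents B, (∏ i, (2 : ℝ) ^ e i) ^ θ₂ ≤ L₂ * (∏ i, B i) ^ θ₂)
    (hC' : ∑ e ∈ dyadicExponents C, (∏ i, (2 : ℝ) ^ e i) ^ θ₃ ≤ L₃ * (∏ i, C i) ^ θ₃) :
    ∑ y ∈ dyadicExponents A ×ˢ dyadicExponents B ×ˢ dyadicExponents C,
      (∏ i, (2 : ℝ) ^ y.1 i) ^ θ₁ *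
        ((∏ i, (2 : ℝ) ^ y.2.1 i) ^ θ₂ * (∏ i, (2 : ℝ) ^ y.2.2 i) ^ θ₃) ≤
      L₁ * (L₂ * L₃) * ((∏ i, A i) ^ θ₁ * ((∏ i, B i) ^ θ₂ * (∏ i, C i) ^ θ₃)) := by
  have h0 : ∀ (θ : ℝ) (X : Fin 3 → ℝ),
      0 ≤ ∑ e ∈ dyadicExponents X, (∏ i, (2 : ℝ) ^ e i) ^ θ := fun θ X =>
    sum_nonneg fun e _ => by positivity
  have hX : ∀ {θ L : ℝ} {X : Fin 3 → ℝ}, 0 ≤ L → (∀ i, 1 ≤ X i) → 0 ≤ L * (∏ i, X i) ^ θ :=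
    fun hL hX => mul_nonneg hL
      (Real.rpow_nonneg (zero_le_one.trans (Finset.one_le_prod fun i _ => hX i)) _)
  refine (sum_product_mul_mul _ _ _ (fun e : Fin 3 → ℕ => (∏ i, (2 : ℝ) ^ e i) ^ θ₁)
    (fun e : Fin 3 → ℕ => (∏ i, (2 : ℝ) ^ e i) ^ θ₂)
    fun e : Fin 3 → ℕ => (∏ i, (2 : ℝ) ^ e i) ^ θ₃).trans_le ?_
  calc _ ≤ L₁ * (∏ i, A i) ^ θ₁ * (L₂ * (∏ i, B i) ^ θ₂ * (L₃ * (∏ i, C i) ^ θ₃)) :=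
        mul_le_mul hA' (mul_le_mul hB' hC' (h0 _ _) (hX h₂ hB))
          (mul_nonneg (h0 _ _) (h0 _ _)) (hX h₁ hA)
    _ = _ := by ring

theorem exists_card_le_of_isPt {ε : ℝ} (hε : 0 < ε) : ∃ K : ℝ, 0 ≤ K ∧
    ∀ {A B C : Fin 3 → ℝ}, (∀ i, 1 ≤ A i) → (∀ i, 1 ≤ B i) → (∀ i, 1 ≤ C i) →
    ∀ m : ℝ, 1 ≤ m → (∀ i j, i ≠ j → m ≤ B i * B j) →
    ∀ S : Finset Triple, (∀ x ∈ S, IsPt x ∧ (∀ i, |(x.1 i : ℝ)| ≤ A i) ∧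
      (∀ i, |(x.2.1 i : ℝ)| ≤ B i) ∧ ∀ i, |(x.2.2 i : ℝ)| ≤ C i) →
    (#S : ℝ) ≤ K * ((∏ i, A i) ^ (2 / 3 : ℝ) * ((∏ i, B i) ^ (2 / 3 : ℝ) *
        (∏ i, C i) ^ (1 / 3 : ℝ)) +
      (∏ i, A i) * ((∏ i, B i) ^ (1 / 2 : ℝ) * (∏ i, C i) ^ (1 / 2 : ℝ)) *
      ((1 + min (∏ i, A i) (∏ i, B i) ^ ε * m ^ (-(1 / 16) : ℝ)) *
        (1 + Real.log (∏ i, B i) * m ^ (-(1 / 16) : ℝ)))) := by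
  obtain ⟨K, hK0, hK⟩ := exists_card_dyadicBox_le hε
  obtain ⟨K₁, hK₁0, hK₁⟩ := exists_sum_dyadicExponents_le (θ := 2 / 3) (by norm_num)
  obtain ⟨K₂, hK₂0, hK₂⟩ := exists_sum_dyadicExponents_le (θ := 1 / 3) (by norm_num)
  obtain ⟨K₃, hK₃0, hK₃⟩ := exists_sum_dyadicExponents_le (θ := 1) (by norm_num)
  obtain ⟨K₄, hK₄0, hK₄⟩ := exists_sum_dyadicExponents_le (θ := 3 / 8) (by norm_num)
  obtain ⟨K₅, hK₅0, hK₅⟩ := exists_sum_dyadicExponents_le (θ := 1 / 2) (by norm_num)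
  refine ⟨K * (K₁ * (K₁ * K₂) + 2 * (K₃ * (K₄ * K₅))), by positivity,
    fun {A B C} hA hB hC m hm1 hm S hS => ?_⟩
  have hpos : ∀ {X : Fin 3 → ℝ}, (∀ i, 1 ≤ X i) → 1 ≤ ∏ i, X i :=
    fun hX => Finset.one_le_prod fun i _ => hX i
  have ha := hpos hA
  have hb := hpos hB
  have hc := hpos hC
  set F := (1 + min (∏ i, A i) (∏ i, B i) ^ ε * m ^ (-(1 / 16) : ℝ)) *
        (1 + Real.log (∏ i, B i) * m ^ (-(1 / 16) : ℝ)) with hFd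
  have hF : 0 ≤ F := by
    have := Real.rpow_nonneg (le_min (zero_le_one.trans ha) (zero_le_one.trans hb)) ε
    have := Real.log_nonneg hb
    positivity
  let E : Triple → (Fin 3 → ℕ) × (Fin 3 → ℕ) × (Fin 3 → ℕ) := fun x =>
    (fun i => Nat.log 2 (x.1 i).natAbs, fun i => Nat.log 2 (x.2.1 i).natAbs,
      fun i => Nat.log 2 (x.2.2 i).natAbs)
  have hE : ∀ x ∈ S, E x ∈ dyadicExponents A ×ˢ dyadicExponents B ×ˢ dyadicExponents C :=
    fun x hx => mem_product.mpr ⟨log_natAbs_mem_dyadicExponents (hS x hx).2.1,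
      mem_product.mpr ⟨log_natAbs_mem_dyadicExponents (hS x hx).2.2.1,
        log_natAbs_mem_dyadicExponents (hS x hx).2.2.2⟩⟩
  have hle : ∀ n : ℤ, n ≠ 0 → 2 ^ Nat.log 2 n.natAbs ≤ n.natAbs := fun n hn =>
    Nat.pow_log_le_self 2 (Int.natAbs_ne_zero.mpr hn)
  have hlt : ∀ n : ℤ, n.natAbs < 2 * 2 ^ Nat.log 2 n.natAbs := fun n => by
    rw [← pow_succ']
    exact Nat.lt_pow_succ_log_self one_lt_two _
  have hfib : ∀ y ∈ dyadicExponents A ×ˢ dyadicExponents B ×ˢ dyadicExponents C,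
      (#{x ∈ S | E x = y} : ℝ) ≤ K * ((∏ i, (2 : ℝ) ^ y.1 i) ^ (2 / 3 : ℝ) *
        ((∏ i, (2 : ℝ) ^ y.2.1 i) ^ (2 / 3 : ℝ) * (∏ i, (2 : ℝ) ^ y.2.2 i) ^ (1 / 3 : ℝ)) +
      (∏ i, (2 : ℝ) ^ y.1 i) ^ (1 : ℝ) * ((∏ i, (2 : ℝ) ^ y.2.1 i) ^ (3 / 8 : ℝ) *
        (∏ i, (2 : ℝ) ^ y.2.2 i) ^ (1 / 2 : ℝ)) * (2 * (∏ i, B i) ^ (1 / 8 : ℝ) * F)) := by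
    rintro y hy
    obtain ⟨he, hy'⟩ := mem_product.mp hy
    obtain ⟨hf, hg⟩ := mem_product.mp hy'
    refine hK hA hB m hm1 hm _ he _ hf _ hg _ fun x hx => ?_
    obtain ⟨hxS, rfl⟩ := mem_filter.mp hx
    have hpt := (hS x hxS).1
    exact ⟨hpt, fun i => hle _ (hpt.a_ne i), fun i => hlt _, fun i => hle _ (hpt.b_ne i),
      fun i => hlt _, fun i => hle _ (hpt.c_ne i), fun i => hlt _⟩
  have hbb : (∏ i, B i) ^ (1 / 2 : ℝ) = (∏ i, B i) ^ (3 / 8 : ℝ) * (∏ i, B i) ^ (1 / 8 : ℝ) := by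
    rw [← Real.rpow_add (by linarith)]
    norm_num
  have hS1 := sum_dyadicExponents_mul_le hA hB hK₁0 hK₁0 (hK₁ A hA) (hK₁ B hB) (hK₂ C hC)
  have hS2 := sum_dyadicExponents_mul_le hA hB hK₃0 hK₄0 (hK₃ A hA) (hK₄ B hB) (hK₅ C hC)
  rw [card_eq_sum_card_fiberwise hE, Nat.cast_sum]
  refine (sum_le_sum hfib).trans ?_
  rw [← mul_sum, sum_add_distrib, ← sum_mul, mul_assoc K, hbb]
  rw [Real.rpow_one] at hS2
  refine mul_le_mul_of_nonneg_left ?_ hK0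
  have hB8 : 0 ≤ 2 * (∏ i, B i) ^ (1 / 8 : ℝ) * F := by positivity
  have hT1 : 0 ≤ (∏ i, A i) ^ (2 / 3 : ℝ) * ((∏ i, B i) ^ (2 / 3 : ℝ) *
        (∏ i, C i) ^ (1 / 3 : ℝ)) := by positivity
  have hT2 : 0 ≤ (∏ i, A i) * ((∏ i, B i) ^ (3 / 8 : ℝ) * (∏ i, B i) ^ (1 / 8 : ℝ) *
      (∏ i, C i) ^ (1 / 2 : ℝ)) * F := by positivity
  have hS2' := mul_le_mul_of_nonneg_right hS2 hB8
  have h1 : 0 ≤ K₁ * (K₁ * K₂) := by positivity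
  have h2 : 0 ≤ 2 * (K₃ * (K₄ * K₅)) := by positivity
  have h3 := mul_nonneg h1 hT2
  have h4 := mul_nonneg h2 hT1
  linarith

theorem natCard_le_of_forall_finset {α : Type*} {p : α → Prop} {r : ℝ}
    (h : ∀ S : Finset α, (∀ x ∈ S, p x) → (#S : ℝ) ≤ r) : (Nat.card {x // p x} : ℝ) ≤ r := by
  rcases finite_or_infinite {x // p x} with hfin | hinf
  · have hset : {x | p x}.Finite := hfin
    have hcard : Nat.card {x // p x} = #hset.toFinset := Nat.card_eq_card_finite_toFinset hset
    rw [hcard]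
    exact h _ fun x hx => hset.mem_toFinset.mp hx
  · simpa using h ∅

theorem Squarefree.isCoprime_of_mul_dvd {n a b : ℤ} (hn : Squarefree n) (h : a * b ∣ n) :
    IsCoprime a b :=
  isRelPrime_iff_isCoprime.mp fun d ha hb => hn d ((mul_dvd_mul ha hb).trans h)

theorem isUnit_of_dvd_of_gcd_natAbs_eq_one {v : Fin 3 → ℤ}
    (h : univ.gcd (fun i => (v i).natAbs) = 1) (d : ℤ) (hd : ∀ i, d ∣ v i) : IsUnit d := by
  rw [Int.isUnit_iff_natAbs_eq, ← Nat.dvd_one, ← h]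
  exact Finset.dvd_gcd fun i _ => Int.natAbs_dvd_natAbs.mpr (hd i)

theorem isPt_of_gcd_conditions {x : Triple}
    (hb : univ.gcd (fun i => (x.2.1 i).natAbs) = 1)
    (ha0 : ∀ i, x.1 i ≠ 0) (hb0 : ∀ i, x.2.1 i ≠ 0) (hc0 : ∀ i, x.2.2 i ≠ 0)
    (heq : ∑ i, x.1 i * x.2.1 i * x.2.2 i ^ 2 = 0)
    (hac : ∀ i j, i ≠ j → Int.gcd (x.1 i) (x.2.2 j) = 1)
    (hcc : ∀ i j, i ≠ j → Int.gcd (x.2.2 i) (x.2.2 j) = 1)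
    (ha : Squarefree (x.1 0 * x.1 1 * x.1 2))
    (habb : ∀ i j k : Fin 3, i ≠ j → j ≠ k → i ≠ k →
      Int.gcd (x.1 i) (Int.gcd (x.2.1 j) (x.2.1 k)) = 1) : IsPt x where
  a_ne := ha0
  b_ne := hb0
  c_ne := hc0
  eqn := heq
  aa i j hij := by
    have h01 := ha.isCoprime_of_mul_dvd (dvd_mul_right (x.1 0 * x.1 1) (x.1 2))
    have h02 := ha.isCoprime_of_mul_dvd
      (⟨x.1 1, by ring⟩ : x.1 0 * x.1 2 ∣ x.1 0 * x.1 1 * x.1 2)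
    have h12 := ha.isCoprime_of_mul_dvd
      (⟨x.1 0, by ring⟩ : x.1 1 * x.1 2 ∣ x.1 0 * x.1 1 * x.1 2)
    fin_cases i <;> fin_cases j <;>
      first | exact absurd rfl hij | assumption | exact IsCoprime.symm (by assumption)
  ac i j hij := Int.isCoprime_iff_gcd_eq_one.mpr (hac i j hij)
  cc i j hij := Int.isCoprime_iff_gcd_eq_one.mpr (hcc i j hij)
  bbb d hd := isUnit_of_dvd_of_gcd_natAbs_eq_one hb d hd
  abb i j k hij hjk hik d hdi hdj hdk :=
    (Int.isCoprime_iff_gcd_eq_one.mpr (habb i j k hij hjk hik)).isRelPrime hdi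
      (Int.dvd_coe_gcd hdj hdk)

end

theorem stmt_12 (ε : ℝ) (hε : 0 < ε) :
    ∃ K : ℝ, ∀ (A B C : Fin 3 → ℝ),
      (∀ i, 1 < A i) → (∀ i, 1 < B i) → (∀ i, 1 < C i) →
      (Nat.card {abc : (Fin 3 → ℤ) × (Fin 3 → ℤ) × (Fin 3 → ℤ) //
          Finset.gcd Finset.univ (fun i => (abc.1 i).natAbs) = 1 ∧
          Finset.gcd Finset.univ (fun i => (abc.2.1 i).natAbs) = 1 ∧
          Finset.gcd Finset.univ (fun i => (abc.2.2 i).natAbs) = 1 ∧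
          (∀ i, abc.1 i ≠ 0) ∧ (∀ i, abc.2.1 i ≠ 0) ∧ (∀ i, abc.2.2 i ≠ 0) ∧
          (∑ i, abc.1 i * abc.2.1 i * abc.2.2 i ^ 2 = 0) ∧
          (∀ i, |(abc.1 i : ℝ)| ≤ A i) ∧ (∀ i, |(abc.2.1 i : ℝ)| ≤ B i) ∧
          (∀ i, |(abc.2.2 i : ℝ)| ≤ C i) ∧
          (∀ i j, i ≠ j → Int.gcd (abc.1 i) (abc.2.2 j) = 1) ∧
          (∀ i j, i ≠ j → Int.gcd (abc.2.2 i) (abc.2.2 j) = 1) ∧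
          Squarefree (abc.1 0 * abc.1 1 * abc.1 2) ∧
          (∀ i j k : Fin 3, i ≠ j → j ≠ k → i ≠ k →
            Int.gcd (abc.1 i) (Int.gcd (abc.2.1 j) (abc.2.1 k)) = 1)} : ℝ)
        ≤ K * ((A 0 * A 1 * A 2) ^ ((2 : ℝ) / 3) * (B 0 * B 1 * B 2) ^ ((2 : ℝ) / 3) *
                 (C 0 * C 1 * C 2) ^ ((1 : ℝ) / 3)
            + (1 + min (A 0 * A 1 * A 2) (B 0 * B 1 * B 2) ^ ε /
                  (min (B 0 * B 1) (min (B 0 * B 2) (B 1 * B 2))) ^ ((1 : ℝ) / 16)) *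
              (1 + Real.log (B 0 * B 1 * B 2) /
                  (min (B 0 * B 1) (min (B 0 * B 2) (B 1 * B 2))) ^ ((1 : ℝ) / 16)) *
              (A 0 * A 1 * A 2) * (B 0 * B 1 * B 2) ^ ((1 : ℝ) / 2) *
              (C 0 * C 1 * C 2) ^ ((1 : ℝ) / 2)) := by
  obtain ⟨K, -, hK⟩ := exists_card_le_of_isPt hε
  refine ⟨K, fun A B C hA hB hC => natCard_le_of_forall_finset fun S hS => ?_⟩
  have hBB : ∀ i j, 1 ≤ B i * B j := fun i j => one_le_mul_of_one_le_of_one_le (hB i).le (hB j).le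
  set m := min (B 0 * B 1) (min (B 0 * B 2) (B 1 * B 2)) with hmd
  have hm1 : 1 ≤ m := le_min (hBB 0 1) (le_min (hBB 0 2) (hBB 1 2))
  have hm : ∀ i j, i ≠ j → m ≤ B i * B j := by
    have h01 : m ≤ B 0 * B 1 := min_le_left _ _
    have h02 : m ≤ B 0 * B 2 := (min_le_right _ _).trans (min_le_left _ _)
    have h12 : m ≤ B 1 * B 2 := (min_le_right _ _).trans (min_le_right _ _)
    intro i j hij
    fin_cases i <;> fin_cases j <;>
      first
      | exact absurd rfl hij
      | assumption
      | exact (by assumption : m ≤ _).trans_eq (mul_comm _ _)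
  have h := hK (fun i => (hA i).le) (fun i => (hB i).le) (fun i => (hC i).le) m hm1 hm S
    fun x hx => by
      obtain ⟨-, hb, -, ha0, hb0, hc0, heq, hA', hB', hC', hac, hcc, ha, habb⟩ := hS x hx
      exact ⟨isPt_of_gcd_conditions hb ha0 hb0 hc0 heq hac hcc ha habb, hA', hB', hC'⟩
  simp only [Fin.prod_univ_three] at h
  rw [Real.rpow_neg (by linarith)] at h
  simp only [div_eq_mul_inv (_ : ℝ) (m ^ (1 / 16 : ℝ))]
  exact h.trans_eq (by ring)
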